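/- There exists a universal R₀ ∈ (0, 1/2] such that the following holds. Let K ≥ 0 and let u be a C² function on B_1 with |u| ≤ 1 satisfying 𝓛u = Vu pointwise in B_1, where V satisfies |V(z,t)| ≤ K ψ(z,t) on B_1, and assume ∫_{B_{R₀/4}} u² ψ > 0. Then there exist constants C₁, C₂ > 0, depending only on universal quantities and on ∫_{B_{R₀/4}} u² ψ, such that for all 0 < r < R₀/9 one has sup_{B_r} |u| ≥ C₁ (r/R₀)^{C₂ (K^{2/3}+1)}. -/

import Mathlib

open MeasureTheory Real Set Filter Asymptotics

noncomputable section

/-- The underlying space ℝ^m × ℝ^k. -/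
abbrev E (m k : ℕ) : Type :=
  EuclideanSpace ℝ (Fin m) × EuclideanSpace ℝ (Fin k)

namespace BG

variable {m k : ℕ}

/-- The Baouendi–Grushin gauge ρ. -/
def rho (γ : ℝ) (p : E m k) : ℝ :=
  (‖p.1‖ ^ (2 * (γ + 1)) + (γ + 1) ^ 2 * ‖p.2‖ ^ 2) ^ (1 / (2 * (γ + 1)))

/-- The angle function ψ = |z|^{2γ}/ρ^{2γ}. -/
def psi (γ : ℝ) (p : E m k) : ℝ :=
  ‖p.1‖ ^ (2 * γ) / rho γ p ^ (2 * γ)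

/-- The gauge ball B_r = {ρ < r}. -/
def ball (γ r : ℝ) : Set (E m k) := {p | rho γ p < r}

/-- The Baouendi–Grushin vector fields as direction fields:
X_i = ∂_{z_i} for i < m, X_{m+j} = |z|^γ ∂_{t_j}. -/
def Xvec (γ : ℝ) (p : E m k) (i : Fin (m + k)) : E m k :=
  if h : (i : ℕ) < m then (EuclideanSpace.single ⟨(i : ℕ), h⟩ 1, 0)
  else (0, EuclideanSpace.single ⟨(i : ℕ) - m, by have := i.isLt; omega⟩ (‖p.1‖ ^ γ))

/-- Derivative along the i-th Baouendi–Grushin vector field. -/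
def Xd (γ : ℝ) (i : Fin (m + k)) (f : E m k → ℝ) (p : E m k) : ℝ :=
  fderiv ℝ f p (Xvec γ p i)

/-- The quadratic form ⟨A Xu, Xu⟩. -/
def quadA (γ : ℝ) (A : E m k → Matrix (Fin (m + k)) (Fin (m + k)) ℝ)
    (u : E m k → ℝ) (p : E m k) : ℝ :=
  ∑ i, ∑ j, A p i j * Xd γ i u p * Xd γ j u p

/-- μ = ⟨A Xρ, Xρ⟩. -/
def mu (γ : ℝ) (A : E m k → Matrix (Fin (m + k)) (Fin (m + k)) ℝ) (p : E m k) : ℝ :=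
  quadA γ A (rho γ) p

/-- The operator 𝓛 u = Σ_{i,j} X_i(a_{ij} X_j u). -/
def Lop (γ : ℝ) (A : E m k → Matrix (Fin (m + k)) (Fin (m + k)) ℝ)
    (u : E m k → ℝ) (p : E m k) : ℝ :=
  ∑ i, ∑ j, Xd γ i (fun q => A q i j * Xd γ j u q) p

/-- The vector field F = (ρ/μ) Σ a_{ij} X_iρ X_j, as a first order operator. -/
def Fop (γ : ℝ) (A : E m k → Matrix (Fin (m + k)) (Fin (m + k)) ℝ)
    (v : E m k → ℝ) (p : E m k) : ℝ :=
  rho γ p / mu γ A p * ∑ i, ∑ j, A p i j * Xd γ i (rho γ) p * Xd γ j v p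

/-- The Baouendi–Grushin operator 𝓑_γ = Δ_z + |z|^{2γ} Δ_t = Σ_i X_i X_i. -/
def Bop (γ : ℝ) (u : E m k → ℝ) (p : E m k) : ℝ :=
  ∑ i : Fin (m + k), Xd γ i (Xd γ i u) p

/-- The generator of anisotropic dilations Z = Σ z_i ∂_{z_i} + (γ+1) Σ t_j ∂_{t_j},
as a first order operator: the derivative in the direction (z, (γ+1) t). -/
def Zd (γ : ℝ) (v : E m k → ℝ) (p : E m k) : ℝ :=
  fderiv ℝ v p (p.1, (γ + 1) • p.2)

/-- The Euclidean divergence of a vector field on ℝ^m × ℝ^k. -/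
def divV (V : E m k → E m k) (p : E m k) : ℝ :=
  (∑ i : Fin m, (fderiv ℝ V p (EuclideanSpace.single i 1, 0)).1 i) +
    ∑ j : Fin k,
      (fderiv ℝ V p ((0 : EuclideanSpace ℝ (Fin m)), EuclideanSpace.single j 1)).2 j

/-- Uniform ellipticity: λ|η|² ≤ ⟨Aη,η⟩ ≤ λ⁻¹|η|². -/
def Elliptic (lam : ℝ) (A : E m k → Matrix (Fin (m + k)) (Fin (m + k)) ℝ) : Prop :=
  ∀ (p : E m k) (η : Fin (m + k) → ℝ),
    lam * ∑ i, η i ^ 2 ≤ ∑ i, ∑ j, A p i j * η i * η j ∧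
      ∑ i, ∑ j, A p i j * η i * η j ≤ lam⁻¹ * ∑ i, η i ^ 2

/-- Symmetry of the matrix A. -/
def Symm (A : E m k → Matrix (Fin (m + k)) (Fin (m + k)) ℝ) : Prop :=
  ∀ p i j, A p i j = A p j i

/-- The entries of A are C¹. -/
def C1coeff (A : E m k → Matrix (Fin (m + k)) (Fin (m + k)) ℝ) : Prop :=
  ∀ i j, ContDiff ℝ 1 fun p => A p i j

/-- The structural hypothesis (H) on B = A - I, in B_1. -/
def HypH (γ Λ : ℝ) (A : E m k → Matrix (Fin (m + k)) (Fin (m + k)) ℝ) : Prop :=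
  ∀ p ∈ ball (m := m) (k := k) γ 1,
    (∀ i j : Fin (m + k),
        |(A p - 1) i j| ≤
          if (i : ℕ) < m ∧ (j : ℕ) < m then Λ * rho γ p
          else Λ * psi γ p ^ ((1 : ℝ) / 2 + 1 / (2 * γ)) * rho γ p) ∧
      ∀ l i j : Fin (m + k),
        |Xd γ l (fun q => (A q - 1) i j) p| ≤
          if (l : ℕ) < m ∧ (i : ℕ) < m ∧ (j : ℕ) < m then Λ
          else if m ≤ (l : ℕ) ∧ (m ≤ (i : ℕ) ∨ m ≤ (j : ℕ)) then
            Λ * psi γ p ^ ((1 : ℝ) + 1 / (2 * γ))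
          else Λ * psi γ p ^ ((1 : ℝ) / 2)

end BG

namespace BG

lemma ibp_line {F : Type*} [NormedAddCommGroup F] [NormedSpace ℝ F] [MeasurableSpace F]
    [BorelSpace F] [FiniteDimensional ℝ F] (μ : Measure F) [μ.IsAddHaarMeasure]
    (f f' : F → ℝ) (v : F) (M : ℝ)
    (hf : Integrable f μ) (hfm : Measurable f') (hfi : Integrable f' μ)
    (hM : ∀ x, |f' x| ≤ M)
    (h : ∀ᵐ x ∂μ, Continuous (fun s : ℝ => f (x + s • v)) ∧
      ∃ S : Set ℝ, S.Countable ∧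
        ∀ s ∉ S, HasDerivAt (fun s : ℝ => f (x + s • v)) (f' (x + s • v)) s) :
    ∫ x, f' x ∂μ = 0 := by
  have hs : SecondCountableTopology F := inferInstance
  have hmeas : Measurable (fun q : F × ℝ => f' (q.1 + q.2 • v)) := by
    apply hfm.comp
    exact (measurable_fst.add (measurable_snd.smul_const v))
  have hint : Integrable (fun q : F × ℝ => f' (q.1 + q.2 • v))
      (μ.prod (volume.restrict (Ioc (0:ℝ) 1))) := by
    rw [integrable_prod_iff' hmeas.aestronglyMeasurable]
    constructor
    · refine Eventually.of_forall fun s => ?_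
      exact hfi.comp_add_right (s • v)
    · have : (fun s : ℝ => ∫ x, ‖f' (x + s • v)‖ ∂μ) = fun s => ∫ x, ‖f' x‖ ∂μ := by
        funext s
        exact integral_add_right_eq_self (fun x => ‖f' x‖) (s • v)
      simp only [this]
      exact integrable_const _
  have h1 : ∀ᵐ x ∂μ, f (x + v) - f x = ∫ s in Ioc (0:ℝ) 1, f' (x + s • v) := by
    filter_upwards [h] with x hx
    obtain ⟨hc, S, hS, hd⟩ := hx
    have hii : IntervalIntegrable (fun s : ℝ => f' (x + s • v)) volume 0 1 := by
      rw [intervalIntegrable_iff_integrableOn_Ioc_of_le zero_le_one]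
      refine Measure.integrableOn_of_bounded (M := M) (by simp) ?_ ?_
      · exact (hfm.comp (measurable_const.add (measurable_id.smul_const v))).aestronglyMeasurable
      · exact Eventually.of_forall fun s => hM _
    have := integral_eq_of_hasDerivAt_off_countable (fun s : ℝ => f (x + s • v))
      (fun s : ℝ => f' (x + s • v)) hS hc.continuousOn (fun s hs => hd s hs.2) hii
    rw [intervalIntegral.integral_of_le zero_le_one] at this
    rw [this]; simp
  have h2 : ∫ x, (f (x + v) - f x) ∂μ = 0 := by
    rw [integral_sub (hf.comp_add_right v) hf, integral_add_right_eq_self f v, sub_self]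
  rw [integral_congr_ae h1] at h2
  rw [integral_integral_swap hint] at h2
  have h3 : ∀ s : ℝ, ∫ x, f' (x + s • v) ∂μ = ∫ x, f' x ∂μ := fun s =>
    integral_add_right_eq_self f' (s • v)
  simpa [h3] using h2

end BG

namespace BG
variable {m k : ℕ}

def gam (γ : ℝ) (i : Fin (m + k)) : ℝ := if (i : ℕ) < m then 0 else γ

def ev (i : Fin (m + k)) : E m k :=
  if h : (i : ℕ) < m then (EuclideanSpace.single ⟨(i : ℕ), h⟩ 1, 0)
  else (0, EuclideanSpace.single ⟨(i : ℕ) - m, by have := i.isLt; omega⟩ 1)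

def om (γ : ℝ) (i : Fin (m + k)) (p : E m k) : ℝ := if (i : ℕ) < m then 1 else ‖p.1‖ ^ γ

def co (i : Fin (m + k)) : E m k →L[ℝ] ℝ :=
  if h : (i : ℕ) < m then
    (EuclideanSpace.proj (𝕜 := ℝ) (⟨(i : ℕ), h⟩ : Fin m)).comp (ContinuousLinearMap.fst ℝ _ _)
  else (EuclideanSpace.proj (𝕜 := ℝ)
    (⟨(i : ℕ) - m, by have := i.isLt; omega⟩ : Fin k)).comp (ContinuousLinearMap.snd ℝ _ _)

def yy (γ : ℝ) (i : Fin (m + k)) (p : E m k) : ℝ := (1 + gam γ i) * co i p / om γ i p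

def nu (i : Fin (m + k)) (p : E m k) : ℝ := if (i : ℕ) < m then co i p / ‖p.1‖ ^ 2 else 0

def hh (γ : ℝ) (p : E m k) : ℝ := ‖p.1‖ ^ (2 * (γ + 1)) + (γ + 1) ^ 2 * ‖p.2‖ ^ 2

def tau (γ : ℝ) (p : E m k) : ℝ := ‖p.1‖ ^ (2 * γ) / hh γ p

def sl (γ : ℝ) (p : E m k) : ℝ := Real.log (rho γ p)

def QQ (m k : ℕ) (γ : ℝ) : ℝ := m + (γ + 1) * k

lemma Xvec_eq (γ : ℝ) (p : E m k) (i : Fin (m + k)) : Xvec γ p i = om γ i p • ev i := by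
  unfold Xvec om ev
  split_ifs with h
  · simp
  · ext j <;> simp

lemma Xd_eq (γ : ℝ) (i : Fin (m + k)) (f : E m k → ℝ) (p : E m k) :
    Xd γ i f p = om γ i p * fderiv ℝ f p (ev i) := by
  unfold Xd; rw [Xvec_eq, map_smul, smul_eq_mul]

lemma sum_split (f : Fin (m + k) → ℝ) :
    ∑ i, f i = (∑ i : Fin m, f (Fin.castAdd k i)) + ∑ j : Fin k, f (Fin.natAdd m j) :=
  Fin.sum_univ_add f

@[simp] lemma gam_l (γ : ℝ) (i : Fin m) : gam γ (Fin.castAdd k i) = 0 := by simp [gam]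
@[simp] lemma gam_r (γ : ℝ) (i : Fin k) : gam γ (Fin.natAdd m i) = γ := by simp [gam]
@[simp] lemma co_l (i : Fin m) (p : E m k) : co (Fin.castAdd k i) p = p.1 i := by
  simp [co]
@[simp] lemma co_r (i : Fin k) (p : E m k) : co (Fin.natAdd m i) p = p.2 i := by
  simp [co]
@[simp] lemma om_l (γ : ℝ) (i : Fin m) (p : E m k) : om γ (Fin.castAdd k i) p = 1 := by
  simp [om]
@[simp] lemma om_r (γ : ℝ) (i : Fin k) (p : E m k) : om γ (Fin.natAdd m i) p = ‖p.1‖ ^ γ := by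
  simp [om]
@[simp] lemma ev_l (i : Fin m) : ev (k := k) (Fin.castAdd k i) = (EuclideanSpace.single i 1, 0) := by
  simp [ev]
@[simp] lemma ev_r (i : Fin k) : ev (m := m) (Fin.natAdd m i) = (0, EuclideanSpace.single i 1) := by
  simp [ev]
@[simp] lemma nu_l (i : Fin m) (p : E m k) : nu (Fin.castAdd k i) p = p.1 i / ‖p.1‖ ^ 2 := by
  simp [nu]
@[simp] lemma nu_r (i : Fin k) (p : E m k) : nu (Fin.natAdd m i) p = 0 := by
  simp [nu]
@[simp] lemma yy_l (γ : ℝ) (i : Fin m) (p : E m k) : yy γ (Fin.castAdd k i) p = p.1 i := by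
  simp [yy]
@[simp] lemma yy_r (γ : ℝ) (i : Fin k) (p : E m k) :
    yy γ (Fin.natAdd m i) p = (1 + γ) * p.2 i / ‖p.1‖ ^ γ := by
  simp [yy]

lemma co_ev (i j : Fin (m + k)) : co i (ev j) = if i = j then 1 else 0 := by
  refine Fin.addCases (fun i => ?_) (fun i => ?_) i <;>
  refine Fin.addCases (fun j => ?_) (fun j => ?_) j
  · simp [Fin.ext_iff]
  · have : ¬ (Fin.castAdd k i = Fin.natAdd m j) := by
      intro h; have := congrArg Fin.val h; simp at this; omega
    simp [this]
  · have : ¬ (Fin.natAdd m i = Fin.castAdd k j) := by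
      intro h; have := congrArg Fin.val h; simp at this; omega
    simp [this]
  · simp [Fin.ext_iff]

lemma sum_gam (γ : ℝ) : ∑ i : Fin (m + k), (1 + gam γ i) = QQ m k γ := by
  rw [sum_split]; simp [QQ]; ring

lemma gam_nonneg {γ : ℝ} (hγ : 0 < γ) (i : Fin (m + k)) : 0 ≤ gam γ i := by
  unfold gam; split_ifs <;> linarith
lemma gam_le {γ : ℝ} (hγ : 0 < γ) (i : Fin (m + k)) : gam γ i ≤ γ := by
  unfold gam; split_ifs <;> linarith

lemma gam_nu (γ : ℝ) (i : Fin (m + k)) (p : E m k) : gam γ i * nu i p = 0 := by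
  unfold gam nu; split_ifs <;> simp

section pt
variable {γ : ℝ} (hγ : 0 < γ) {p : E m k} (hp : p.1 ≠ 0)
include hγ hp

lemma N_pos : 0 < ‖p.1‖ := by
  have := hγ; exact norm_pos_iff.mpr hp

lemma om_pos (i : Fin (m + k)) : 0 < om γ i p := by
  unfold om; split_ifs
  · exact one_pos
  · exact rpow_pos_of_pos (N_pos hγ hp) _

lemma hh_pos : 0 < hh γ p := by
  have := rpow_pos_of_pos (N_pos hγ hp) (2 * (γ + 1))
  unfold hh; positivity

lemma rho_pos : 0 < rho γ p := rpow_pos_of_pos (hh_pos hγ hp) _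

lemma tau_pos : 0 < tau γ p :=
  div_pos (rpow_pos_of_pos (N_pos hγ hp) _) (hh_pos hγ hp)

lemma exp_sl : Real.exp (sl γ p) = rho γ p := Real.exp_log (rho_pos hγ hp)

omit hp in
lemma rho_pow (p : E m k) : rho γ p ^ (2 * (γ + 1)) = hh γ p := by
  have h0 : 0 ≤ hh γ p := by unfold hh; positivity
  change (hh γ p ^ (1 / (2 * (γ + 1)))) ^ (2 * (γ + 1)) = _
  rw [← rpow_mul h0]
  rw [one_div_mul_cancel (by positivity), rpow_one]

omit hp in
lemma rho_nonneg (p : E m k) : 0 ≤ rho γ p := by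
  have h0 : 0 ≤ hh γ p := by unfold hh; positivity
  exact rpow_nonneg h0 _

omit hp in
lemma N_le_rho (p : E m k) : ‖p.1‖ ≤ rho γ p := by
  have h1 : ‖p.1‖ ^ (2 * (γ + 1)) ≤ rho γ p ^ (2 * (γ + 1)) := by
    rw [rho_pow hγ]; unfold hh
    have : 0 ≤ (γ + 1) ^ 2 * ‖p.2‖ ^ 2 := by positivity
    linarith
  exact (rpow_le_rpow_iff (norm_nonneg _) (rho_nonneg hγ p) (by positivity)).mp h1

lemma psi_eq : psi γ p = tau γ p * rho γ p ^ 2 := by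
  unfold psi tau
  rw [← rho_pow hγ p]
  have h := rho_pos hγ hp
  have e : rho γ p ^ (2 * (γ + 1)) = rho γ p ^ (2 * γ) * rho γ p ^ (2:ℕ) := by
    rw [← rpow_natCast, ← rpow_add h]; congr 1; push_cast; ring
  rw [e]
  have := rpow_pos_of_pos h (2 * γ)
  field_simp

lemma psi_pos : 0 < psi γ p := by
  rw [psi_eq hγ hp]; exact mul_pos (tau_pos hγ hp) (pow_pos (rho_pos hγ hp) 2)

omit hp in
lemma psi_nonneg (p : E m k) : 0 ≤ psi γ p :=
  div_nonneg (rpow_nonneg (norm_nonneg _) _) (rpow_nonneg (rho_nonneg hγ p) _)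

omit hp in
lemma psi_le_one (p : E m k) : psi γ p ≤ 1 := by
  unfold psi
  apply div_le_one_of_le₀ _ (rpow_nonneg (rho_nonneg hγ p) _)
  exact rpow_le_rpow (norm_nonneg _) (N_le_rho hγ p) (by positivity)

lemma sum_y_sq : tau γ p * ∑ i, yy γ i p ^ 2 = 1 := by
  have hN := N_pos hγ hp
  rw [sum_split]
  simp only [yy_l, yy_r]
  have e1 : ∑ i : Fin m, p.1 i ^ 2 = ‖p.1‖ ^ 2 := by
    rw [EuclideanSpace.norm_sq_eq]; simp
  have e2 : ∑ i : Fin k, ((1 + γ) * p.2 i / ‖p.1‖ ^ γ) ^ 2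
      = (1 + γ) ^ 2 / ‖p.1‖ ^ (2 * γ) * ‖p.2‖ ^ 2 := by
    rw [EuclideanSpace.norm_sq_eq, Finset.mul_sum]
    apply Finset.sum_congr rfl
    intro i _
    rw [mul_comm 2 γ, rpow_mul hN.le]
    simp [div_pow, mul_pow]; ring
  rw [e1, e2]
  have hh0 := hh_pos hγ hp
  have e3 : hh γ p = ‖p.1‖ ^ (2 * γ) * ‖p.1‖ ^ 2 + (γ + 1) ^ 2 * ‖p.2‖ ^ 2 := by
    unfold hh
    rw [← rpow_natCast ‖p.1‖ 2, ← rpow_add hN]; congr 2; push_cast; ring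
  have h4 := rpow_pos_of_pos hN (2 * γ)
  unfold tau
  rw [div_mul_eq_mul_div, div_eq_one_iff_eq hh0.ne', e3]
  field_simp
  ring

lemma sum_nu_y : ∑ i, nu i p * yy γ i p = 1 := by
  have hN := N_pos hγ hp
  rw [sum_split]
  simp only [nu_l, yy_l, nu_r, zero_mul, Finset.sum_const_zero, add_zero]
  have e1 : ∑ i : Fin m, p.1 i ^ 2 = ‖p.1‖ ^ 2 := by
    rw [EuclideanSpace.norm_sq_eq]; simp
  have : ∑ i : Fin m, p.1 i / ‖p.1‖ ^ 2 * p.1 i = (∑ i : Fin m, p.1 i ^ 2) / ‖p.1‖ ^ 2 := by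
    rw [Finset.sum_div]; apply Finset.sum_congr rfl; intro i _; ring
  rw [this, e1]; field_simp

lemma nu_le (i : Fin (m + k)) : |nu i p| ≤ 1 / ‖p.1‖ := by
  have hN := N_pos hγ hp
  refine Fin.addCases (fun i => ?_) (fun i => ?_) i
  · simp only [nu_l]
    rw [abs_div, abs_of_nonneg (by positivity : 0 ≤ ‖p.1‖ ^ 2)]
    have : |p.1 i| ≤ ‖p.1‖ := by simpa using PiLp.norm_apply_le p.1 i
    rw [div_le_div_iff₀ (by positivity) hN]
    nlinarith
  · simp only [nu_r]; simp

omit hp in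
lemma tau_N_sq (hp : p.1 ≠ 0) : tau γ p * ‖p.1‖ ^ 2 ≤ 1 := by
  rw [← sum_y_sq hγ hp]
  apply mul_le_mul_of_nonneg_left _ (tau_pos hγ hp).le
  rw [sum_split]
  have e1 : ∑ i : Fin m, p.1 i ^ 2 = ‖p.1‖ ^ 2 := by
    rw [EuclideanSpace.norm_sq_eq]; simp
  simp only [yy_l]
  rw [e1]
  have : 0 ≤ ∑ j : Fin k, yy γ (Fin.natAdd m j) p ^ 2 := Finset.sum_nonneg fun _ _ => sq_nonneg _
  linarith

/-- differentiability -/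
lemma diff_N (a : ℝ) : HasFDerivAt (fun q : E m k => ‖q.1‖ ^ a)
    ((a * ‖p.1‖ ^ (a - 2)) • (innerSL ℝ p.1).comp (ContinuousLinearMap.fst ℝ _ _)) p := by
  have hN := N_pos hγ hp
  have h1 : HasFDerivAt (fun q : E m k => ‖q.1‖ ^ 2)
      (2 • (innerSL ℝ p.1).comp (ContinuousLinearMap.fst ℝ _ _)) p :=
    (hasFDerivAt_fst (𝕜 := ℝ) (p := p)).norm_sq
  have h2 := h1.rpow_const (p := a / 2) (Or.inl (by positivity))
  have e : (fun q : E m k => ‖q.1‖ ^ a) = fun q => (‖q.1‖ ^ 2) ^ (a / 2) := by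
    funext q
    rw [← rpow_natCast, ← rpow_mul (norm_nonneg _)]; congr 1; push_cast; ring
  rw [e]
  refine h2.congr_fderiv ?_
  rw [← rpow_natCast, ← rpow_mul (norm_nonneg _)]
  ext v
  · simp
    rw [show (2:ℝ) * (a / 2 - 1) = a - 2 by ring]; ring
  · simp

lemma Xd_N (a : ℝ) (i : Fin (m + k)) : Xd γ i (fun q : E m k => ‖q.1‖ ^ a) p
    = a * ‖p.1‖ ^ a * nu i p := by
  have hN := N_pos hγ hp
  rw [Xd_eq, (diff_N hγ hp a).fderiv]
  refine Fin.addCases (fun i => ?_) (fun i => ?_) i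
  · simp only [om_l, ev_l, nu_l]
    rw [rpow_sub hN]
    simp [EuclideanSpace.inner_single_right]
    ring
  · simp

lemma diff_hh : HasFDerivAt (fun q : E m k => hh γ q)
    ((2 * (γ + 1) * ‖p.1‖ ^ (2 * (γ + 1) - 2)) •
        (innerSL ℝ p.1).comp (ContinuousLinearMap.fst ℝ _ _)
      + (γ + 1) ^ 2 • (2 • (innerSL ℝ p.2).comp (ContinuousLinearMap.snd ℝ _ _))) p := by
  have h1 := diff_N hγ hp (2 * (γ + 1))
  have h2 : HasFDerivAt (fun q : E m k => ‖q.2‖ ^ 2)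
      (2 • (innerSL ℝ p.2).comp (ContinuousLinearMap.snd ℝ _ _)) p :=
    (hasFDerivAt_snd (𝕜 := ℝ) (p := p)).norm_sq
  exact h1.add (h2.const_mul ((γ + 1) ^ 2))

lemma Xd_hh (i : Fin (m + k)) : Xd γ i (hh γ) p
    = 2 * (γ + 1) * ‖p.1‖ ^ (2 * γ) * yy γ i p := by
  have hN := N_pos hγ hp
  rw [Xd_eq]
  have := (diff_hh hγ hp).fderiv
  change fderiv ℝ (hh γ) p = _ at this
  rw [this]
  have e3 : ‖p.1‖ ^ (2 * γ) = ‖p.1‖ ^ γ * ‖p.1‖ ^ γ := by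
    rw [← rpow_add hN]; congr 1; ring
  have h4 := rpow_pos_of_pos hN γ
  refine Fin.addCases (fun i => ?_) (fun i => ?_) i
  · simp [EuclideanSpace.inner_single_right]
    left; left; congr 1; ring
  · simp [EuclideanSpace.inner_single_right]
    rw [e3]; field_simp; ring

end pt
end BG

namespace BG
variable {m k : ℕ}

lemma Xd_mul {γ : ℝ} {p : E m k} {f g : E m k → ℝ} (i : Fin (m + k))
    (hf : DifferentiableAt ℝ f p) (hg : DifferentiableAt ℝ g p) :
    Xd γ i (fun q => f q * g q) p = f p * Xd γ i g p + g p * Xd γ i f p := by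
  unfold Xd; rw [fderiv_fun_mul hf hg]; simp

lemma Xd_add {γ : ℝ} {p : E m k} {f g : E m k → ℝ} (i : Fin (m + k))
    (hf : DifferentiableAt ℝ f p) (hg : DifferentiableAt ℝ g p) :
    Xd γ i (fun q => f q + g q) p = Xd γ i f p + Xd γ i g p := by
  unfold Xd; rw [fderiv_fun_add hf hg]; simp

lemma Xd_sub {γ : ℝ} {p : E m k} {f g : E m k → ℝ} (i : Fin (m + k))
    (hf : DifferentiableAt ℝ f p) (hg : DifferentiableAt ℝ g p) :
    Xd γ i (fun q => f q - g q) p = Xd γ i f p - Xd γ i g p := by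
  unfold Xd; rw [fderiv_fun_sub hf hg]; simp

lemma Xd_sum {ι : Type*} (s : Finset ι) {γ : ℝ} {p : E m k} {f : ι → E m k → ℝ} (i : Fin (m + k))
    (hf : ∀ j ∈ s, DifferentiableAt ℝ (f j) p) :
    Xd γ i (fun q => ∑ j ∈ s, f j q) p = ∑ j ∈ s, Xd γ i (f j) p := by
  unfold Xd; rw [fderiv_fun_sum hf]; simp

lemma Xd_comp {γ : ℝ} {p : E m k} {f : E m k → ℝ} {φ : ℝ → ℝ} {d : ℝ} (i : Fin (m + k))
    (hf : DifferentiableAt ℝ f p) (hφ : HasDerivAt φ d (f p)) :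
    Xd γ i (fun q => φ (f q)) p = d * Xd γ i f p := by
  unfold Xd
  have := (hφ.comp_hasFDerivAt p hf.hasFDerivAt).fderiv
  change fderiv ℝ (fun q => φ (f q)) p = _ at this
  rw [this]; simp

lemma Xd_congr {γ : ℝ} {p : E m k} {f g : E m k → ℝ} (i : Fin (m + k))
    (h : f =ᶠ[nhds p] g) : Xd γ i f p = Xd γ i g p := by
  unfold Xd; rw [h.fderiv_eq]

lemma Xd_const_mul {γ : ℝ} {p : E m k} {f : E m k → ℝ} (c : ℝ) (i : Fin (m + k))
    (hf : DifferentiableAt ℝ f p) :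
    Xd γ i (fun q => c * f q) p = c * Xd γ i f p := by
  unfold Xd; rw [fderiv_const_mul hf]; simp

lemma isOpen_Om : IsOpen {p : E m k | p.1 ≠ 0} :=
  isOpen_ne_fun continuous_fst continuous_const

lemma Xd_co (γ : ℝ) (i j : Fin (m + k)) (p : E m k) :
    Xd γ i (fun q => co j q) p = if j = i then om γ i p else 0 := by
  rw [Xd_eq]
  have : fderiv ℝ (fun q : E m k => co j q) p = co j := (co j).fderiv
  rw [this, co_ev]; simp

section pt
variable {γ : ℝ} (hγ : 0 < γ) {p : E m k} (hp : p.1 ≠ 0)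
include hγ hp

lemma da_hh : DifferentiableAt ℝ (hh γ) p := (diff_hh hγ hp).differentiableAt
lemma da_N (a : ℝ) : DifferentiableAt ℝ (fun q : E m k => ‖q.1‖ ^ a) p :=
  (diff_N hγ hp a).differentiableAt

lemma da_om (i : Fin (m + k)) : DifferentiableAt ℝ (om γ i) p := by
  by_cases h : (i : ℕ) < m
  · have : om γ i = fun _ : E m k => (1:ℝ) := by funext q; simp [om, h]
    rw [this]; exact differentiableAt_const _
  · have : om γ i = fun q : E m k => ‖q.1‖ ^ γ := by funext q; simp [om, h]
    rw [this]; exact da_N hγ hp γ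

lemma Xd_om (i j : Fin (m + k)) : Xd γ i (om γ j) p = gam γ j * nu i p * om γ j p := by
  by_cases h : (j : ℕ) < m
  · have : om γ j = fun _ : E m k => (1:ℝ) := by funext q; simp [om, h]
    rw [this]; simp [gam, h, Xd]
  · have : om γ j = fun q : E m k => ‖q.1‖ ^ γ := by funext q; simp [om, h]
    rw [this, Xd_N hγ hp]; simp [gam, h]; ring

lemma sl_eq : sl γ p = (1 / (2 * (γ + 1))) * Real.log (hh γ p) := by
  unfold sl
  change Real.log (hh γ p ^ (1 / (2 * (γ + 1)))) = _
  rw [Real.log_rpow (hh_pos hγ hp)]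

lemma sl_eventually : sl γ =ᶠ[nhds p] fun q => (1 / (2 * (γ + 1))) * Real.log (hh γ q) := by
  filter_upwards [isOpen_Om.mem_nhds hp] with q hq
  exact sl_eq hγ hq

lemma da_sl : DifferentiableAt ℝ (sl γ) p := by
  rw [(sl_eventually hγ hp).differentiableAt_iff]
  exact ((da_hh hγ hp).log (hh_pos hγ hp).ne').const_mul _

lemma Xd_sl (i : Fin (m + k)) : Xd γ i (sl γ) p = tau γ p * yy γ i p := by
  rw [Xd_congr i (sl_eventually hγ hp),
    Xd_const_mul _ _ ((da_hh hγ hp).log (hh_pos hγ hp).ne'),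
    Xd_comp i (da_hh hγ hp) (Real.hasDerivAt_log (hh_pos hγ hp).ne'), Xd_hh hγ hp]
  unfold tau
  have := hh_pos hγ hp
  have h2 : γ + 1 ≠ 0 := by positivity
  field_simp

lemma da_tau : DifferentiableAt ℝ (tau γ) p := by
  have e : tau γ = fun q : E m k => ‖q.1‖ ^ (2 * γ) * (hh γ q)⁻¹ := by
    funext q; unfold tau; rw [div_eq_mul_inv]
  rw [e]
  exact (da_N hγ hp _).fun_mul ((da_hh hγ hp).fun_inv (hh_pos hγ hp).ne')

lemma Xd_tau (i : Fin (m + k)) : Xd γ i (tau γ) p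
    = tau γ p * (2 * γ * nu i p - (2 * γ + 2) * tau γ p * yy γ i p) := by
  have e : tau γ = fun q : E m k => ‖q.1‖ ^ (2 * γ) * (hh γ q)⁻¹ := by
    funext q; unfold tau; rw [div_eq_mul_inv]
  have h0 := hh_pos hγ hp
  conv_lhs => rw [e]
  rw [Xd_mul i (da_N hγ hp _) ((da_hh hγ hp).fun_inv h0.ne'),
    Xd_comp i (da_hh hγ hp) (hasDerivAt_inv h0.ne'), Xd_hh hγ hp, Xd_N hγ hp]
  unfold tau
  field_simp
  ring

lemma da_y (i : Fin (m + k)) : DifferentiableAt ℝ (yy γ i) p := by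
  have e : yy γ i = fun q : E m k => (1 + gam γ i) * (co i q * (om γ i q)⁻¹) := by
    funext q; unfold yy; rw [mul_div_assoc, div_eq_mul_inv]
  rw [e]
  have d1 : DifferentiableAt ℝ (fun q : E m k => co i q) p := (co i).differentiableAt
  exact (d1.fun_mul ((da_om hγ hp i).fun_inv (om_pos hγ hp i).ne')).const_mul _

lemma Xd_y (l i : Fin (m + k)) : Xd γ l (yy γ i) p
    = (if l = i then 1 + gam γ i else 0) - gam γ i * nu l p * yy γ i p := by
  have e : yy γ i = fun q : E m k => (1 + gam γ i) * (co i q * (om γ i q)⁻¹) := by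
    funext q; unfold yy; rw [mul_div_assoc, div_eq_mul_inv]
  have h0 := om_pos hγ hp i
  conv_lhs => rw [e]
  have d1 : DifferentiableAt ℝ (fun q : E m k => co i q) p := (co i).differentiableAt
  have d2 : DifferentiableAt ℝ (fun q : E m k => (om γ i q)⁻¹) p := (da_om hγ hp i).fun_inv h0.ne'
  rw [Xd_const_mul _ _ (d1.fun_mul d2), Xd_mul l d1 d2,
    Xd_comp l (da_om hγ hp i) (hasDerivAt_inv h0.ne'), Xd_co, Xd_om hγ hp]
  unfold yy
  by_cases h : i = l
  · subst h; simp; field_simp; ring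
  · have h' : ¬ l = i := fun e => h e.symm
    simp [h, h']; field_simp

lemma Xd_rad {φ : ℝ → ℝ} {d : ℝ} (i : Fin (m + k)) (hφ : HasDerivAt φ d (sl γ p)) :
    Xd γ i (fun q => φ (sl γ q)) p = d * (tau γ p * yy γ i p) := by
  rw [Xd_comp i (da_sl hγ hp) hφ, Xd_sl hγ hp]

end pt

/-- second derivatives -/
lemma Xd_fun_eq (γ : ℝ) (j : Fin (m + k)) (w : E m k → ℝ) :
    Xd γ j w = fun q => om γ j q * fderiv ℝ w q (ev j) := by
  funext q; exact Xd_eq γ j w q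

lemma da_fd {p : E m k} {w : E m k → ℝ} (hw : ContDiffAt ℝ 2 w p) (v : E m k) :
    DifferentiableAt ℝ (fun q => fderiv ℝ w q v) p := by
  have h1 : ContDiffAt ℝ 1 (fderiv ℝ w) p := hw.fderiv_right (by norm_num)
  exact (h1.differentiableAt (by norm_num)).clm_apply (differentiableAt_const v)

lemma fd_fd {p : E m k} {w : E m k → ℝ} (hw : ContDiffAt ℝ 2 w p) (v v' : E m k) :
    fderiv ℝ (fun q => fderiv ℝ w q v) p v' = fderiv ℝ (fderiv ℝ w) p v' v := by
  have h1 : ContDiffAt ℝ 1 (fderiv ℝ w) p := hw.fderiv_right (by norm_num)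
  have h2 := (h1.differentiableAt (by norm_num))
  rw [fderiv_clm_apply h2 (differentiableAt_const v)]
  simp

lemma da_W {γ : ℝ} (hγ : 0 < γ) {p : E m k} (hp : p.1 ≠ 0) {w : E m k → ℝ}
    (hw : ContDiffAt ℝ 2 w p) (j : Fin (m + k)) : DifferentiableAt ℝ (Xd γ j w) p := by
  rw [Xd_fun_eq]
  exact (da_om hγ hp j).fun_mul (da_fd hw _)

lemma Xd_Xd {γ : ℝ} (hγ : 0 < γ) {p : E m k} (hp : p.1 ≠ 0) {w : E m k → ℝ}
    (hw : ContDiffAt ℝ 2 w p) (i j : Fin (m + k)) :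
    Xd γ i (Xd γ j w) p = om γ i p * om γ j p * fderiv ℝ (fderiv ℝ w) p (ev i) (ev j)
      + gam γ j * nu i p * Xd γ j w p := by
  conv_lhs => rw [Xd_fun_eq γ j w]
  rw [Xd_mul i (da_om hγ hp j) (da_fd hw _), Xd_om hγ hp, Xd_eq γ i (fun q => _), fd_fd hw,
    Xd_eq γ j w]
  ring

lemma Xd_comm {γ : ℝ} (hγ : 0 < γ) {p : E m k} (hp : p.1 ≠ 0) {w : E m k → ℝ}
    (hw : ContDiffAt ℝ 2 w p) (i j : Fin (m + k)) :
    Xd γ i (Xd γ j w) p = Xd γ j (Xd γ i w) p + gam γ j * nu i p * Xd γ j w p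
      - gam γ i * nu j p * Xd γ i w p := by
  rw [Xd_Xd hγ hp hw, Xd_Xd hγ hp hw]
  have : fderiv ℝ (fderiv ℝ w) p (ev i) (ev j) = fderiv ℝ (fderiv ℝ w) p (ev j) (ev i) := by
    have h := hw.isSymmSndFDerivAt (by simp)
    exact h _ _
  rw [this]; ring

end BG

namespace BG
variable {m k : ℕ}

lemma y_le_N {γ : ℝ} (p : E m k) {i : Fin (m + k)} (hi : (i : ℕ) < m) :
    |yy γ i p| ≤ ‖p.1‖ := by
  have : yy γ i p = p.1 ⟨i, hi⟩ := by
    have h := yy_l (k := k) γ ⟨i, hi⟩ p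
    simpa using h
  rw [this]; simpa using PiLp.norm_apply_le p.1 ⟨i, hi⟩

lemma psi_y {γ : ℝ} (hγ : 0 < γ) {p : E m k} (hp : p.1 ≠ 0) (i : Fin (m + k)) :
    psi γ p ^ ((1:ℝ) / 2) * |yy γ i p| ≤ rho γ p := by
  have h1 : tau γ p * yy γ i p ^ 2 ≤ 1 := by
    rw [← sum_y_sq hγ hp]
    apply mul_le_mul_of_nonneg_left _ (tau_pos hγ hp).le
    exact Finset.single_le_sum (f := fun i => yy γ i p ^ 2) (fun _ _ => sq_nonneg _)
      (Finset.mem_univ i)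
  have hr := rho_pos hγ hp
  rw [← Real.sqrt_eq_rpow, ← Real.sqrt_sq_eq_abs, ← Real.sqrt_mul (psi_nonneg hγ p)]
  rw [Real.sqrt_le_left hr.le, psi_eq hγ hp]
  nlinarith [sq_nonneg (rho γ p)]

lemma psi_rho {γ : ℝ} (hγ : 0 < γ) {p : E m k} (hp : p.1 ≠ 0) :
    psi γ p ^ ((1:ℝ) / (2 * γ)) * rho γ p = ‖p.1‖ := by
  have hr := rho_pos hγ hp
  have hN := N_pos hγ hp
  unfold psi
  rw [div_rpow (by positivity) (by positivity), ← rpow_mul hN.le, ← rpow_mul hr.le]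
  have : 2 * γ * (1 / (2 * γ)) = 1 := by field_simp
  rw [this, rpow_one, rpow_one]; field_simp

structure PB (γ Λ : ℝ) (A : E m k → Matrix (Fin (m + k)) (Fin (m + k)) ℝ) (p : E m k) : Prop where
  b : ∀ i j, |(A p - 1) i j| ≤ Λ * rho γ p
  by_ : ∀ i j, |(A p - 1) i j| * |yy γ i p| ≤ Λ * rho γ p * ‖p.1‖
  bg : ∀ i j, gam γ j * |(A p - 1) i j| ≤ γ * Λ * ‖p.1‖
  D : ∀ l i j, |Xd γ l (fun q => A q i j) p| ≤ Λ
  Dy : ∀ l i j, |Xd γ l (fun q => A q i j) p| * |yy γ i p| ≤ Λ * rho γ p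
  Dz : ∀ l i j, |Xd γ l (fun q => A q i j) p| * |yy γ l p| ≤ Λ * rho γ p

lemma PB_of_H {γ Λ : ℝ} (hγ : 0 < γ) (hΛ : 0 < Λ)
    {A : E m k → Matrix (Fin (m + k)) (Fin (m + k)) ℝ} (hH : HypH γ Λ A)
    {p : E m k} (hp : p.1 ≠ 0) (hp1 : rho γ p < 1) : PB γ Λ A p := by
  obtain ⟨h1, h2⟩ := hH p hp1
  have hr := rho_pos hγ hp
  have hN := N_pos hγ hp
  have hNr := N_le_rho hγ p
  have hps := psi_pos hγ hp
  have hps1 := psi_le_one hγ p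
  set P := psi γ p with hP
  have hh1 : P ^ ((1:ℝ) / 2) ≤ 1 := rpow_le_one hps.le hps1 (by norm_num)
  have hh0 : 0 ≤ P ^ ((1:ℝ) / 2) := by positivity
  have hg0 : 0 ≤ P ^ ((1:ℝ) / (2 * γ)) := by positivity
  have hg1 : P ^ ((1:ℝ) / (2 * γ)) ≤ 1 := rpow_le_one hps.le hps1 (by positivity)
  have e1 : P ^ ((1 : ℝ) / 2 + 1 / (2 * γ)) = P ^ ((1:ℝ) / 2) * P ^ ((1:ℝ) / (2 * γ)) :=
    rpow_add hps _ _
  have e2 : P ^ ((1 : ℝ) + 1 / (2 * γ)) = P * P ^ ((1:ℝ) / (2 * γ)) := by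
    rw [rpow_add hps, rpow_one]
  have hrN : P ^ ((1:ℝ) / (2 * γ)) * rho γ p = ‖p.1‖ := psi_rho hγ hp
  have hy := psi_y hγ hp
  have ePP : P ^ ((1:ℝ)/2) * P ^ ((1:ℝ)/2) = P := by
    rw [← rpow_add hps]; norm_num
  have hPle : P ≤ P ^ ((1:ℝ)/2) := by nlinarith
  have e3 : P ^ ((1 : ℝ) + 1 / (2 * γ)) ≤ P ^ ((1:ℝ)/2) := by
    rw [e2]; nlinarith
  -- mixed coefficient bound
  have hb2 : Λ * P ^ ((1 : ℝ) / 2 + 1 / (2 * γ)) * rho γ p = Λ * (P ^ ((1:ℝ)/2) * ‖p.1‖) := by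
    rw [e1, ← hrN]; ring
  have hX : ∀ l i j, Xd γ l (fun q => (A q - 1) i j) p = Xd γ l (fun q => A q i j) p := by
    intro l i j
    unfold Xd
    have : (fun q => (A q - 1) i j)
        = fun q => A q i j - (1 : Matrix (Fin (m + k)) (Fin (m + k)) ℝ) i j := by
      funext q; simp [Matrix.sub_apply]
    rw [this, fderiv_sub_const]
  have hmix : ∀ i j : Fin (m + k), ¬ ((i : ℕ) < m ∧ (j : ℕ) < m) →
      |(A p - 1) i j| ≤ Λ * (P ^ ((1:ℝ)/2) * ‖p.1‖) := by
    intro i j h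
    have := h1 i j
    rw [if_neg h, hb2] at this
    exact this
  have hball : ∀ i j, |(A p - 1) i j| ≤ Λ * rho γ p := by
    intro i j
    by_cases h : (i : ℕ) < m ∧ (j : ℕ) < m
    · have := h1 i j; rwa [if_pos h] at this
    · refine (hmix i j h).trans ?_
      apply mul_le_mul_of_nonneg_left _ hΛ.le
      nlinarith
  have hD : ∀ l i j, |Xd γ l (fun q => A q i j) p| ≤ Λ := by
    intro l i j
    have := h2 l i j
    rw [hX] at this
    refine this.trans ?_
    split_ifs
    · exact le_rfl
    · nlinarith
    · nlinarith
  have hD2 : ∀ l i j : Fin (m + k), ¬ ((l : ℕ) < m ∧ (i : ℕ) < m ∧ (j : ℕ) < m) →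
      |Xd γ l (fun q => A q i j) p| ≤ Λ * P ^ ((1:ℝ)/2) := by
    intro l i j h
    have := h2 l i j
    rw [hX, if_neg h] at this
    refine this.trans ?_
    split_ifs
    · exact mul_le_mul_of_nonneg_left e3 hΛ.le
    · exact le_rfl
  have hDgen : ∀ l i j q : Fin (m + k), (q = i ∨ q = l) →
      |Xd γ l (fun q => A q i j) p| * |yy γ q p| ≤ Λ * rho γ p := by
    intro l i j q hq
    by_cases h : (q : ℕ) < m
    · have := y_le_N (γ := γ) p h
      have h0 := abs_nonneg (yy γ q p)
      exact mul_le_mul (hD l i j) (this.trans hNr) h0 hΛ.le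
    · have h3 : ¬ ((l : ℕ) < m ∧ (i : ℕ) < m ∧ (j : ℕ) < m) := by
        rintro ⟨ha, hb, hc⟩; rcases hq with rfl | rfl <;> contradiction
      have h4 := mul_le_mul_of_nonneg_right (hD2 l i j h3) (abs_nonneg (yy γ q p))
      refine h4.trans ?_
      rw [mul_assoc]
      exact mul_le_mul_of_nonneg_left (hy q) hΛ.le
  refine ⟨hball, ?_, ?_, hD, fun l i j => hDgen l i j i (Or.inl rfl),
    fun l i j => hDgen l i j l (Or.inr rfl)⟩
  · intro i j
    by_cases h : (i : ℕ) < m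
    · exact mul_le_mul (hball i j) (y_le_N p h) (abs_nonneg _) (by positivity)
    · have h3 : ¬ ((i : ℕ) < m ∧ (j : ℕ) < m) := fun h' => h h'.1
      have h4 := mul_le_mul_of_nonneg_right (hmix i j h3) (abs_nonneg (yy γ i p))
      refine h4.trans ?_
      have := hy i
      calc Λ * (P ^ ((1:ℝ)/2) * ‖p.1‖) * |yy γ i p|
          = Λ * (P ^ ((1:ℝ)/2) * |yy γ i p|) * ‖p.1‖ := by ring
        _ ≤ Λ * rho γ p * ‖p.1‖ := by gcongr
  · intro i j
    by_cases h : (j : ℕ) < m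
    · simp [gam, h]; positivity
    · have h3 : ¬ ((i : ℕ) < m ∧ (j : ℕ) < m) := fun h' => h h'.2
      have h4 := hmix i j h3
      simp only [gam, h, if_false]
      rw [mul_assoc]
      apply mul_le_mul_of_nonneg_left _ hγ.le
      refine h4.trans ?_
      apply mul_le_mul_of_nonneg_left _ hΛ.le
      nlinarith

end BG

namespace BG
variable {m k : ℕ}

lemma sum_bd (f : Fin (m + k) → ℝ) (M : ℝ) (h : ∀ i, |f i| ≤ M) :
    |∑ i, f i| ≤ ((m + k : ℕ) : ℝ) * M := by
  refine (Finset.abs_sum_le_sum_abs _ _).trans ?_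
  refine (Finset.sum_le_sum (fun i _ => h i)).trans ?_
  simp

def cc (γ : ℝ) (A : E m k → Matrix (Fin (m + k)) (Fin (m + k)) ℝ) (j : Fin (m + k)) (p : E m k) : ℝ :=
  ∑ i, (A p i j - if i = j then 1 else 0) * yy γ i p

def ff (γ : ℝ) (A : E m k → Matrix (Fin (m + k)) (Fin (m + k)) ℝ) (j : Fin (m + k)) (p : E m k) : ℝ :=
  yy γ j p + cc γ A j p

def sg (γ : ℝ) (A : E m k → Matrix (Fin (m + k)) (Fin (m + k)) ℝ) (p : E m k) : ℝ :=
  1 + tau γ p * ∑ j, cc γ A j p * yy γ j p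

lemma ff_eq (γ : ℝ) (A : E m k → Matrix (Fin (m + k)) (Fin (m + k)) ℝ) (j : Fin (m + k)) (p : E m k) :
    ff γ A j p = ∑ i, A p i j * yy γ i p := by
  unfold ff cc
  simp [sub_mul, Finset.sum_sub_distrib]

structure GB (C γ : ℝ) (A : E m k → Matrix (Fin (m + k)) (Fin (m + k)) ℝ) (p : E m k) : Prop where
  c : ∀ j, |cc γ A j p| ≤ C * rho γ p * ‖p.1‖
  qf : ∀ j, √(tau γ p) * |ff γ A j p| ≤ C
  sg : |sg γ A p - 1| ≤ C * rho γ p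
  div : |∑ j, Xd γ j (ff γ A j) p - QQ m k γ| ≤ C * rho γ p
  ft : |∑ i, ff γ A i p * Xd γ i (tau γ) p + 2 * tau γ p| ≤ C * rho γ p * tau γ p
  fa : ∀ i j, |∑ l, ff γ A l p * Xd γ l (fun q => A q i j) p| ≤ C * rho γ p
  fs : |∑ l, ff γ A l p * Xd γ l (BG.sg γ A) p| ≤ C * rho γ p
  r : ∃ r : Fin (m + k) → Fin (m + k) → ℝ, (∀ i j, |r i j| ≤ C * rho γ p) ∧
    ∀ (W : Fin (m + k) → ℝ) (i : Fin (m + k)), ∑ j, Xd γ i (ff γ A j) p * W j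
      + ∑ j, ff γ A j p * (gam γ j * nu i p * W j - gam γ i * nu j p * W i)
      = W i + ∑ j, r i j * W j

section
variable {γ Λ : ℝ} (hγ : 0 < γ) (hΛ : 0 < Λ)
    {A : E m k → Matrix (Fin (m + k)) (Fin (m + k)) ℝ} {p : E m k} (hp : p.1 ≠ 0)
    (hA : C1coeff A)

include hA in
lemma da_A (i j : Fin (m + k)) : DifferentiableAt ℝ (fun q => A q i j) p :=
  ((hA i j).differentiable (by norm_num)).differentiableAt

include hA in
lemma da_b (i j : Fin (m + k)) :
    DifferentiableAt ℝ (fun q => A q i j - if i = j then (1:ℝ) else 0) p :=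
  (da_A hA i j).sub_const _

include hA in
lemma Xd_b (l i j : Fin (m + k)) :
    Xd γ l (fun q => A q i j - if i = j then (1:ℝ) else 0) p = Xd γ l (fun q => A q i j) p := by
  unfold Xd; rw [fderiv_sub_const]

include hγ hp hA

lemma da_cc (j : Fin (m + k)) : DifferentiableAt ℝ (cc γ A j) p := by
  unfold cc
  exact DifferentiableAt.fun_sum fun i _ => (da_b hA i j).fun_mul (da_y hγ hp i)

lemma da_ff (j : Fin (m + k)) : DifferentiableAt ℝ (ff γ A j) p := by
  unfold ff
  exact (da_y hγ hp j).fun_add (da_cc hγ hp hA j)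

lemma da_sg : DifferentiableAt ℝ (sg γ A) p := by
  unfold sg
  refine (differentiableAt_const _).fun_add ((da_tau hγ hp).fun_mul ?_)
  exact DifferentiableAt.fun_sum fun i _ => (da_cc hγ hp hA i).fun_mul (da_y hγ hp i)

lemma Xd_cc (l j : Fin (m + k)) : Xd γ l (cc γ A j) p =
    ∑ i, (Xd γ l (fun q => A q i j) p * yy γ i p
      + (A p i j - if i = j then 1 else 0) * (if l = i then 1 + gam γ i else 0)
      - (A p i j - if i = j then 1 else 0) * yy γ i p * (gam γ i * nu l p)) := by
  unfold cc
  rw [Xd_sum _ _ (fun i _ => (da_b hA i j).fun_mul (da_y hγ hp i))]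
  refine Finset.sum_congr rfl fun i _ => ?_
  rw [Xd_mul l (da_b hA i j) (da_y hγ hp i), Xd_b hA, Xd_y hγ hp]
  ring

lemma Xd_ff (l j : Fin (m + k)) : Xd γ l (ff γ A j) p =
    (if l = j then 1 + gam γ j else 0) - gam γ j * nu l p * yy γ j p + Xd γ l (cc γ A j) p := by
  unfold ff
  rw [Xd_add l (da_y hγ hp j) (da_cc hγ hp hA j), Xd_y hγ hp]

include hΛ in
lemma Xd_cc_le (h : PB γ Λ A p) (hp1 : rho γ p < 1) (l j : Fin (m + k)) :
    |Xd γ l (cc γ A j) p| ≤ ((m + k : ℕ) : ℝ) * (Λ + (1 + γ) * Λ + γ * Λ) * rho γ p := by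
  rw [Xd_cc hγ hp hA, mul_assoc]
  have hr := rho_pos hγ hp
  have hN := N_pos hγ hp
  apply sum_bd
  intro i
  have hb := h.b i j
  have hby := h.by_ i j
  have hD := h.Dy l i j
  simp only [Matrix.sub_apply, Matrix.one_apply] at hb hby
  set b := A p i j - if i = j then (1:ℝ) else 0
  have t1 : |Xd γ l (fun q => A q i j) p * yy γ i p| ≤ Λ * rho γ p := by rwa [abs_mul]
  have g0 := gam_nonneg hγ i
  have g1 := gam_le hγ i
  have t2 : |b * (if l = i then 1 + gam γ i else 0)| ≤ (1 + γ) * Λ * rho γ p := by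
    rw [abs_mul]
    have : |(if l = i then 1 + gam γ i else 0)| ≤ 1 + γ := by
      split_ifs
      · rw [abs_of_nonneg] <;> linarith
      · simp; linarith
    calc |b| * _ ≤ (Λ * rho γ p) * (1 + γ) := by gcongr
      _ = _ := by ring
  have t3 : |b * yy γ i p * (gam γ i * nu l p)| ≤ γ * Λ * rho γ p := by
    rw [abs_mul, abs_mul, abs_mul, abs_of_nonneg g0]
    calc |b| * |yy γ i p| * (gam γ i * |nu l p|) ≤ (Λ * rho γ p * ‖p.1‖) * (γ * (1 / ‖p.1‖)) := by
          gcongr; exact nu_le hγ hp l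
      _ = _ := by field_simp
  calc _ ≤ |Xd γ l (fun q => A q i j) p * yy γ i p| + |b * (if l = i then 1 + gam γ i else 0)|
        + |b * yy γ i p * (gam γ i * nu l p)| := (abs_sub _ _).trans (by gcongr; exact abs_add_le _ _)
    _ ≤ _ := by linarith
end

lemma qy_le {γ : ℝ} (hγ : 0 < γ) {p : E m k} (hp : p.1 ≠ 0) (i : Fin (m + k)) :
    √(tau γ p) * |yy γ i p| ≤ 1 := by
  have h1 : tau γ p * yy γ i p ^ 2 ≤ 1 := by
    rw [← sum_y_sq hγ hp]
    apply mul_le_mul_of_nonneg_left _ (tau_pos hγ hp).le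
    exact Finset.single_le_sum (f := fun i => yy γ i p ^ 2) (fun _ _ => sq_nonneg _)
      (Finset.mem_univ i)
  rw [← Real.sqrt_sq_eq_abs, ← Real.sqrt_mul (tau_pos hγ hp).le]
  rw [Real.sqrt_le_left (by norm_num)]; simpa using h1

lemma qN_le {γ : ℝ} (hγ : 0 < γ) {p : E m k} (hp : p.1 ≠ 0)  :
    √(tau γ p) * ‖p.1‖ ≤ 1 := by
  have h1 := tau_N_sq hγ hp
  rw [← abs_of_nonneg (norm_nonneg p.1), ← Real.sqrt_sq_eq_abs, ← Real.sqrt_mul (tau_pos hγ hp).le]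
  rw [Real.sqrt_le_left (by norm_num)]; simpa using h1

end BG

namespace BG
variable {m k : ℕ}

def C1 (m k : ℕ) (γ Λ : ℝ) : ℝ := ((m + k : ℕ) : ℝ) * (Λ + (1 + γ) * Λ + γ * Λ)

def CG (m k : ℕ) (γ Λ : ℝ) : ℝ :=
  let n : ℝ := ((m + k : ℕ) : ℝ)
  let B1 := C1 m k γ Λ
  let L := n * Λ
  L + (1 + L) + n * L + n * B1 + ((2 * γ) * (n * L) + (2 * γ + 2) * (n * L))
    + (n * Λ + n * (L * Λ))
    + ((2 + (2 * γ) * (n * L) + (2 * γ + 2) * (n * L)) * (n * L)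
      + n * (n * ((1 + L) * B1) + L * ((1 + γ) * (1 + L) + γ * (1 + n * L))))
    + (B1 + γ * L + γ * (n * L))

set_option maxHeartbeats 2000000 in
lemma GB_of_PB {γ Λ : ℝ} (hγ : 0 < γ) (hΛ : 0 < Λ)
    {A : E m k → Matrix (Fin (m + k)) (Fin (m + k)) ℝ} {p : E m k} (hp : p.1 ≠ 0)
    (hA : C1coeff A) (h : PB γ Λ A p) (hp1 : rho γ p < 1) : GB (CG m k γ Λ) γ A p := by
  have hr := rho_pos hγ hp
  have hN := N_pos hγ hp
  have hNr := N_le_rho hγ p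
  have ht := tau_pos hγ hp
  have hqq : √(tau γ p) * √(tau γ p) = tau γ p := Real.mul_self_sqrt ht.le
  have hq0 : 0 ≤ √(tau γ p) := Real.sqrt_nonneg _
  have hqy := qy_le hγ hp
  have hqN := qN_le hγ hp
  have hn0 : (0:ℝ) ≤ ((m + k : ℕ) : ℝ) := Nat.cast_nonneg _
  have hX : ∀ l j, |Xd γ l (cc γ A j) p| ≤ C1 m k γ Λ * rho γ p :=
    fun l j => Xd_cc_le hγ hΛ hp hA h hp1 l j
  have hB1 : 0 ≤ C1 m k γ Λ := by unfold C1; positivity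
  set n : ℝ := ((m + k : ℕ) : ℝ) with hn
  set B1 := C1 m k γ Λ with hB1'
  set L := n * Λ with hL
  have hL0 : 0 ≤ L := by positivity
  set q := √(tau γ p) with hq
  set R := rho γ p with hR
  set N := ‖p.1‖ with hNN
  -- c bound
  have hc : ∀ j, |cc γ A j p| ≤ L * R * N := by
    intro j
    have := sum_bd (fun i => (A p i j - if i = j then 1 else 0) * yy γ i p) (Λ * R * N) (by
      intro i
      have := h.by_ i j
      simp only [Matrix.sub_apply, Matrix.one_apply] at this
      rwa [abs_mul])
    calc _ ≤ n * (Λ * R * N) := this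
      _ = _ := by rw [hL]; ring
  have hqc : ∀ j, q * |cc γ A j p| ≤ L * R := by
    intro j
    calc q * |cc γ A j p| ≤ q * (L * R * N) := by gcongr; exact hc j
      _ = (L * R) * (q * N) := by ring
      _ ≤ (L * R) * 1 := by gcongr
      _ = _ := by ring
  have hqf : ∀ j, q * |ff γ A j p| ≤ 1 + L := by
    intro j
    calc q * |ff γ A j p| ≤ q * (|yy γ j p| + |cc γ A j p|) := by
          gcongr; exact abs_add_le _ _
      _ = q * |yy γ j p| + q * |cc γ A j p| := by ring
      _ ≤ 1 + L * R := by linarith [hqy j, hqc j]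
      _ ≤ 1 + L := by nlinarith
  have hcn : |∑ i, cc γ A i p * nu i p| ≤ n * (L * R) := by
    apply sum_bd
    intro i
    rw [abs_mul]
    calc |cc γ A i p| * |nu i p| ≤ (L * R * N) * (1 / N) := by
          gcongr; exacts [hc i, nu_le hγ hp i]
      _ = L * R := by field_simp
  have hfn : ∑ i, ff γ A i p * nu i p = 1 + ∑ i, cc γ A i p * nu i p := by
    rw [← sum_nu_y hγ hp, ← Finset.sum_add_distrib]
    refine Finset.sum_congr rfl fun i _ => ?_
    unfold ff; ring
  have hsg : |tau γ p * ∑ j, cc γ A j p * yy γ j p| ≤ n * (L * R) := by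
    rw [Finset.mul_sum]
    apply sum_bd
    intro j
    rw [abs_mul, abs_mul, abs_of_pos ht, ← hqq]
    calc q * q * (|cc γ A j p| * |yy γ j p|) = (q * |cc γ A j p|) * (q * |yy γ j p|) := by ring
      _ ≤ (L * R) * 1 := mul_le_mul (hqc j) (hqy j) (by positivity) (by positivity)
      _ = _ := by ring
  have hfy : tau γ p * ∑ i, ff γ A i p * yy γ i p = 1 + tau γ p * ∑ j, cc γ A j p * yy γ j p := by
    rw [← sum_y_sq hγ hp, ← mul_add, ← Finset.sum_add_distrib]
    congr 1
    refine Finset.sum_congr rfl fun i _ => ?_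
    unfold ff; ring
  have hft : ∑ i, ff γ A i p * Xd γ i (tau γ) p = tau γ p * (-2
      + (2 * γ) * (∑ i, cc γ A i p * nu i p)
      - (2 * γ + 2) * (tau γ p * ∑ j, cc γ A j p * yy γ j p)) := by
    have : ∑ i, ff γ A i p * Xd γ i (tau γ) p = tau γ p * ((2 * γ) * (∑ i, ff γ A i p * nu i p)
      - (2 * γ + 2) * (tau γ p * ∑ j, ff γ A j p * yy γ j p)) := by
      simp only [Finset.mul_sum, ← Finset.sum_sub_distrib]
      refine Finset.sum_congr rfl fun i _ => ?_
      rw [Xd_tau hγ hp]; ring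
    rw [this, hfy, hfn]; ring
  have hFc : ∀ j, q * |∑ l, ff γ A l p * Xd γ l (cc γ A j) p| ≤ n * ((1 + L) * (B1 * R)) := by
    intro j
    have : q * |∑ l, ff γ A l p * Xd γ l (cc γ A j) p|
        = |∑ l, q * (ff γ A l p * Xd γ l (cc γ A j) p)| := by
      rw [← Finset.mul_sum, abs_mul, abs_of_nonneg hq0]
    rw [this]
    apply sum_bd
    intro l
    rw [abs_mul, abs_mul, abs_of_nonneg hq0, ← mul_assoc]
    exact mul_le_mul (hqf l) (hX l j) (abs_nonneg _) (by positivity)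
  have hFy : ∀ j, ∑ l, ff γ A l p * Xd γ l (yy γ j) p = (1 + gam γ j) * ff γ A j p
      - gam γ j * yy γ j p * (1 + ∑ i, cc γ A i p * nu i p) := by
    intro j
    rw [← hfn, Finset.mul_sum]
    have : (1 + gam γ j) * ff γ A j p = ∑ l, ff γ A l p * (if l = j then 1 + gam γ j else 0) := by
      simp; ring
    rw [this, ← Finset.sum_sub_distrib]
    refine Finset.sum_congr rfl fun i _ => ?_
    rw [Xd_y hγ hp]; ring
  have hqFy : ∀ j, q * |∑ l, ff γ A l p * Xd γ l (yy γ j) p|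
      ≤ (1 + γ) * (1 + L) + γ * (1 + n * L) := by
    intro j
    rw [hFy]
    have g0 := gam_nonneg hγ j
    have g1 := gam_le hγ j
    have hone : |1 + ∑ i, cc γ A i p * nu i p| ≤ 1 + n * L := by
      refine (abs_add_le _ _).trans ?_
      rw [abs_one]
      have : n * (L * R) ≤ n * L := by
        have : L * R ≤ L := by nlinarith
        gcongr
      linarith
    calc _ ≤ q * (|(1 + gam γ j) * ff γ A j p|
          + |gam γ j * yy γ j p * (1 + ∑ i, cc γ A i p * nu i p)|) := by
          gcongr; exact abs_sub _ _
      _ = (1 + gam γ j) * (q * |ff γ A j p|) + gam γ j * (q * |yy γ j p|)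
          * |1 + ∑ i, cc γ A i p * nu i p| := by
          rw [abs_mul, abs_mul, abs_mul, abs_of_nonneg g0, abs_of_nonneg (by linarith : 0 ≤ 1 + gam γ j)]
          ring
      _ ≤ (1 + γ) * (1 + L) + γ * 1 * (1 + n * L) := by
          gcongr
          · exact hqf j
          · exact hqy j
      _ = _ := by ring
  -- the pieces of the constant
  have hCG : CG m k γ Λ = L + (1 + L) + n * L + n * B1 + ((2 * γ) * (n * L) + (2 * γ + 2) * (n * L))
    + (n * Λ + n * (L * Λ))
    + ((2 + (2 * γ) * (n * L) + (2 * γ + 2) * (n * L)) * (n * L)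
      + n * (n * ((1 + L) * B1) + L * ((1 + γ) * (1 + L) + γ * (1 + n * L))))
    + (B1 + γ * L + γ * (n * L)) := rfl
  have p1 : 0 ≤ n * L := by positivity
  have p2 : 0 ≤ n * B1 := by positivity
  have p3 : 0 ≤ (2 * γ) * (n * L) + (2 * γ + 2) * (n * L) := by positivity
  have p4 : 0 ≤ n * Λ + n * (L * Λ) := by positivity
  have p5 : 0 ≤ ((2 + (2 * γ) * (n * L) + (2 * γ + 2) * (n * L)) * (n * L)
      + n * (n * ((1 + L) * B1) + L * ((1 + γ) * (1 + L) + γ * (1 + n * L)))) := by positivity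
  have p6 : 0 ≤ B1 + γ * L + γ * (n * L) := by positivity
  have key : ∀ x c : ℝ, x ≤ c * R → c ≤ CG m k γ Λ → x ≤ CG m k γ Λ * R := fun x c h1 h2 =>
    h1.trans (mul_le_mul_of_nonneg_right h2 hr.le)
  refine ⟨?_, ?_, ?_, ?_, ?_, ?_, ?_, ?_⟩
  · intro j
    refine (hc j).trans ?_
    gcongr
    rw [hCG]; linarith
  · intro j
    refine (hqf j).trans ?_
    rw [hCG]; linarith
  · unfold sg
    rw [add_sub_cancel_left]
    exact key _ (n * L) (by linarith) (by rw [hCG]; linarith)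
  · have : ∑ j, Xd γ j (ff γ A j) p - QQ m k γ = ∑ j, Xd γ j (cc γ A j) p := by
      rw [← sum_gam, ← Finset.sum_sub_distrib]
      refine Finset.sum_congr rfl fun i _ => ?_
      rw [Xd_ff hγ hp hA, gam_nu]; simp
    rw [this]
    exact key _ (n * B1) (by rw [mul_assoc]; exact sum_bd _ _ (fun i => hX i i))
      (by rw [hCG]; linarith)
  · rw [hft]
    have e : tau γ p * (-2 + (2 * γ) * (∑ i, cc γ A i p * nu i p)
      - (2 * γ + 2) * (tau γ p * ∑ j, cc γ A j p * yy γ j p)) + 2 * tau γ p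
      = ((2 * γ) * (∑ i, cc γ A i p * nu i p)
      - (2 * γ + 2) * (tau γ p * ∑ j, cc γ A j p * yy γ j p)) * tau γ p := by ring
    rw [e, abs_mul, abs_of_pos ht]
    gcongr
    refine key _ ((2 * γ) * (n * L) + (2 * γ + 2) * (n * L)) ?_ (by rw [hCG]; linarith)
    refine (abs_sub _ _).trans ?_
    rw [abs_mul, abs_mul (2 * γ + 2), abs_of_pos (by linarith : 0 < 2 * γ),
      abs_of_pos (by linarith : 0 < 2 * γ + 2)]
    have := mul_le_mul_of_nonneg_left hcn (by linarith : 0 ≤ 2 * γ)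
    have := mul_le_mul_of_nonneg_left hsg (by linarith : 0 ≤ 2 * γ + 2)
    linarith
  · intro i j
    refine key _ (n * Λ + n * (L * Λ)) ?_ (by rw [hCG]; linarith)
    have : ∑ l, ff γ A l p * Xd γ l (fun q => A q i j) p
      = ∑ l, yy γ l p * Xd γ l (fun q => A q i j) p + ∑ l, cc γ A l p * Xd γ l (fun q => A q i j) p := by
      rw [← Finset.sum_add_distrib]
      refine Finset.sum_congr rfl fun i _ => ?_
      unfold ff; ring
    rw [this]
    refine (abs_add_le _ _).trans ?_
    have h1 := sum_bd (fun l => yy γ l p * Xd γ l (fun q => A q i j) p) (Λ * R) (by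
      intro l; rw [abs_mul, mul_comm]; exact h.Dz l i j)
    have h2 := sum_bd (fun l => cc γ A l p * Xd γ l (fun q => A q i j) p) (L * R * Λ) (by
      intro l; rw [abs_mul]
      refine mul_le_mul ?_ (h.D l i j) (abs_nonneg _) (by positivity)
      refine (hc l).trans ?_
      have : L * R * N ≤ L * R * 1 := by gcongr; linarith
      linarith)
    linarith
  · refine key _ ((2 + (2 * γ) * (n * L) + (2 * γ + 2) * (n * L)) * (n * L)
      + n * (n * ((1 + L) * B1) + L * ((1 + γ) * (1 + L) + γ * (1 + n * L)))) ?_ (by rw [hCG]; linarith)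
    have dsum : DifferentiableAt ℝ (fun q => ∑ j, cc γ A j q * yy γ j q) p :=
      DifferentiableAt.fun_sum fun i _ => (da_cc hγ hp hA i).fun_mul (da_y hγ hp i)
    have e : ∀ l, Xd γ l (BG.sg γ A) p = Xd γ l (tau γ) p * (∑ j, cc γ A j p * yy γ j p)
        + tau γ p * ∑ j, (Xd γ l (cc γ A j) p * yy γ j p + cc γ A j p * Xd γ l (yy γ j) p) := by
      intro l
      have : Xd γ l (BG.sg γ A) p = Xd γ l (fun q => tau γ q * ∑ j, cc γ A j q * yy γ j q) p := by
        unfold Xd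
        unfold BG.sg
        rw [fderiv_const_add]
      rw [this, Xd_mul l (da_tau hγ hp) dsum, Xd_sum _ _
        (fun i _ => (da_cc hγ hp hA i).fun_mul (da_y hγ hp i))]
      have e0 : ∑ i, Xd γ l (fun q => cc γ A i q * yy γ i q) p
          = ∑ j, (Xd γ l (cc γ A j) p * yy γ j p + cc γ A j p * Xd γ l (yy γ j) p) :=
        Finset.sum_congr rfl fun i _ => by
          rw [Xd_mul l (da_cc hγ hp hA i) (da_y hγ hp i)]; ring
      rw [e0]; ring
    have e2 : ∑ l, ff γ A l p * Xd γ l (BG.sg γ A) p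
        = (∑ i, ff γ A i p * Xd γ i (tau γ) p) * (∑ j, cc γ A j p * yy γ j p)
        + ∑ j, tau γ p * ((∑ l, ff γ A l p * Xd γ l (cc γ A j) p) * yy γ j p
          + cc γ A j p * (∑ l, ff γ A l p * Xd γ l (yy γ j) p)) := by
      simp only [e, mul_add, Finset.sum_add_distrib]
      rw [Finset.sum_mul]
      congr 1
      · refine Finset.sum_congr rfl fun i _ => ?_
        ring
      · simp only [Finset.sum_mul, Finset.mul_sum]
        congr 1
        · rw [Finset.sum_comm]
          refine Finset.sum_congr rfl fun i _ => Finset.sum_congr rfl fun l _ => ?_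
          ring
        · rw [Finset.sum_comm]
          refine Finset.sum_congr rfl fun i _ => Finset.sum_congr rfl fun l _ => ?_
          ring
    rw [e2, hft]
    have h1 : |tau γ p * (-2 + (2 * γ) * (∑ i, cc γ A i p * nu i p)
      - (2 * γ + 2) * (tau γ p * ∑ j, cc γ A j p * yy γ j p)) * (∑ j, cc γ A j p * yy γ j p)|
      ≤ (2 + (2 * γ) * (n * L) + (2 * γ + 2) * (n * L)) * (n * (L * R)) := by
      rw [mul_comm (tau γ p), mul_assoc, abs_mul]
      refine mul_le_mul ?_ hsg (abs_nonneg _) (by positivity)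
      have hRL : n * (L * R) ≤ n * L := by
        have : L * R ≤ L := by nlinarith
        gcongr
      refine (abs_sub _ _).trans ?_
      have h3 := abs_add_le (-2 : ℝ) ((2 * γ) * (∑ i, cc γ A i p * nu i p))
      rw [abs_mul, abs_of_pos (by linarith : 0 < 2 * γ)] at h3
      rw [abs_mul (2 * γ + 2), abs_of_pos (by linarith : 0 < 2 * γ + 2)]
      have := mul_le_mul_of_nonneg_left (hcn.trans hRL) (by linarith : 0 ≤ 2 * γ)
      have := mul_le_mul_of_nonneg_left (hsg.trans hRL) (by linarith : 0 ≤ 2 * γ + 2)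
      norm_num at h3
      linarith
    have h2 := sum_bd (fun j => tau γ p * ((∑ l, ff γ A l p * Xd γ l (cc γ A j) p) * yy γ j p
          + cc γ A j p * (∑ l, ff γ A l p * Xd γ l (yy γ j) p)))
          (n * ((1 + L) * (B1 * R)) + (L * R) * ((1 + γ) * (1 + L) + γ * (1 + n * L))) (by
      intro j
      rw [abs_mul, abs_of_pos ht, ← hqq]
      calc _ ≤ q * q * (|(∑ l, ff γ A l p * Xd γ l (cc γ A j) p) * yy γ j p|
          + |cc γ A j p * (∑ l, ff γ A l p * Xd γ l (yy γ j) p)|) := by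
            gcongr; exact abs_add_le _ _
        _ = (q * |∑ l, ff γ A l p * Xd γ l (cc γ A j) p|) * (q * |yy γ j p|)
          + (q * |cc γ A j p|) * (q * |∑ l, ff γ A l p * Xd γ l (yy γ j) p|) := by
            rw [abs_mul, abs_mul]; ring
        _ ≤ (n * ((1 + L) * (B1 * R))) * 1 + (L * R) * ((1 + γ) * (1 + L) + γ * (1 + n * L)) := by
            refine add_le_add (mul_le_mul (hFc j) (hqy j) (by positivity) (by positivity))
              (mul_le_mul (hqc j) (hqFy j) (by positivity) (by positivity))
        _ = _ := by ring)
    refine (abs_add_le _ _).trans ?_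
    linarith
  · refine ⟨fun i j => Xd γ i (cc γ A j) p + cc γ A j p * (gam γ j * nu i p)
      - (if i = j then gam γ i * ∑ l, cc γ A l p * nu l p else 0), ?_, ?_⟩
    · intro i j
      refine key _ (B1 + γ * L + γ * (n * L)) ?_ (by rw [hCG]; linarith)
      refine (abs_sub _ _).trans ?_
      have h1 := abs_add_le (Xd γ i (cc γ A j) p) (cc γ A j p * (gam γ j * nu i p))
      have h2 : |cc γ A j p * (gam γ j * nu i p)| ≤ γ * L * R := by
        rw [abs_mul, abs_mul, abs_of_nonneg (gam_nonneg hγ j)]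
        calc |cc γ A j p| * (gam γ j * |nu i p|) ≤ (L * R * N) * (γ * (1 / N)) := by
              have := gam_nonneg hγ j
              gcongr; exacts [hc j, gam_le hγ j, nu_le hγ hp i]
          _ = _ := by field_simp
      have h3 : |(if i = j then gam γ i * ∑ l, cc γ A l p * nu l p else 0)| ≤ γ * (n * (L * R)) := by
        split_ifs
        · rw [abs_mul, abs_of_nonneg (gam_nonneg hγ i)]
          exact mul_le_mul (gam_le hγ i) hcn (abs_nonneg _) hγ.le
        · simp; positivity
      have := hX i j
      linarith
    · intro W i
      have e1 : ∑ j, Xd γ i (ff γ A j) p * W j = (1 + gam γ i) * W i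
          - ∑ j, gam γ j * nu i p * yy γ j p * W j + ∑ j, Xd γ i (cc γ A j) p * W j := by
        have : (1 + gam γ i) * W i = ∑ j, (if i = j then 1 + gam γ j else 0) * W j := by
          simp
        rw [this, ← Finset.sum_sub_distrib, ← Finset.sum_add_distrib]
        refine Finset.sum_congr rfl fun j _ => ?_
        rw [Xd_ff hγ hp hA]; ring
      have e2 : ∑ j, ff γ A j p * (gam γ j * nu i p * W j - gam γ i * nu j p * W i)
          = ∑ j, gam γ j * nu i p * yy γ j p * W j + ∑ j, cc γ A j p * (gam γ j * nu i p) * W j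
            - gam γ i * W i * ∑ j, ff γ A j p * nu j p := by
        rw [Finset.mul_sum, ← Finset.sum_add_distrib, ← Finset.sum_sub_distrib]
        refine Finset.sum_congr rfl fun j _ => ?_
        unfold ff; ring
      rw [e1, e2, hfn]
      have e3 : ∑ j, (Xd γ i (cc γ A j) p + cc γ A j p * (gam γ j * nu i p)
          - (if i = j then gam γ i * ∑ l, cc γ A l p * nu l p else 0)) * W j
          = ∑ j, Xd γ i (cc γ A j) p * W j + ∑ j, cc γ A j p * (gam γ j * nu i p) * W j
            - (gam γ i * ∑ l, cc γ A l p * nu l p) * W i := by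
        have : (gam γ i * ∑ l, cc γ A l p * nu l p) * W i
            = ∑ j, (if i = j then gam γ i * ∑ l, cc γ A l p * nu l p else 0) * W j := by
          simp
        rw [this, ← Finset.sum_add_distrib, ← Finset.sum_sub_distrib]
        refine Finset.sum_congr rfl fun j _ => ?_
        ring
      rw [e3]; ring

lemma CG_ge {γ Λ : ℝ} (hγ : 0 < γ) (hΛ : 0 < Λ) : 1 ≤ CG m k γ Λ := by
  have hB1 : 0 ≤ C1 m k γ Λ := by unfold C1; positivity
  have hn0 : (0:ℝ) ≤ ((m + k : ℕ) : ℝ) := Nat.cast_nonneg _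
  have hCG : CG m k γ Λ = ((m + k : ℕ) : ℝ) * Λ + (1 + ((m + k : ℕ) : ℝ) * Λ) + (((m + k : ℕ) : ℝ) * (((m + k : ℕ) : ℝ) * Λ) + ((m + k : ℕ) : ℝ) * C1 m k γ Λ + ((2 * γ) * (((m + k : ℕ) : ℝ) * (((m + k : ℕ) : ℝ) * Λ)) + (2 * γ + 2) * (((m + k : ℕ) : ℝ) * (((m + k : ℕ) : ℝ) * Λ)))
    + (((m + k : ℕ) : ℝ) * Λ + ((m + k : ℕ) : ℝ) * ((((m + k : ℕ) : ℝ) * Λ) * Λ))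
    + ((2 + (2 * γ) * (((m + k : ℕ) : ℝ) * (((m + k : ℕ) : ℝ) * Λ)) + (2 * γ + 2) * (((m + k : ℕ) : ℝ) * (((m + k : ℕ) : ℝ) * Λ))) * (((m + k : ℕ) : ℝ) * (((m + k : ℕ) : ℝ) * Λ))
      + ((m + k : ℕ) : ℝ) * (((m + k : ℕ) : ℝ) * ((1 + (((m + k : ℕ) : ℝ) * Λ)) * C1 m k γ Λ) + (((m + k : ℕ) : ℝ) * Λ) * ((1 + γ) * (1 + (((m + k : ℕ) : ℝ) * Λ)) + γ * (1 + ((m + k : ℕ) : ℝ) * (((m + k : ℕ) : ℝ) * Λ)))))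
    + (C1 m k γ Λ + γ * (((m + k : ℕ) : ℝ) * Λ) + γ * (((m + k : ℕ) : ℝ) * (((m + k : ℕ) : ℝ) * Λ)))) := by
    unfold CG; simp only []; ring
  rw [hCG]
  have : 0 ≤ ((m + k : ℕ) : ℝ) * Λ := by positivity
  refine le_trans (by linarith : (1:ℝ) ≤ ((m + k : ℕ) : ℝ) * Λ + (1 + ((m + k : ℕ) : ℝ) * Λ)) ?_
  apply le_add_of_nonneg_right
  positivity

end BG

namespace BG
variable {m k : ℕ}

def FF (γ : ℝ) (A : E m k → Matrix (Fin (m + k)) (Fin (m + k)) ℝ) (h : E m k → ℝ) (p : E m k) : ℝ :=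
  ∑ l, ff γ A l p * Xd γ l h p

lemma FF_mul {γ : ℝ} (A : E m k → Matrix (Fin (m + k)) (Fin (m + k)) ℝ) {p : E m k} {f g : E m k → ℝ}
    (hf : DifferentiableAt ℝ f p) (hg : DifferentiableAt ℝ g p) :
    FF γ A (fun q => f q * g q) p = f p * FF γ A g p + g p * FF γ A f p := by
  unfold FF
  rw [Finset.mul_sum, Finset.mul_sum, ← Finset.sum_add_distrib]
  refine Finset.sum_congr rfl fun i _ => ?_
  rw [Xd_mul i hf hg]; ring

lemma FF_add {γ : ℝ} (A : E m k → Matrix (Fin (m + k)) (Fin (m + k)) ℝ) {p : E m k} {f g : E m k → ℝ}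
    (hf : DifferentiableAt ℝ f p) (hg : DifferentiableAt ℝ g p) :
    FF γ A (fun q => f q + g q) p = FF γ A f p + FF γ A g p := by
  unfold FF
  rw [← Finset.sum_add_distrib]
  refine Finset.sum_congr rfl fun i _ => ?_
  rw [Xd_add i hf hg]; ring

lemma FF_sum {γ : ℝ} (A : E m k → Matrix (Fin (m + k)) (Fin (m + k)) ℝ) {p : E m k}
    {f : Fin (m + k) → E m k → ℝ}
    (hf : ∀ i, DifferentiableAt ℝ (f i) p) :
    FF γ A (fun q => ∑ i, f i q) p = ∑ i, FF γ A (f i) p := by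
  unfold FF
  rw [Finset.sum_comm]
  refine Finset.sum_congr rfl fun i _ => ?_
  rw [Xd_sum _ i (fun j _ => hf j), Finset.mul_sum]

section
variable {γ : ℝ} (hγ : 0 < γ) {A : E m k → Matrix (Fin (m + k)) (Fin (m + k)) ℝ} {p : E m k}
  (hp : p.1 ≠ 0)
include hγ hp

lemma tau_f_y : tau γ p * ∑ i, ff γ A i p * yy γ i p = sg γ A p := by
  unfold sg
  rw [← sum_y_sq hγ hp, ← mul_add, ← Finset.sum_add_distrib]
  congr 1
  refine Finset.sum_congr rfl fun i _ => ?_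
  unfold ff; ring

lemma FF_rad {φ : ℝ → ℝ} {d : ℝ} (hφ : HasDerivAt φ d (sl γ p)) :
    FF γ A (fun q => φ (sl γ q)) p = d * sg γ A p := by
  rw [← tau_f_y hγ hp]
  unfold FF
  rw [Finset.mul_sum, Finset.mul_sum]
  refine Finset.sum_congr rfl fun i _ => ?_
  rw [Xd_rad hγ hp i hφ]; ring

lemma da_rad {φ : ℝ → ℝ} {d : ℝ} (hφ : HasDerivAt φ d (sl γ p)) :
    DifferentiableAt ℝ (fun q => φ (sl γ q)) p :=
  hφ.differentiableAt.comp p (da_sl hγ hp)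

/-- divergence of f times a function -/
lemma div_fS (hA : C1coeff A) {S : E m k → ℝ} (hS : DifferentiableAt ℝ S p) :
    ∑ i, Xd γ i (fun q => ff γ A i q * S q) p
      = (∑ i, Xd γ i (ff γ A i) p) * S p + FF γ A S p := by
  unfold FF
  rw [Finset.sum_mul, ← Finset.sum_add_distrib]
  refine Finset.sum_congr rfl fun i _ => ?_
  rw [Xd_mul i (da_ff hγ hp hA i) hS]; ring
end

def PP (A : E m k → Matrix (Fin (m + k)) (Fin (m + k)) ℝ) (W : Fin (m + k) → E m k → ℝ)
    (i : Fin (m + k)) (q : E m k) : ℝ := ∑ j, A q i j * W j q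

def EE (A : E m k → Matrix (Fin (m + k)) (Fin (m + k)) ℝ) (W : Fin (m + k) → E m k → ℝ)
    (q : E m k) : ℝ := ∑ i, PP A W i q * W i q

section
variable {γ : ℝ} (hγ : 0 < γ) {A : E m k → Matrix (Fin (m + k)) (Fin (m + k)) ℝ} {p : E m k}
  (hp : p.1 ≠ 0) (hA : C1coeff A) (hsym : Symm A) {W : Fin (m + k) → E m k → ℝ}
  (hW : ∀ i, DifferentiableAt ℝ (W i) p)

include hA hW in
lemma da_PP (i : Fin (m + k)) : DifferentiableAt ℝ (PP A W i) p :=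
  DifferentiableAt.fun_sum fun j _ => (da_A hA i j).fun_mul (hW j)

include hA hW in
lemma da_EE : DifferentiableAt ℝ (EE A W) p :=
  DifferentiableAt.fun_sum fun j _ => (da_PP hA hW j).fun_mul (hW j)

include hsym in
lemma sum_P_y : ∑ i, PP A W i p * yy γ i p = ∑ j, ff γ A j p * W j p := by
  simp only [PP, ff_eq, Finset.sum_mul]
  rw [Finset.sum_comm]
  refine Finset.sum_congr rfl fun i _ => Finset.sum_congr rfl fun j _ => ?_
  ring

include hA hW hsym in
lemma FF_EE : FF γ A (EE A W) p = ∑ i, ∑ j, FF γ A (fun q => A q i j) p * W i p * W j p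
    + 2 * ∑ i, PP A W i p * FF γ A (W i) p := by
  unfold EE
  rw [FF_sum A (fun i => (da_PP hA hW i).fun_mul (hW i))]
  have h1 : ∀ i, FF γ A (fun q => PP A W i q * W i q) p
      = PP A W i p * FF γ A (W i) p + ∑ j, A p i j * W i p * FF γ A (W j) p
        + ∑ j, FF γ A (fun q => A q i j) p * W i p * W j p := by
    intro i
    rw [FF_mul A (da_PP hA hW i) (hW i), add_assoc]
    congr 1
    unfold PP
    rw [FF_sum A (fun j => (da_A hA i j).fun_mul (hW j)), Finset.mul_sum, ← Finset.sum_add_distrib]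
    refine Finset.sum_congr rfl fun j _ => ?_
    rw [FF_mul A (da_A hA i j) (hW j)]; ring
  simp only [h1, Finset.sum_add_distrib]
  have h2 : ∑ i, ∑ j, A p i j * W i p * FF γ A (W j) p = ∑ i, PP A W i p * FF γ A (W i) p := by
    rw [Finset.sum_comm]
    refine Finset.sum_congr rfl fun j _ => ?_
    unfold PP; rw [Finset.sum_mul]
    refine Finset.sum_congr rfl fun i _ => ?_
    rw [hsym p i j]
  rw [h2]; ring

include hγ hp hA hsym hW in
lemma div_energy {w : E m k → ℝ} (hw : DifferentiableAt ℝ w p) (hwX : ∀ i, Xd γ i w p = W i p)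
    {Z : ℝ → ℝ} {Z1 : ℝ} (hZ : HasDerivAt Z Z1 (sl γ p)) :
    ∑ i, Xd γ i (fun q => Z (sl γ q) * (w q * PP A W i q)) p
      = Z (sl γ p) * (w p * ∑ i, Xd γ i (PP A W i) p) + Z (sl γ p) * EE A W p
        + Z1 * tau γ p * (w p * ∑ j, ff γ A j p * W j p) := by
  rw [← sum_P_y hsym]
  unfold EE
  simp only [Finset.mul_sum, ← Finset.sum_add_distrib]
  refine Finset.sum_congr rfl fun i _ => ?_
  have d := da_PP hA hW i
  rw [Xd_mul i (da_rad hγ hp hZ) (hw.fun_mul d), Xd_mul i hw d, Xd_rad hγ hp i hZ, hwX]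
  ring

include hγ hp hA hsym hW in
lemma div_main {w : E m k → ℝ} (hw : DifferentiableAt ℝ w p) (hwX : ∀ i, Xd γ i w p = W i p)
    (hcomm : ∀ i j, Xd γ i (W j) p = Xd γ j (W i) p + gam γ j * nu i p * W j p
      - gam γ i * nu j p * W i p)
    {G : E m k → ℝ} (hG : G =ᶠ[nhds p] fun q => ∑ j, ff γ A j q * W j q)
    {κ : E m k → ℝ} (hκ : DifferentiableAt ℝ κ p)
    {r : Fin (m + k) → Fin (m + k) → ℝ}
    (hr : ∀ (W : Fin (m + k) → ℝ) (i : Fin (m + k)), ∑ j, Xd γ i (ff γ A j) p * W j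
      + ∑ j, ff γ A j p * (gam γ j * nu i p * W j - gam γ i * nu j p * W i)
      = W i + ∑ j, r i j * W j)
    {Θ : ℝ → ℝ} {Θ1 : ℝ} (hΘ : HasDerivAt Θ Θ1 (sl γ p)) :
    ∑ i, Xd γ i (fun q => Θ (sl γ q) * (PP A W i q * G q)
      + (-1 / 2) * (ff γ A i q * (Θ (sl γ q) * EE A W q))
      + (1 / 2) * (ff γ A i q * (tau γ q * (Θ (sl γ q) * (κ q * (w q * w q)))))) p
    = Θ (sl γ p) * ((∑ i, Xd γ i (PP A W i) p) * G p) + Θ1 * tau γ p * G p ^ 2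
      + Θ (sl γ p) * (EE A W p + ∑ i, PP A W i p * ∑ j, r i j * W j p)
      - (1 / 2) * (Θ (sl γ p) * ∑ i, ∑ j, FF γ A (fun q => A q i j) p * W i p * W j p)
      - (1 / 2) * EE A W p * (Θ1 * sg γ A p + Θ (sl γ p) * ∑ i, Xd γ i (ff γ A i) p)
      + tau γ p * Θ (sl γ p) * κ p * w p * G p
      + (1 / 2) * w p ^ 2 * (tau γ p * κ p * Θ1 * sg γ A p + tau γ p * Θ (sl γ p) * FF γ A κ p
        + Θ (sl γ p) * κ p * (tau γ p * (∑ i, Xd γ i (ff γ A i) p) + FF γ A (tau γ) p)) := by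
  have hGp : G p = ∑ j, ff γ A j p * W j p := hG.eq_of_nhds
  have dG0 : DifferentiableAt ℝ (fun q => ∑ j, ff γ A j q * W j q) p :=
    DifferentiableAt.fun_sum fun j _ => (da_ff hγ hp hA j).fun_mul (hW j)
  have dG : DifferentiableAt ℝ G p := dG0.congr_of_eventuallyEq hG
  have dP := da_PP hA hW
  have dE := da_EE hA hW
  have dΘ := da_rad hγ hp hΘ
  have dt := da_tau hγ hp
  have df := da_ff hγ hp hA
  have d2 : DifferentiableAt ℝ (fun q => Θ (sl γ q) * EE A W q) p := dΘ.fun_mul dE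
  have d3a : DifferentiableAt ℝ (fun q => κ q * (w q * w q)) p := hκ.fun_mul (hw.fun_mul hw)
  have d3b : DifferentiableAt ℝ (fun q => Θ (sl γ q) * (κ q * (w q * w q))) p := dΘ.fun_mul d3a
  have d3 : DifferentiableAt ℝ (fun q => tau γ q * (Θ (sl γ q) * (κ q * (w q * w q)))) p :=
    dt.fun_mul d3b
  have hXG : ∀ i, Xd γ i G p = W i p + ∑ j, r i j * W j p + FF γ A (W i) p := by
    intro i
    rw [← hr (fun j => W j p) i, Xd_congr i hG,
      Xd_sum _ i (fun j _ => (df j).fun_mul (hW j)), FF, ← Finset.sum_add_distrib,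
      ← Finset.sum_add_distrib]
    refine Finset.sum_congr rfl fun j _ => ?_
    rw [Xd_mul i (df j) (hW j), hcomm i j]; ring
  have e : ∀ i, Xd γ i (fun q => Θ (sl γ q) * (PP A W i q * G q)
      + (-1 / 2) * (ff γ A i q * (Θ (sl γ q) * EE A W q))
      + (1 / 2) * (ff γ A i q * (tau γ q * (Θ (sl γ q) * (κ q * (w q * w q)))))) p
      = (Θ (sl γ p) * (PP A W i p * (W i p + ∑ j, r i j * W j p + FF γ A (W i) p))
        + Θ (sl γ p) * (Xd γ i (PP A W i) p * G p)
        + Θ1 * tau γ p * G p * (PP A W i p * yy γ i p))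
        + (-1 / 2) * Xd γ i (fun q => ff γ A i q * (Θ (sl γ q) * EE A W q)) p
        + (1 / 2) * Xd γ i (fun q => ff γ A i q * (tau γ q * (Θ (sl γ q) * (κ q * (w q * w q))))) p := by
    intro i
    rw [Xd_add i ((dΘ.fun_mul ((dP i).fun_mul dG)).fun_add (((df i).fun_mul d2).const_mul _))
      (((df i).fun_mul d3).const_mul _),
      Xd_add i (dΘ.fun_mul ((dP i).fun_mul dG)) (((df i).fun_mul d2).const_mul _),
      Xd_const_mul _ i ((df i).fun_mul d2), Xd_const_mul _ i ((df i).fun_mul d3),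
      Xd_mul i dΘ ((dP i).fun_mul dG), Xd_mul i (dP i) dG, Xd_rad hγ hp i hΘ, hXG]
    ring
  simp only [e, Finset.sum_add_distrib, ← Finset.mul_sum]
  rw [div_fS hγ hp hA d2, div_fS hγ hp hA d3, FF_mul A dΘ dE, FF_rad hγ hp hΘ,
    FF_EE hA hsym hW, FF_mul A dt d3b, FF_mul A dΘ d3a, FF_rad hγ hp hΘ,
    FF_mul A hκ (hw.fun_mul hw), FF_mul A hw hw, sum_P_y hsym, ← hGp]
  have e1 : ∑ i, PP A W i p * (W i p + ∑ j, r i j * W j p + FF γ A (W i) p)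
      = EE A W p + ∑ i, PP A W i p * ∑ j, r i j * W j p + ∑ i, PP A W i p * FF γ A (W i) p := by
    unfold EE
    rw [← Finset.sum_add_distrib, ← Finset.sum_add_distrib]
    refine Finset.sum_congr rfl fun i _ => ?_
    ring
  have e2 : FF γ A w p = G p := by
    rw [hGp]; unfold FF
    refine Finset.sum_congr rfl fun i _ => ?_
    rw [hwX]
  rw [e1, e2, ← Finset.sum_mul]
  ring
end

end BG

namespace BG
variable {m k : ℕ}

lemma basics {C α e : ℝ} (hC : 1 ≤ C) (hα : 100 * C ^ 2 ≤ α) (he : 0 < e)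
    (he1 : 1000 * C ^ 2 * e ≤ 1) :
    100 ≤ α ∧ 100 * C ≤ α ∧ 1000 * (C * e) ≤ 1 ∧ 1000 * e ≤ 1 ∧ C * e ^ 2 ≤ 1 / 4 := by
  have h1 : 1 ≤ C ^ 2 := one_le_pow₀ hC
  have h2 : C ≤ C ^ 2 := by nlinarith
  have h3 : C * e ≤ C ^ 2 * e := by gcongr
  have h4 : 1 * e ≤ C * e := by gcongr
  refine ⟨by linarith, by linarith, by linarith, by linarith, ?_⟩
  have : C * e * e ≤ 1 * (1/4) := mul_le_mul (by linarith) (by linarith) he.le (by norm_num)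
  nlinarith

set_option maxHeartbeats 2000000 in
lemma scalar_main {C α e K Q θ b τ σ D Ft Fs EE S G w RR AA κ Fκ LW V g1 g2 : ℝ}
    (hC : 1 ≤ C) (hQ : |Q - 2| ≤ C) (hα : 100 * C ^ 2 ≤ α) (he : 0 < e) (he1 : 1000 * C ^ 2 * e ≤ 1)
    (hθ : 0 ≤ θ) (hτ : 0 < τ) (hσ : |σ - 1| ≤ C * e ^ 2) (hD : |D - Q| ≤ C * e ^ 2)
    (hFt : |Ft + 2 * τ| ≤ C * e ^ 2 * τ) (hFs : |Fs| ≤ C * e ^ 2)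
    (hE0 : 0 ≤ EE) (hE : EE ≤ C * S) (hRR : |RR| ≤ C * e ^ 2 * S) (hAA : |AA| ≤ C * e ^ 2 * S)
    (hG : τ * G ^ 2 ≤ C * S) (hκ : κ = g1 ^ 2 * σ + (Q - 2) * g1)
    (hFκ : Fκ = 2 * g1 * g2 * σ ^ 2 + g1 ^ 2 * Fs + (Q - 2) * g2 * σ)
    (hLW : LW = V * w - 2 * g1 * τ * G - g2 * τ * σ * w - g1 * (τ * D + Ft) * w - g1 ^ 2 * τ * σ * w)
    (hg1 : α / 2 ≤ g1) (hg1' : g1 ≤ α) (hg2 : g2 = -(α * e / 4)) (hV : |V| ≤ K * e ^ 4 * τ)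
    (hK0 : 0 ≤ K) (hK : K ^ 2 ≤ α ^ 3) :
    θ * (LW * G) + ((2 - Q) * θ + b) * τ * G ^ 2 + θ * (EE + RR) - (1 / 2) * (θ * AA)
      - (1 / 2) * EE * (((2 - Q) * θ + b) * σ + θ * D) + τ * θ * κ * w * G
      + (1 / 2) * w ^ 2 * (τ * κ * ((2 - Q) * θ + b) * σ + τ * θ * Fκ + θ * κ * (τ * D + Ft))
    ≤ -(1 / 32) * α ^ 2 * e * (θ * τ * w ^ 2) + 3 * C ^ 3 * e ^ 2 * (θ * S)
      + 3 * C * |b| * (S + α ^ 2 * (τ * w ^ 2)) := by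
  have hS : 0 ≤ S := by
    by_contra h
    push Not at h
    nlinarith
  obtain ⟨hα1, hαC, hCe, hee, hCe2⟩ := basics hC hα he he1
  have hα0 : 0 < α := by linarith
  have hCC : C ≤ C ^ 2 := by
    calc C = C * 1 := (mul_one _).symm
      _ ≤ C * C := by gcongr
      _ = _ := by ring
  have hσa : |σ - 1| ≤ 1 / 4 := hσ.trans hCe2
  obtain ⟨hσ1, hσ2⟩ := abs_le.mp hσa
  obtain ⟨hQ1, hQ2⟩ := abs_le.mp hQ
  -- delta
  obtain ⟨δ, hδ⟩ : ∃ δ, τ * D + Ft = τ * ((Q - 2) + δ) :=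
    ⟨D + Ft / τ - (Q - 2), by field_simp; ring⟩
  have hδ1 : |δ| ≤ 2 * C * e ^ 2 := by
    have h1 : τ * δ = τ * (D - Q) + (Ft + 2 * τ) := by linarith
    have h2 : τ * |δ| ≤ τ * (2 * C * e ^ 2) := by
      calc τ * |δ| = |τ * δ| := by rw [abs_mul, abs_of_pos hτ]
        _ = |τ * (D - Q) + (Ft + 2 * τ)| := by rw [h1]
        _ ≤ |τ * (D - Q)| + |Ft + 2 * τ| := abs_add_le _ _
        _ = τ * |D - Q| + |Ft + 2 * τ| := by rw [abs_mul, abs_of_pos hτ]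
        _ ≤ τ * (C * e ^ 2) + C * e ^ 2 * τ := by gcongr
        _ = _ := by ring
    exact le_of_mul_le_mul_left h2 hτ
  have hb := le_abs_self b
  have hb0 := abs_nonneg b
  have hnb := neg_abs_le b
  have hg1p : 0 ≤ g1 := by linarith
  have hκ2 : |κ| ≤ 2 * α ^ 2 := by
    rw [hκ, abs_le]
    have h1 : g1 ^ 2 ≤ α ^ 2 := by gcongr
    have h1' : 0 ≤ g1 ^ 2 := sq_nonneg _
    have h2 : |(Q - 2) * g1| ≤ C * α := by
      rw [abs_mul, abs_of_nonneg hg1p]; gcongr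
    obtain ⟨h3, h4⟩ := abs_le.mp h2
    have h5 : C * α ≤ α ^ 2 := by
      rw [pow_two]; gcongr; linarith
    have h6 : g1 ^ 2 * σ ≤ g1 ^ 2 * (5 / 4) := by gcongr; linarith
    have h7 : 0 ≤ g1 ^ 2 * σ := mul_nonneg h1' (by linarith)
    have h8 : 100 * α ≤ α ^ 2 := by rw [pow_two]; gcongr
    have h9 : 100 * (C * α) ≤ α ^ 2 := by
      calc 100 * (C * α) = (100 * C) * α := by ring
        _ ≤ α * α := by gcongr
        _ = _ := by ring
    constructor <;> linarith
  -- first group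
  have T1 : θ * (LW * G) + ((2 - Q) * θ + b) * τ * G ^ 2 + τ * θ * κ * w * G
      ≤ (1 / 128) * α ^ 2 * e * (θ * τ * w ^ 2) + |b| * (C * S) := by
    have e1 : θ * (LW * G) + ((2 - Q) * θ + b) * τ * G ^ 2 + τ * θ * κ * w * G
        = θ * (V * (w * G) + τ * (-2 * g1 * G ^ 2 + (2 - Q) * G ^ 2 + (-g2 * σ - g1 * δ) * (w * G)))
          + b * (τ * G ^ 2) := by
      rw [hLW, hδ, hκ]; ring
    rw [e1]
    have hbG : b * (τ * G ^ 2) ≤ |b| * (C * S) := by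
      have : 0 ≤ τ * G ^ 2 := by positivity
      calc b * (τ * G ^ 2) ≤ |b| * (τ * G ^ 2) := by gcongr
        _ ≤ _ := by gcongr
    set x := |w * G| with hx
    have hx0 : 0 ≤ x := abs_nonneg _
    have hVx : V * (w * G) ≤ τ * (K * e ^ 4 * x) := by
      calc V * (w * G) ≤ |V * (w * G)| := le_abs_self _
        _ = |V| * x := abs_mul _ _
        _ ≤ (K * e ^ 4 * τ) * x := by gcongr
        _ = _ := by ring
    have hcx : (-g2 * σ - g1 * δ) * (w * G) ≤ (α * e + 2 * C * α * e ^ 2) * x := by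
      have : |-g2 * σ - g1 * δ| ≤ α * e + 2 * C * α * e ^ 2 := by
        refine (abs_sub _ _).trans ?_
        rw [abs_mul, abs_mul, abs_neg, abs_of_nonneg hg1p, hg2, abs_neg,
          abs_of_pos (by positivity : 0 < α * e / 4)]
        have h1 : |σ| ≤ 2 := by rw [abs_le]; constructor <;> linarith
        have h2 : g1 * |δ| ≤ α * (2 * C * e ^ 2) := by gcongr
        have h3 : α * e / 4 * |σ| ≤ α * e / 4 * 2 := by gcongr
        have : 0 < α * e := by positivity
        linarith
      calc _ ≤ |(-g2 * σ - g1 * δ) * (w * G)| := le_abs_self _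
        _ = |-g2 * σ - g1 * δ| * x := abs_mul _ _
        _ ≤ _ := by gcongr
    have hGx : -2 * g1 * G ^ 2 + (2 - Q) * G ^ 2 ≤ -(3 / 4) * α * G ^ 2 := by
      have h1 : 0 ≤ G ^ 2 := sq_nonneg _
      rw [← add_mul]
      exact mul_le_mul_of_nonneg_right (by linarith) h1
    have hB : (K * e ^ 4 + (α * e + 2 * C * α * e ^ 2)) * x
        ≤ (3 / 4) * α * G ^ 2 + (1 / 128) * α ^ 2 * e * w ^ 2 := by
      have h1 : 2 * C * α * e ^ 2 ≤ (1 / 500) * (α * e) := by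
        calc 2 * C * α * e ^ 2 = (α * e) * (2 * (C * e)) := by ring
          _ ≤ (α * e) * (1 / 500) := by gcongr; linarith
          _ = _ := by ring
      -- K e^4 x ≤ α/4 G² + K² e^8/α w²
      have hxx : x ^ 2 = w ^ 2 * G ^ 2 := by rw [hx, sq_abs]; ring
      have key : ∀ c d : ℝ, 0 ≤ d → c ^ 2 ≤ α * d → c * x ≤ (1 / 4) * α * G ^ 2 + d * w ^ 2 := by
        intro c d hd hcd
        apply le_of_sq_le_sq _ (by positivity)
        calc (c * x) ^ 2 = c ^ 2 * (w ^ 2 * G ^ 2) := by rw [mul_pow, hxx]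
          _ ≤ (α * d) * (w ^ 2 * G ^ 2) := by gcongr
          _ ≤ _ := by linarith [sq_nonneg ((1 / 4) * α * G ^ 2 - d * w ^ 2)]
      have k1 := key (K * e ^ 4) (α ^ 2 * e ^ 8) (by positivity) (by
        calc (K * e ^ 4) ^ 2 = K ^ 2 * e ^ 8 := by ring
          _ ≤ α ^ 3 * e ^ 8 := by gcongr
          _ = _ := by ring)
      have k2 := key (2 * (α * e)) (4 * α * e ^ 2) (by positivity) (by
        apply le_of_eq; ring)
      have h8 : e ^ 8 ≤ (1 / 1000) * e := by
        have : e ^ 7 ≤ 1 / 1000 := by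
          calc e ^ 7 ≤ e ^ 1 := pow_le_pow_of_le_one he.le (by linarith) (by norm_num)
            _ ≤ _ := by rw [pow_one]; linarith
        calc e ^ 8 = e ^ 7 * e := by ring
          _ ≤ _ := by gcongr
      have h9 : 4 * α * e ^ 2 ≤ (1 / 1000) * (α ^ 2 * e) := by
        have : 4 * e ≤ (1 / 1000) * α := by linarith
        calc 4 * α * e ^ 2 = (α * e) * (4 * e) := by ring
          _ ≤ (α * e) * ((1 / 1000) * α) := by gcongr
          _ = _ := by ring
      have hw2 : 0 ≤ w ^ 2 := sq_nonneg _
      have h10 : α ^ 2 * e ^ 8 * w ^ 2 ≤ (1 / 1000) * (α ^ 2 * e) * w ^ 2 := by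
        calc α ^ 2 * e ^ 8 * w ^ 2 ≤ α ^ 2 * ((1 / 1000) * e) * w ^ 2 := by gcongr
          _ = _ := by ring
      have h11 : 4 * α * e ^ 2 * w ^ 2 ≤ (1 / 1000) * (α ^ 2 * e) * w ^ 2 := by gcongr
      have h12 : (α * e + 2 * C * α * e ^ 2) * x ≤ 2 * (α * e) * x := by
        have : 0 < α * e := by positivity
        gcongr; linarith
      have h13 : 0 ≤ α * G ^ 2 := by positivity
      have h14 : 0 ≤ α ^ 2 * e * w ^ 2 := by positivity
      rw [add_mul]
      linarith
    have hfin : V * (w * G) + τ * (-2 * g1 * G ^ 2 + (2 - Q) * G ^ 2 + (-g2 * σ - g1 * δ) * (w * G))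
        ≤ τ * ((1 / 128) * α ^ 2 * e * w ^ 2) := by
      have : τ * (K * e ^ 4 * x) + τ * (-(3 / 4) * α * G ^ 2 + (α * e + 2 * C * α * e ^ 2) * x)
        ≤ τ * ((1 / 128) * α ^ 2 * e * w ^ 2) := by
        rw [← mul_add]; gcongr; linarith
      refine le_trans ?_ this
      gcongr
    have := mul_le_mul_of_nonneg_left hfin hθ
    linarith
  have T2 : θ * (EE + RR) - (1 / 2) * (θ * AA) - (1 / 2) * EE * (((2 - Q) * θ + b) * σ + θ * D)
      ≤ 3 * C ^ 3 * e ^ 2 * (θ * S) + |b| * (C * S) := by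
    have e1 : θ * (EE + RR) - (1 / 2) * (θ * AA) - (1 / 2) * EE * (((2 - Q) * θ + b) * σ + θ * D)
      = θ * (EE * ((1 / 2) * ((Q - 2) * (σ - 1) - (D - Q))) + RR - (1 / 2) * AA)
        + (1 / 2) * (-b * σ) * EE := by ring
    rw [e1]
    have h1 : (1 / 2) * ((Q - 2) * (σ - 1) - (D - Q)) ≤ C ^ 2 * e ^ 2 := by
      have h3 : |(Q - 2) * (σ - 1)| ≤ C * (C * e ^ 2) := by rw [abs_mul]; gcongr
      have := (abs_le.mp h3).2
      have := (abs_le.mp hD).1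
      have : C * e ^ 2 ≤ C ^ 2 * e ^ 2 := by gcongr
      linarith
    have h2 : EE * ((1 / 2) * ((Q - 2) * (σ - 1) - (D - Q))) ≤ (C * S) * (C ^ 2 * e ^ 2) := by
      calc _ ≤ EE * (C ^ 2 * e ^ 2) := by gcongr
        _ ≤ _ := by gcongr
    have h4 := (abs_le.mp hRR).2
    have h5 := (abs_le.mp hAA).1
    have h6 : C * e ^ 2 * S ≤ C ^ 3 * e ^ 2 * S := by
      gcongr
      calc C = C ^ 1 := (pow_one _).symm
        _ ≤ C ^ 3 := pow_le_pow_right₀ hC (by norm_num)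
    have h7 : θ * (EE * ((1 / 2) * ((Q - 2) * (σ - 1) - (D - Q))) + RR - (1 / 2) * AA)
        ≤ θ * (3 * C ^ 3 * e ^ 2 * S) := by
      gcongr
      have : 0 ≤ C ^ 3 * e ^ 2 * S := by positivity
      linarith
    have h8 : (1 / 2) * (-b * σ) * EE ≤ |b| * (C * S) := by
      have : (1 / 2) * (-b * σ) ≤ |b| := by
        have h1 : |σ| ≤ 2 := by rw [abs_le]; constructor <;> linarith
        refine (le_abs_self _).trans ?_
        rw [abs_mul, abs_mul, abs_neg, abs_of_pos (by norm_num : (0:ℝ) < 1 / 2)]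
        calc 1 / 2 * (|b| * |σ|) ≤ 1 / 2 * (|b| * 2) := by gcongr
          _ = _ := by ring
      calc _ ≤ |b| * EE := by gcongr
        _ ≤ _ := by gcongr
    linarith
  have T3 : (1 / 2) * w ^ 2 * (τ * κ * ((2 - Q) * θ + b) * σ + τ * θ * Fκ + θ * κ * (τ * D + Ft))
      ≤ -(1 / 20) * α ^ 2 * e * (θ * τ * w ^ 2) + 2 * |b| * (α ^ 2 * (τ * w ^ 2)) := by
    have e1 : (1 / 2) * w ^ 2 * (τ * κ * ((2 - Q) * θ + b) * σ + τ * θ * Fκ + θ * κ * (τ * D + Ft))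
        = (1 / 2) * (θ * τ * w ^ 2) * (κ * (δ - (Q - 2) * (σ - 1)) + Fκ)
          + (1 / 2) * (b * κ * σ) * (τ * w ^ 2) := by
      rw [hδ]; ring
    rw [e1]
    have h0 : 0 ≤ τ * w ^ 2 := by positivity
    have h0' : 0 ≤ θ * τ * w ^ 2 := by positivity
    have h1 : κ * (δ - (Q - 2) * (σ - 1)) ≤ 2 * α ^ 2 * (3 * C ^ 2 * e ^ 2) := by
      refine (le_abs_self _).trans ?_
      rw [abs_mul]
      gcongr
      refine (abs_sub _ _).trans ?_
      have h3 : |(Q - 2) * (σ - 1)| ≤ C * (C * e ^ 2) := by rw [abs_mul]; gcongr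
      have : C * e ^ 2 ≤ C ^ 2 * e ^ 2 := by gcongr
      linarith
    have h2 : Fκ ≤ -(9 / 64) * α ^ 2 * e + α ^ 2 * (C * e ^ 2) + C * α * e := by
      rw [hFκ]
      have a1 : 2 * g1 * g2 * σ ^ 2 ≤ -(9 / 64) * α ^ 2 * e := by
        rw [hg2]
        have : α * (9 / 16) ≤ 2 * g1 * σ ^ 2 := by
          have s2 : 9 / 16 ≤ σ ^ 2 := by
            calc (9 / 16 : ℝ) = (3 / 4) ^ 2 := by norm_num
              _ ≤ σ ^ 2 := by gcongr; linarith
          calc α * (9 / 16) ≤ (2 * g1) * σ ^ 2 := by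
                apply mul_le_mul (by linarith) s2 (by norm_num) (by linarith)
            _ = _ := by ring
        calc 2 * g1 * -(α * e / 4) * σ ^ 2 = -(α * e / 4 * (2 * g1 * σ ^ 2)) := by ring
          _ ≤ -(α * e / 4 * (α * (9 / 16))) := by gcongr
          _ = _ := by ring
      have a2 : g1 ^ 2 * Fs ≤ α ^ 2 * (C * e ^ 2) := by
        calc g1 ^ 2 * Fs ≤ g1 ^ 2 * (C * e ^ 2) := by
              gcongr; exact (abs_le.mp hFs).2
          _ ≤ _ := by gcongr
      have a3 : (Q - 2) * g2 * σ ≤ C * α * e := by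
        refine (le_abs_self _).trans ?_
        rw [abs_mul, abs_mul, hg2, abs_neg, abs_of_pos (by positivity : 0 < α * e / 4)]
        have h1 : |σ| ≤ 4 := by rw [abs_le]; constructor <;> linarith
        calc |Q - 2| * (α * e / 4) * |σ| ≤ C * (α * e / 4) * 4 := by gcongr
          _ = _ := by ring
      linarith
    have h3 : κ * (δ - (Q - 2) * (σ - 1)) + Fκ ≤ -(1 / 10) * α ^ 2 * e := by
      have p : 0 < α ^ 2 * e := by positivity
      have b1 : 2 * α ^ 2 * (3 * C ^ 2 * e ^ 2) ≤ (6 / 1000) * (α ^ 2 * e) := by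
        calc 2 * α ^ 2 * (3 * C ^ 2 * e ^ 2) = (6 / 1000) * (α ^ 2 * e * (1000 * C ^ 2 * e)) := by ring
          _ ≤ (6 / 1000) * (α ^ 2 * e * 1) := by gcongr
          _ = _ := by ring
      have b2 : α ^ 2 * (C * e ^ 2) ≤ (1 / 1000) * (α ^ 2 * e) := by
        calc α ^ 2 * (C * e ^ 2) = (1 / 1000) * (α ^ 2 * e * (1000 * (C * e))) := by ring
          _ ≤ (1 / 1000) * (α ^ 2 * e * 1) := by gcongr
          _ = _ := by ring
      have b3 : C * α * e ≤ (1 / 100) * (α ^ 2 * e) := by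
        calc C * α * e = (1 / 100) * ((100 * C) * (α * e)) := by ring
          _ ≤ (1 / 100) * (α * (α * e)) := by gcongr
          _ = _ := by ring
      linarith
    have h4 : (1 / 2) * (b * κ * σ) ≤ 2 * |b| * α ^ 2 := by
      refine (le_abs_self _).trans ?_
      rw [abs_mul, abs_mul, abs_mul, abs_of_pos (by norm_num : (0:ℝ) < 1 / 2)]
      have h1 : |σ| ≤ 2 := by rw [abs_le]; constructor <;> linarith
      calc 1 / 2 * (|b| * |κ| * |σ|) ≤ 1 / 2 * (|b| * (2 * α ^ 2) * 2) := by gcongr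
        _ = _ := by ring
    have h5 := mul_le_mul_of_nonneg_left h3 h0'
    have h6 := mul_le_mul_of_nonneg_right h4 h0
    linarith
  have hpos : 0 ≤ α ^ 2 * e * (θ * τ * w ^ 2) := by positivity
  have hpos2 : 0 ≤ |b| * (α ^ 2 * (τ * w ^ 2)) := by positivity
  have hpos3 : 0 ≤ |b| * (C * S) := by positivity
  have hpos4 : 2 * (|b| * (α ^ 2 * (τ * w ^ 2))) ≤ 3 * C * (|b| * (α ^ 2 * (τ * w ^ 2))) := by
    apply mul_le_mul_of_nonneg_right _ hpos2; linarith
  linarith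

set_option maxHeartbeats 2000000 in
lemma scalar_energy {lam C α e K Q ζ ζd τ σ D Ft EE S G w LW V g1 g2 : ℝ} (hlam : 0 < lam)
    (hC : 1 ≤ C) (hQ : |Q - 2| ≤ C) (hα : 100 * C ^ 2 ≤ α) (he : 0 < e) (he1 : 1000 * C ^ 2 * e ≤ 1)
    (hτ : 0 < τ) (hσ : |σ - 1| ≤ C * e ^ 2) (hD : |D - Q| ≤ C * e ^ 2)
    (hFt : |Ft + 2 * τ| ≤ C * e ^ 2 * τ)
    (hE : lam * S ≤ EE)
    (hG : τ * G ^ 2 ≤ C * S)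
    (hLW : LW = V * w - 2 * g1 * τ * G - g2 * τ * σ * w - g1 * (τ * D + Ft) * w - g1 ^ 2 * τ * σ * w)
    (hg1 : α / 2 ≤ g1) (hg1' : g1 ≤ α) (hg2 : g2 = -(α * e / 4)) (hV : |V| ≤ K * e ^ 4 * τ)
    (hK0 : 0 ≤ K) (hK : K ^ 2 ≤ α ^ 3) :
    (lam / 2) * ζ ^ 2 * S - (4 * C / lam + 10 * C) * α ^ 2 * (ζ ^ 2 * (τ * w ^ 2))
      - (4 * C / lam) * (ζd ^ 2 * (τ * w ^ 2))
    ≤ ζ ^ 2 * (w * LW) + ζ ^ 2 * EE + (2 * ζ * ζd) * τ * (w * G) := by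
  obtain ⟨hα1, hαC, hCe, hee, hCe2⟩ := basics hC hα he he1
  have hα0 : 0 < α := by linarith
  have hCC : C ≤ C ^ 2 := by
    calc C = C * 1 := (mul_one _).symm
      _ ≤ C * C := by gcongr
      _ = _ := by ring
  have hσa : |σ - 1| ≤ 1 / 4 := hσ.trans hCe2
  obtain ⟨hσ1, hσ2⟩ := abs_le.mp hσa
  obtain ⟨hQ1, hQ2⟩ := abs_le.mp hQ
  have hg1p : 0 ≤ g1 := by linarith
  have hKα : K ≤ α ^ 2 := by
    apply le_of_sq_le_sq _ (by positivity)
    refine hK.trans ?_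
    rw [← pow_mul]
    exact pow_le_pow_right₀ (by linarith) (by norm_num)
  have hS : 0 ≤ S := by
    have : 0 ≤ τ * G ^ 2 := by positivity
    by_contra h
    push Not at h
    nlinarith
  obtain ⟨δ, hδ⟩ : ∃ δ, τ * D + Ft = τ * ((Q - 2) + δ) :=
    ⟨D + Ft / τ - (Q - 2), by field_simp; ring⟩
  have hδ1 : |δ| ≤ 2 * C * e ^ 2 := by
    have h1 : τ * δ = τ * (D - Q) + (Ft + 2 * τ) := by linarith
    have h2 : τ * |δ| ≤ τ * (2 * C * e ^ 2) := by
      calc τ * |δ| = |τ * δ| := by rw [abs_mul, abs_of_pos hτ]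
        _ = |τ * (D - Q) + (Ft + 2 * τ)| := by rw [h1]
        _ ≤ |τ * (D - Q)| + |Ft + 2 * τ| := abs_add_le _ _
        _ = τ * |D - Q| + |Ft + 2 * τ| := by rw [abs_mul, abs_of_pos hτ]
        _ ≤ τ * (C * e ^ 2) + C * e ^ 2 * τ := by gcongr
        _ = _ := by ring
    exact le_of_mul_le_mul_left h2 hτ
  obtain ⟨hd1, hd2⟩ := abs_le.mp hδ1
  have hd3 : 2 * C * e ^ 2 ≤ C := by linarith
  have y0 : 0 ≤ τ * w ^ 2 := by positivity
  -- Young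
  have young : ∀ c : ℝ, 2 * c * τ * (w * G) ≥ -((lam / 4) * S) - (4 * C / lam) * c ^ 2 * (τ * w ^ 2) := by
    intro c
    have h1 : 0 ≤ τ * (lam / (4 * C)) * (G + (4 * C / lam) * c * w) ^ 2 := by positivity
    have h2 : τ * (lam / (4 * C)) * (G + (4 * C / lam) * c * w) ^ 2
        = (lam / (4 * C)) * (τ * G ^ 2) + 2 * c * τ * (w * G) + (4 * C / lam) * c ^ 2 * (τ * w ^ 2) := by
      field_simp; ring
    have h3 : (lam / (4 * C)) * (τ * G ^ 2) ≤ (lam / (4 * C)) * (C * S) := by gcongr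
    have h4 : (lam / (4 * C)) * (C * S) = (lam / 4) * S := by field_simp
    linarith
  have m1 : w * LW ≥ -((lam / 4) * S) - (4 * C / lam) * α ^ 2 * (τ * w ^ 2)
      - 10 * C * α ^ 2 * (τ * w ^ 2) := by
    have e1 : w * LW = V * w ^ 2 + 2 * (-g1) * τ * (w * G)
        + (-g2 * σ - g1 * ((Q - 2) + δ) - g1 ^ 2 * σ) * (τ * w ^ 2) := by
      rw [hLW, hδ]; ring
    rw [e1]
    have v1 : V * w ^ 2 ≥ -(α ^ 2 * (τ * w ^ 2)) := by
      have : -(K * e ^ 4 * τ) ≤ V := (abs_le.mp hV).1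
      have h2 : K * e ^ 4 * τ ≤ α ^ 2 * τ := by
        have : e ^ 4 ≤ 1 := pow_le_one₀ he.le (by linarith)
        have : K * e ^ 4 ≤ α ^ 2 * 1 := mul_le_mul hKα this (by positivity) (by positivity)
        gcongr; linarith
      have h3 : 0 ≤ w ^ 2 := sq_nonneg _
      have h4 := mul_le_mul_of_nonneg_right (show -(α ^ 2 * τ) ≤ V by linarith) h3
      linarith
    have v2 := young (-g1)
    have v3 : (4 * C / lam) * (-g1) ^ 2 * (τ * w ^ 2) ≤ (4 * C / lam) * α ^ 2 * (τ * w ^ 2) := by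
      have : (-g1) ^ 2 ≤ α ^ 2 := by rw [neg_sq]; gcongr
      gcongr
    have v4 : -(9 * C * α ^ 2) ≤ -g2 * σ - g1 * ((Q - 2) + δ) - g1 ^ 2 * σ := by
      have b1 : 0 ≤ -g2 * σ := by
        rw [hg2, neg_neg]; exact mul_nonneg (by positivity) (by linarith)
      have b2 : g1 * ((Q - 2) + δ) ≤ α * (2 * C) := by
        calc g1 * ((Q - 2) + δ) ≤ g1 * (2 * C) := by gcongr; linarith
          _ ≤ _ := by gcongr
      have b3 : g1 ^ 2 * σ ≤ α ^ 2 * 2 := by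
        calc g1 ^ 2 * σ ≤ g1 ^ 2 * 2 := by gcongr; linarith
          _ ≤ _ := by gcongr
      have b4 : α ^ 2 * 2 ≤ 2 * C * α ^ 2 := by
        calc α ^ 2 * 2 = 2 * 1 * α ^ 2 := by ring
          _ ≤ _ := by gcongr
      have b5 : α * (2 * C) ≤ 2 * C * α ^ 2 := by
        calc α * (2 * C) = 2 * C * (1 * α) := by ring
          _ ≤ 2 * C * (α * α) := by gcongr; linarith
          _ = _ := by ring
      have b6 : 0 ≤ C * α ^ 2 := by positivity
      linarith
    have v5 := mul_le_mul_of_nonneg_right v4 y0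
    have v6 : α ^ 2 * (τ * w ^ 2) ≤ C * α ^ 2 * (τ * w ^ 2) := by
      have : α ^ 2 ≤ C * α ^ 2 := le_mul_of_one_le_left (by positivity) hC
      gcongr
    linarith
  have m2 : (2 * ζ * ζd) * τ * (w * G) ≥ -((lam / 4) * (ζ ^ 2 * S)) - (4 * C / lam) * ζd ^ 2 * (τ * w ^ 2) := by
    by_cases hz : ζ = 0
    · subst hz
      have : 0 ≤ (4 * C / lam) * ζd ^ 2 * (τ * w ^ 2) := by positivity
      simp; linarith
    · have h1 := young (ζd / ζ)
      have h2 := mul_le_mul_of_nonneg_left h1 (sq_nonneg ζ)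
      have h3 : ζ ^ 2 * (2 * (ζd / ζ) * τ * (w * G)) = (2 * ζ * ζd) * τ * (w * G) := by
        field_simp
      have h4 : ζ ^ 2 * (-((lam / 4) * S) - (4 * C / lam) * (ζd / ζ) ^ 2 * (τ * w ^ 2))
          = -((lam / 4) * (ζ ^ 2 * S)) - (4 * C / lam) * ζd ^ 2 * (τ * w ^ 2) := by
        field_simp
      rw [h3, h4] at h2
      exact h2
  have m3 := mul_le_mul_of_nonneg_left m1 (sq_nonneg ζ)
  have m4 := mul_le_mul_of_nonneg_left hE (sq_nonneg ζ)
  linarith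
end BG

namespace BG
variable {m k : ℕ}

def gf (α s : ℝ) : ℝ := α * (s - Real.exp (s / 2))
def g1f (α s : ℝ) : ℝ := α * (1 - Real.exp (s / 2) / 2)
def g2f (α s : ℝ) : ℝ := -(α * Real.exp (s / 2) / 4)

lemma hd_exp2 (s : ℝ) : HasDerivAt (fun s : ℝ => Real.exp (s / 2)) (Real.exp (s / 2) / 2) s := by
  have h : HasDerivAt (fun s : ℝ => s / 2) (1 / 2) s := (hasDerivAt_id s).div_const 2
  convert h.exp using 1; ring

lemma hd_gf (α s : ℝ) : HasDerivAt (gf α) (g1f α s) s := by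
  have := ((hasDerivAt_id s).sub (hd_exp2 s)).const_mul α
  exact this

lemma hd_g1f (α s : ℝ) : HasDerivAt (g1f α) (g2f α s) s := by
  have := (((hd_exp2 s).div_const 2).const_sub 1).const_mul α
  exact this.congr_deriv (by unfold g2f; ring)

lemma hd_E (α s : ℝ) : HasDerivAt (fun s => Real.exp (-gf α s)) (Real.exp (-gf α s) * (-g1f α s)) s :=
  (hd_gf α s).neg.exp

def wf (γ α : ℝ) (u : E m k → ℝ) (q : E m k) : ℝ := Real.exp (-gf α (sl γ q)) * u q

def Wf (γ α : ℝ) (u : E m k → ℝ) (j : Fin (m + k)) (q : E m k) : ℝ :=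
  Real.exp (-gf α (sl γ q)) * (Xd γ j u q - g1f α (sl γ q) * (tau γ q * yy γ j q) * u q)

section
variable {γ : ℝ} (hγ : 0 < γ) {p : E m k} (hp : p.1 ≠ 0) {n : WithTop ℕ∞}
include hp

lemma cd_N (a : ℝ) : ContDiffAt ℝ n (fun q : E m k => ‖q.1‖ ^ a) p := by
  exact (contDiffAt_fst.norm ℝ hp).rpow_const_of_ne (norm_ne_zero_iff.mpr hp)

lemma cd_hh : ContDiffAt ℝ n (hh γ) p := by
  unfold hh
  exact (cd_N hp _).add (contDiffAt_const.mul (contDiffAt_snd.norm_sq ℝ))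

include hγ
lemma cd_sl : ContDiffAt ℝ n (sl γ) p := by
  have : ContDiffAt ℝ n (fun q => (1 / (2 * (γ + 1))) * Real.log (hh γ q)) p :=
    contDiffAt_const.mul ((cd_hh hp).log (hh_pos hγ hp).ne')
  exact this.congr_of_eventuallyEq (sl_eventually hγ hp)

omit hγ in
lemma cd_om (i : Fin (m + k)) : ContDiffAt ℝ n (om γ i) p := by
  unfold om
  split_ifs
  · exact contDiffAt_const
  · exact cd_N hp _

lemma cd_tau : ContDiffAt ℝ n (tau γ) p := by
  unfold tau
  exact (cd_N hp _).div (cd_hh hp) (hh_pos hγ hp).ne'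

lemma cd_y (i : Fin (m + k)) : ContDiffAt ℝ n (yy γ i) p := by
  unfold yy
  exact (contDiffAt_const.mul (co i).contDiff.contDiffAt).div (cd_om hp i) (om_pos hγ hp i).ne'

lemma cd_Xd {u : E m k → ℝ} (hu : ContDiffAt ℝ 2 u p) (j : Fin (m + k)) :
    ContDiffAt ℝ 1 (Xd γ j u) p := by
  rw [Xd_fun_eq]
  refine (cd_om hp j).mul ?_
  exact (hu.fderiv_right (m := 1) (by norm_num)).clm_apply contDiffAt_const
end

lemma cd_gf (α : ℝ) {n : WithTop ℕ∞} : ContDiff ℝ n (gf α) := by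
  unfold gf; fun_prop
lemma cd_g1f (α : ℝ) {n : WithTop ℕ∞} : ContDiff ℝ n (g1f α) := by
  unfold g1f; fun_prop

section
variable {γ α : ℝ} (hγ : 0 < γ) {p : E m k} (hp : p.1 ≠ 0) {u : E m k → ℝ} (hu : ContDiffAt ℝ 2 u p)
include hγ hp hu

lemma cd_wf : ContDiffAt ℝ 2 (wf γ α u) p := by
  unfold wf
  exact ((cd_gf α).contDiffAt.comp p (cd_sl hγ hp)).neg.exp.mul hu

omit hu in
lemma Xd_wf (hu : DifferentiableAt ℝ u p) (j : Fin (m + k)) : Xd γ j (wf γ α u) p = Wf γ α u j p := by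
  unfold wf Wf
  have hE := hd_E α (sl γ p)
  rw [Xd_mul j (da_rad hγ hp hE) hu, Xd_rad hγ hp j hE]
  ring

lemma Wf_ev (j : Fin (m + k)) : Wf γ α u j =ᶠ[nhds p] Xd γ j (wf γ α u) := by
  have h1 : ∀ᶠ q in nhds p, ContDiffAt ℝ 2 u q := hu.eventually (by norm_num)
  filter_upwards [h1, isOpen_Om.mem_nhds hp] with q h2 h3
  exact (Xd_wf hγ h3 (h2.differentiableAt (by norm_num)) j).symm

lemma cd_Wf (j : Fin (m + k)) : ContDiffAt ℝ 1 (Wf γ α u j) p :=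
  (cd_Xd hγ hp (cd_wf hγ hp hu) j).congr_of_eventuallyEq (Wf_ev hγ hp hu j)

lemma da_Wf (j : Fin (m + k)) : DifferentiableAt ℝ (Wf γ α u j) p :=
  (cd_Wf hγ hp hu j).differentiableAt (by norm_num)

lemma Wf_comm (i j : Fin (m + k)) : Xd γ i (Wf γ α u j) p = Xd γ j (Wf γ α u i) p
    + gam γ j * nu i p * Wf γ α u j p - gam γ i * nu j p * Wf γ α u i p := by
  rw [Xd_congr i (Wf_ev hγ hp hu j), Xd_congr j (Wf_ev hγ hp hu i), Xd_comm hγ hp (cd_wf hγ hp hu),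
    (Wf_ev hγ hp hu i).eq_of_nhds, (Wf_ev hγ hp hu j).eq_of_nhds]

variable {A : E m k → Matrix (Fin (m + k)) (Fin (m + k)) ℝ} (hA : C1coeff A) (hsym : Symm A)
include hA hsym

lemma LW_eq {v : ℝ} (hL : Lop γ A u p = v * u p) :
    ∑ i, Xd γ i (PP A (Wf γ α u) i) p = v * wf γ α u p
      - 2 * g1f α (sl γ p) * tau γ p * (∑ j, ff γ A j p * Wf γ α u j p)
      - g2f α (sl γ p) * tau γ p * sg γ A p * wf γ α u p
      - g1f α (sl γ p) * (tau γ p * (∑ i, Xd γ i (ff γ A i) p) + FF γ A (tau γ) p) * wf γ α u p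
      - g1f α (sl γ p) ^ 2 * tau γ p * sg γ A p * wf γ α u p := by
  set U : Fin (m + k) → E m k → ℝ := fun j => Xd γ j u with hU
  have dU : ∀ j, DifferentiableAt ℝ (U j) p := fun j => da_W hγ hp hu j
  have du : DifferentiableAt ℝ u p := hu.differentiableAt (by norm_num)
  have hE := hd_E α (sl γ p)
  set φ : ℝ → ℝ := fun s => Real.exp (-gf α s) * g1f α s with hφ
  have hφ1 : HasDerivAt φ (Real.exp (-gf α (sl γ p)) * (g2f α (sl γ p) - g1f α (sl γ p) ^ 2)) (sl γ p) := by
    exact (hE.fun_mul (hd_g1f α (sl γ p))).congr_deriv (by ring)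
  have dφ := da_rad hγ hp hφ1
  have dE := da_rad hγ hp hE
  have dt := da_tau hγ hp
  set S : E m k → ℝ := fun q => φ (sl γ q) * (tau γ q * u q) with hS
  have dS : DifferentiableAt ℝ S p := dφ.fun_mul (dt.fun_mul du)
  have dP := da_PP hA dU
  have eP : ∀ i, PP A (Wf γ α u) i = fun q => Real.exp (-gf α (sl γ q)) * PP A U i q - ff γ A i q * S q := by
    intro i; funext q
    simp only [PP, ff_eq, hS, hφ, hU, Wf, Finset.mul_sum, Finset.sum_mul, ← Finset.sum_sub_distrib]
    refine Finset.sum_congr rfl fun j _ => ?_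
    rw [hsym q i j]; ring
  have e1 : ∀ i, Xd γ i (PP A (Wf γ α u) i) p = Real.exp (-gf α (sl γ p)) * Xd γ i (PP A U i) p
      + (-(Real.exp (-gf α (sl γ p)) * g1f α (sl γ p)) * tau γ p) * (PP A U i p * yy γ i p)
      - Xd γ i (fun q => ff γ A i q * S q) p := by
    intro i
    rw [eP i, Xd_sub i (dE.fun_mul (dP i)) ((da_ff hγ hp hA i).fun_mul dS), Xd_mul i dE (dP i),
      Xd_rad hγ hp i hE]
    ring
  have eL : ∑ i, Xd γ i (PP A U i) p = v * u p := by
    rw [← hL]; unfold Lop PP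
    refine Finset.sum_congr rfl fun i _ => ?_
    rw [Xd_sum _ i (fun j _ => (da_A hA i j).fun_mul (dU j))]
  simp only [e1, Finset.sum_sub_distrib, Finset.sum_add_distrib, ← Finset.mul_sum]
  rw [eL, sum_P_y hsym, div_fS hγ hp hA dS, hS, FF_mul A dφ (dt.fun_mul du), FF_rad hγ hp hφ1,
    FF_mul A dt du]
  have eG : ∑ j, ff γ A j p * Wf γ α u j p = Real.exp (-gf α (sl γ p)) * FF γ A u p
      - Real.exp (-gf α (sl γ p)) * g1f α (sl γ p) * u p * sg γ A p := by
    rw [← tau_f_y hγ hp]; unfold FF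
    simp only [Finset.mul_sum, ← Finset.sum_sub_distrib]
    refine Finset.sum_congr rfl fun j _ => ?_
    unfold Wf; ring
  have eF : ∑ j, ff γ A j p * U j p = FF γ A u p := rfl
  rw [eG, eF, wf, hφ]
  ring

omit hu hsym in
lemma FF_kappa (Q : ℝ) :
    DifferentiableAt ℝ (fun q => g1f α (sl γ q) ^ 2 * sg γ A q + (Q - 2) * g1f α (sl γ q)) p ∧
    FF γ A (fun q => g1f α (sl γ q) ^ 2 * sg γ A q + (Q - 2) * g1f α (sl γ q)) p
      = 2 * g1f α (sl γ p) * g2f α (sl γ p) * sg γ A p ^ 2 + g1f α (sl γ p) ^ 2 * FF γ A (sg γ A) p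
        + (Q - 2) * g2f α (sl γ p) * sg γ A p := by
  have h1 : HasDerivAt (fun s => g1f α s ^ 2) (2 * g1f α (sl γ p) * g2f α (sl γ p)) (sl γ p) := by
    exact ((hd_g1f α (sl γ p)).fun_pow 2).congr_deriv (by simp)
  have h2 : HasDerivAt (fun s => (Q - 2) * g1f α s) ((Q - 2) * g2f α (sl γ p)) (sl γ p) :=
    (hd_g1f α (sl γ p)).const_mul _
  have d1 := da_rad hγ hp h1
  have d2 := da_rad hγ hp h2
  have ds := da_sg hγ hp hA
  refine ⟨(d1.fun_mul ds).fun_add d2, ?_⟩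
  rw [FF_add A (d1.fun_mul ds) d2, FF_mul A d1 ds, FF_rad hγ hp h1, FF_rad hγ hp h2]
  ring
end
end BG

namespace BG
variable {m k : ℕ}

lemma scalar_tot {lam C α e Q X χ χd η ηd M L S y main en1 en2 : ℝ} (hlam : 0 < lam)
    (hC : 1 ≤ C) (hQ : |Q - 2| ≤ C) (hα : 1 ≤ α) (he : 0 < e) (he0 : e ≤ 1) (hM : 0 ≤ M)
    (hX : 0 ≤ X) (hS : 0 ≤ S) (hy : 0 ≤ y) (hL : 0 ≤ L)
    (he1 : 6 * C ^ 3 / lam * (L + 10 * C + L * (2 * C ^ 2)) * e ≤ 1 / 64)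
    (hMη : 2 * |χ * χd| ≤ M * η ^ 2)
    (h0 : main ≤ -(1 / 32) * α ^ 2 * e * (χ ^ 2 * X * y) + 3 * C ^ 3 * e ^ 2 * (χ ^ 2 * X * S)
      + 3 * C * |2 * (χ * χd) * X| * (S + α ^ 2 * y))
    (h1 : (lam / 2) * (χ ^ 2 * X * e ^ 2) * S - (L + 10 * C) * α ^ 2 * ((χ ^ 2 * X * e ^ 2) * y)
      - L * (((χd + (3 - Q) / 2 * χ) ^ 2 * X * e ^ 2) * y) ≤ en1)
    (h2 : (lam / 2) * (η ^ 2 * X) * S - (L + 10 * C) * α ^ 2 * ((η ^ 2 * X) * y)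
      - L * (((ηd + (2 - Q) / 2 * η) ^ 2 * X) * y) ≤ en2) :
    main - 6 * C ^ 3 / lam * en1 - 6 * C * M / lam * en2 ≤
      -(1 / 64) * α ^ 2 * e * (χ ^ 2 * X * y)
      + (6 * C + 2 * (6 * C ^ 3 / lam * L) + 6 * C * M / lam * (L + 10 * C)
        + 6 * C * M / lam * L * (2 + 2 * C ^ 2)) * α ^ 2
        * ((|χ * χd| + χd ^ 2 + η ^ 2 + ηd ^ 2) * X * y) := by
  obtain ⟨hQ1, hQ2⟩ := abs_le.mp hQ
  set M1 := 6 * C ^ 3 / lam with hM1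
  set M2 := 6 * C * M / lam with hM2
  have hC0 : 0 ≤ C := by linarith
  have p1 : 0 ≤ M1 := by positivity
  have p2 : 0 ≤ M2 := by positivity
  have hα2 : 1 ≤ α ^ 2 := one_le_pow₀ hα
  have q1 := mul_le_mul_of_nonneg_left h1 p1
  have q2 := mul_le_mul_of_nonneg_left h2 p2
  have sqb : ∀ a c d : ℝ, |c| ≤ C → (a + c * d) ^ 2 ≤ 2 * a ^ 2 + 2 * C ^ 2 * d ^ 2 := by
    intro a c d hc
    have h3 : c ^ 2 ≤ C ^ 2 := by rw [← sq_abs c]; gcongr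
    calc (a + c * d) ^ 2 ≤ 2 * a ^ 2 + 2 * c ^ 2 * d ^ 2 := by
          have := sq_nonneg (a - c * d)
          linarith
      _ ≤ _ := by gcongr
  have s1 := sqb χd ((3 - Q) / 2) χ (by rw [abs_le]; constructor <;> linarith)
  have s2 := sqb ηd ((2 - Q) / 2) η (by rw [abs_le]; constructor <;> linarith)
  -- S terms
  have t1 : M1 * ((lam / 2) * (χ ^ 2 * X * e ^ 2) * S) = 3 * C ^ 3 * e ^ 2 * (χ ^ 2 * X * S) := by
    rw [hM1]; field_simp; ring
  have t2 : M2 * ((lam / 2) * (η ^ 2 * X) * S) = 3 * C * (M * η ^ 2) * (X * S) := by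
    rw [hM2]; field_simp; ring
  have t3 : 3 * C * |2 * (χ * χd) * X| * (S + α ^ 2 * y)
      ≤ 3 * C * (M * η ^ 2) * (X * S) + 6 * C * α ^ 2 * (|χ * χd| * X * y) := by
    rw [abs_mul, abs_mul, abs_of_nonneg hX, abs_two]
    have : 3 * C * (2 * |χ * χd|) * (X * S) ≤ 3 * C * (M * η ^ 2) * (X * S) := by gcongr
    linarith
  -- y terms, chi
  have t4 : M1 * (L * (((χd + (3 - Q) / 2 * χ) ^ 2 * X * e ^ 2) * y))
      ≤ M1 * L * (2 * C ^ 2) * α ^ 2 * e * e * (χ ^ 2 * X * y) + 2 * (M1 * L) * α ^ 2 * (χd ^ 2 * X * y) := by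
    have a1 : M1 * (L * (((χd + (3 - Q) / 2 * χ) ^ 2 * X * e ^ 2) * y))
      ≤ M1 * (L * (((2 * χd ^ 2 + 2 * C ^ 2 * χ ^ 2) * X * e ^ 2) * y)) := by gcongr
    have a2 : M1 * L * (2 * C ^ 2) * 1 * e * e * (χ ^ 2 * X * y)
        ≤ M1 * L * (2 * C ^ 2) * α ^ 2 * e * e * (χ ^ 2 * X * y) := by gcongr
    have a3 : 2 * (M1 * L) * 1 * (χd ^ 2 * X * y) * e ^ 2 ≤ 2 * (M1 * L) * α ^ 2 * (χd ^ 2 * X * y) * 1 := by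
      gcongr; exact pow_le_one₀ he.le he0
    linarith
  have t5 : M1 * (L + 10 * C + L * (2 * C ^ 2)) * e * (α ^ 2 * e * (χ ^ 2 * X * y))
      ≤ 1 / 64 * (α ^ 2 * e * (χ ^ 2 * X * y)) := by gcongr
  have t6 : M2 * (L * (((ηd + (2 - Q) / 2 * η) ^ 2 * X) * y))
      ≤ M2 * L * (2 + 2 * C ^ 2) * α ^ 2 * ((η ^ 2 + ηd ^ 2) * X * y) := by
    have a0 : 2 * ηd ^ 2 + 2 * C ^ 2 * η ^ 2 ≤ (2 + 2 * C ^ 2) * (η ^ 2 + ηd ^ 2) := by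
      have : 0 ≤ C ^ 2 * ηd ^ 2 := by positivity
      have : 0 ≤ η ^ 2 := by positivity
      linarith
    calc M2 * (L * (((ηd + (2 - Q) / 2 * η) ^ 2 * X) * y))
        ≤ M2 * (L * ((((2 + 2 * C ^ 2) * (η ^ 2 + ηd ^ 2)) * X) * y)) := by
          gcongr; exact s2.trans a0
      _ = M2 * L * (2 + 2 * C ^ 2) * 1 * ((η ^ 2 + ηd ^ 2) * X * y) := by ring
      _ ≤ _ := by gcongr
  have n1 : 0 ≤ 6 * C * α ^ 2 * ((χd ^ 2 + η ^ 2 + ηd ^ 2) * X * y) := by positivity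
  have n2 : 0 ≤ 2 * (M1 * L) * α ^ 2 * ((|χ * χd| + η ^ 2 + ηd ^ 2) * X * y) := by positivity
  have n3 : 0 ≤ M2 * (L + 10 * C) * α ^ 2 * ((|χ * χd| + χd ^ 2 + ηd ^ 2) * X * y) := by positivity
  have n4 : 0 ≤ M2 * L * (2 + 2 * C ^ 2) * α ^ 2 * ((|χ * χd| + χd ^ 2) * X * y) := by positivity
  linarith

/-- universal constant -/
def CU (m k : ℕ) (γ Λ lam : ℝ) : ℝ :=
  1 + CG m k γ Λ + ((m + k : ℕ) : ℝ) ^ 2 * (1 + Λ) * CG m k γ Λ + ((m + k : ℕ) : ℝ) * CG m k γ Λ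
    + ((m + k : ℕ) : ℝ) * CG m k γ Λ ^ 2 + lam⁻¹ + |QQ m k γ - 2|

lemma sumabs_sq (W : Fin (m + k) → ℝ) :
    (∑ i, |W i|) ^ 2 ≤ ((m + k : ℕ) : ℝ) * ∑ i, W i ^ 2 := by
  have := sq_sum_le_card_mul_sum_sq (s := Finset.univ) (f := fun i => |W i|)
  simpa using this

lemma abs_sum_mul (a W : Fin (m + k) → ℝ) (c : ℝ) (h : ∀ i, |a i| ≤ c) :
    |∑ i, a i * W i| ≤ c * ∑ i, |W i| := by
  rw [Finset.mul_sum]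
  refine (Finset.abs_sum_le_sum_abs _ _).trans (Finset.sum_le_sum fun i _ => ?_)
  rw [abs_mul]; gcongr; exact h i

end BG

namespace BG
variable {m k : ℕ}

/-- continuous representative of G -/
def Gf (γ α : ℝ) (A : E m k → Matrix (Fin (m + k)) (Fin (m + k)) ℝ) (u : E m k → ℝ) (q : E m k) : ℝ :=
  Real.exp (-gf α (sl γ q)) * (Zd γ u q - g1f α (sl γ q) * u q) + ∑ j, cc γ A j q * Wf γ α u j q

def kap (γ α : ℝ) (A : E m k → Matrix (Fin (m + k)) (Fin (m + k)) ℝ) (q : E m k) : ℝ :=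
  g1f α (sl γ q) ^ 2 * sg γ A q + (QQ m k γ - 2) * g1f α (sl γ q)

def Th (Q : ℝ) (χ : ℝ → ℝ) (s : ℝ) : ℝ := χ s ^ 2 * Real.exp ((2 - Q) * s)
def ze (Q : ℝ) (χ : ℝ → ℝ) (s : ℝ) : ℝ := (χ s * Real.exp (Q / 2 * s)) ^ 2

def vmain (γ α : ℝ) (A : E m k → Matrix (Fin (m + k)) (Fin (m + k)) ℝ) (u : E m k → ℝ) (χ : ℝ → ℝ)
    (i : Fin (m + k)) (q : E m k) : ℝ :=
  Th (QQ m k γ) χ (sl γ q) * (PP A (Wf γ α u) i q * Gf γ α A u q)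
      + (-1 / 2) * (ff γ A i q * (Th (QQ m k γ) χ (sl γ q) * EE A (Wf γ α u) q))
      + (1 / 2) * (ff γ A i q * (tau γ q * (Th (QQ m k γ) χ (sl γ q)
        * (kap γ α A q * (wf γ α u q * wf γ α u q)))))

def ven (γ α : ℝ) (A : E m k → Matrix (Fin (m + k)) (Fin (m + k)) ℝ) (u : E m k → ℝ) (Q : ℝ) (χ : ℝ → ℝ)
    (i : Fin (m + k)) (q : E m k) : ℝ :=
  ze Q χ (sl γ q) * (wf γ α u q * PP A (Wf γ α u) i q)

lemma hd_expc (c s : ℝ) : HasDerivAt (fun s : ℝ => Real.exp (c * s)) (Real.exp (c * s) * c) s := by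
  have h : HasDerivAt (fun s : ℝ => c * s) c s := by simpa using (hasDerivAt_id s).const_mul c
  exact h.exp

lemma hd_Th (Q : ℝ) {χ : ℝ → ℝ} {χd s : ℝ} (h : HasDerivAt χ χd s) :
    HasDerivAt (Th Q χ) ((2 - Q) * Th Q χ s + 2 * (χ s * χd) * Real.exp ((2 - Q) * s)) s :=
  ((h.fun_pow 2).fun_mul (hd_expc (2 - Q) s)).congr_deriv (by unfold Th; push_cast; ring)

lemma hd_ze (Q : ℝ) {χ : ℝ → ℝ} {χd s : ℝ} (h : HasDerivAt χ χd s) :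
    HasDerivAt (ze Q χ) (2 * (χ s * Real.exp (Q / 2 * s)) * ((χd + Q / 2 * χ s) * Real.exp (Q / 2 * s))) s :=
  ((h.fun_mul (hd_expc (Q / 2) s)).fun_pow 2).congr_deriv (by push_cast; ring)

lemma sum_y_Xd {γ : ℝ} (hγ : 0 < γ) {p : E m k} (hp : p.1 ≠ 0) (u : E m k → ℝ) :
    ∑ j, yy γ j p * Xd γ j u p = Zd γ u p := by
  have h1 : ∀ j : Fin (m + k), yy γ j p * Xd γ j u p = fderiv ℝ u p (((1 + gam γ j) * co j p) • ev j) := by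
    intro j
    rw [Xd_eq, map_smul, smul_eq_mul]
    unfold yy
    have := om_pos hγ hp j
    field_simp
  simp only [h1]
  rw [← map_sum]
  unfold Zd
  congr 1
  rw [Fin.sum_univ_add]
  ext i
  · simp [Prod.fst_sum, Prod.fst_add, Finset.sum_apply, Pi.single_apply]
  · simp [Prod.snd_sum, Prod.snd_add, Finset.sum_apply, Pi.single_apply]
    left; ring

lemma Gf_eq {γ α : ℝ} (hγ : 0 < γ) {p : E m k} (hp : p.1 ≠ 0) (u : E m k → ℝ)
    (A : E m k → Matrix (Fin (m + k)) (Fin (m + k)) ℝ) :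
    Gf γ α A u p = ∑ j, ff γ A j p * Wf γ α u j p := by
  unfold Gf ff
  simp only [add_mul, Finset.sum_add_distrib]
  congr 1
  have h2 := sum_y_sq hγ hp
  have e : ∀ j, yy γ j p * Wf γ α u j p = Real.exp (-gf α (sl γ p)) * (yy γ j p * Xd γ j u p)
      - Real.exp (-gf α (sl γ p)) * g1f α (sl γ p) * u p * tau γ p * yy γ j p ^ 2 := by
    intro j; unfold Wf; ring
  simp only [e, Finset.sum_sub_distrib, ← Finset.mul_sum]
  rw [sum_y_Xd hγ hp, mul_assoc _ (tau γ p), h2]; ring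

/-- the constants needed in scalar lemmas -/
structure SB (C : ℝ) (lam γ α : ℝ) (A : E m k → Matrix (Fin (m + k)) (Fin (m + k)) ℝ) (u : E m k → ℝ)
    (p : E m k) : Prop where
  sg : |sg γ A p - 1| ≤ C * rho γ p
  div : |∑ j, Xd γ j (ff γ A j) p - QQ m k γ| ≤ C * rho γ p
  ft : |FF γ A (tau γ) p + 2 * tau γ p| ≤ C * rho γ p * tau γ p
  fs : |FF γ A (BG.sg γ A) p| ≤ C * rho γ p
  e0 : lam * ∑ i, Wf γ α u i p ^ 2 ≤ EE A (Wf γ α u) p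
  e1 : EE A (Wf γ α u) p ≤ C * ∑ i, Wf γ α u i p ^ 2
  aa : |∑ i, ∑ j, FF γ A (fun q => A q i j) p * Wf γ α u i p * Wf γ α u j p|
    ≤ C * rho γ p * ∑ i, Wf γ α u i p ^ 2
  G : tau γ p * (∑ j, ff γ A j p * Wf γ α u j p) ^ 2 ≤ C * ∑ i, Wf γ α u i p ^ 2
  r : ∃ r : Fin (m + k) → Fin (m + k) → ℝ,
    (|∑ i, PP A (Wf γ α u) i p * ∑ j, r i j * Wf γ α u j p| ≤ C * rho γ p * ∑ i, Wf γ α u i p ^ 2) ∧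
    ∀ (W : Fin (m + k) → ℝ) (i : Fin (m + k)), ∑ j, Xd γ i (ff γ A j) p * W j
      + ∑ j, ff γ A j p * (gam γ j * nu i p * W j - gam γ i * nu j p * W i)
      = W i + ∑ j, r i j * W j

lemma SB_of {γ Λ lam α : ℝ} (hγ : 0 < γ) (hΛ : 0 < Λ) (hlam : 0 < lam)
    {A : E m k → Matrix (Fin (m + k)) (Fin (m + k)) ℝ} {p : E m k} (hp : p.1 ≠ 0)
    (hA : C1coeff A) (hE : Elliptic lam A) (hH : HypH γ Λ A) (hp1 : rho γ p < 1) (u : E m k → ℝ) :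
    SB (CU m k γ Λ lam) lam γ α A u p := by
  have hPB := PB_of_H hγ hΛ hH hp hp1
  obtain ⟨-, hqf, hsg, hdiv, hft, hfa, hfs, r, hr, hr'⟩ := GB_of_PB hγ hΛ hp hA hPB hp1
  have hCG := CG_ge (m := m) (k := k) hγ hΛ
  set C0 := CG m k γ Λ with hC0
  have hC0' : 0 ≤ C0 := by linarith
  set n : ℝ := ((m + k : ℕ) : ℝ) with hn
  have hn0 : 0 ≤ n := Nat.cast_nonneg _
  have hρ := rho_pos hγ hp
  have hτ := tau_pos hγ hp
  set S := ∑ i, Wf γ α u i p ^ 2 with hS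
  have hS0 : 0 ≤ S := Finset.sum_nonneg fun i _ => sq_nonneg _
  set T := ∑ i, |Wf γ α u i p| with hT
  have hT0 : 0 ≤ T := Finset.sum_nonneg fun i _ => abs_nonneg _
  have hTS : T ^ 2 ≤ n * S := sumabs_sq _
  have hCU : CU m k γ Λ lam = 1 + C0 + n ^ 2 * (1 + Λ) * C0 + n * C0
    + n * C0 ^ 2 + lam⁻¹ + |QQ m k γ - 2| := rfl
  set C := CU m k γ Λ lam
  have x1 : 0 ≤ n ^ 2 * (1 + Λ) * C0 := by positivity
  have x2 : 0 ≤ n * C0 := by positivity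
  have x3 : 0 ≤ n * C0 ^ 2 := by positivity
  have x4 : 0 ≤ lam⁻¹ := by positivity
  have x5 : 0 ≤ |QQ m k γ - 2| := abs_nonneg _
  have l1 : C0 ≤ C := by linarith
  have l2 : n ^ 2 * (1 + Λ) * C0 ≤ C := by linarith
  have l3 : n * C0 ≤ C := by linarith
  have l4 : n * C0 ^ 2 ≤ C := by linarith
  have l5 : lam⁻¹ ≤ C := by linarith
  have hEE : EE A (Wf γ α u) p = ∑ i, ∑ j, A p i j * Wf γ α u i p * Wf γ α u j p := by
    unfold EE PP
    refine Finset.sum_congr rfl fun i _ => ?_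
    rw [Finset.sum_mul]
    refine Finset.sum_congr rfl fun j _ => ?_
    ring
  obtain ⟨hE1, hE2⟩ := hE p (fun i => Wf γ α u i p)
  have hAb : ∀ i j, |A p i j| ≤ 1 + Λ := by
    intro i j
    have h1 := hPB.b i j
    have h2 : A p i j = (A p - 1) i j + (1 : Matrix (Fin (m + k)) (Fin (m + k)) ℝ) i j := by simp
    have h3 : |(1 : Matrix (Fin (m + k)) (Fin (m + k)) ℝ) i j| ≤ 1 := by
      rw [Matrix.one_apply]; split_ifs <;> simp
    rw [h2]
    refine (abs_add_le _ _).trans ?_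
    have : Λ * rho γ p ≤ Λ * 1 := by gcongr
    linarith
  have dbl : ∀ c : ℝ, 0 ≤ c → ∀ a : Fin (m + k) → Fin (m + k) → ℝ, (∀ i j, |a i j| ≤ c) →
      ∀ i, |∑ j, a i j * Wf γ α u j p| ≤ c * T := fun c _ a h i => abs_sum_mul _ _ c (h i)
  refine ⟨hsg.trans (by gcongr), hdiv.trans (by gcongr), hft.trans (by gcongr), hfs.trans (by gcongr),
    hEE ▸ hE1, (hEE ▸ hE2).trans (by gcongr), ?_, ?_, r, ?_, hr'⟩
  · have e : ∑ i, ∑ j, FF γ A (fun q => A q i j) p * Wf γ α u i p * Wf γ α u j p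
        = ∑ i, (∑ j, FF γ A (fun q => A q i j) p * Wf γ α u j p) * Wf γ α u i p := by
      refine Finset.sum_congr rfl fun i _ => ?_
      rw [Finset.sum_mul]
      refine Finset.sum_congr rfl fun j _ => ?_
      ring
    rw [e]
    have h1 := dbl (C0 * rho γ p) (by positivity) (fun i j => FF γ A (fun q => A q i j) p) hfa
    refine (abs_sum_mul _ _ _ h1).trans ?_
    calc C0 * rho γ p * T * T = C0 * rho γ p * T ^ 2 := by ring
      _ ≤ C0 * rho γ p * (n * S) := by gcongr
      _ = (n * C0) * rho γ p * S := by ring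
      _ ≤ _ := by gcongr
  · have h1 : ∀ j, |√(tau γ p) * ff γ A j p| ≤ C0 := by
      intro j; rw [abs_mul, abs_of_nonneg (Real.sqrt_nonneg _)]; exact hqf j
    have h2 := abs_sum_mul _ (fun j => Wf γ α u j p) C0 h1
    have h3 : tau γ p * (∑ j, ff γ A j p * Wf γ α u j p) ^ 2
        = |∑ j, √(tau γ p) * ff γ A j p * Wf γ α u j p| ^ 2 := by
      rw [sq_abs]
      simp only [mul_assoc]
      rw [← Finset.mul_sum, mul_pow, Real.sq_sqrt hτ.le]
    rw [h3]
    calc _ ≤ (C0 * T) ^ 2 := by gcongr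
      _ = C0 ^ 2 * T ^ 2 := by ring
      _ ≤ C0 ^ 2 * (n * S) := by gcongr
      _ = (n * C0 ^ 2) * S := by ring
      _ ≤ _ := by gcongr
  · have h1 := dbl (C0 * rho γ p) (by positivity) r hr
    have h2 := dbl (1 + Λ) (by positivity) (A p) hAb
    calc |∑ i, PP A (Wf γ α u) i p * ∑ j, r i j * Wf γ α u j p|
        ≤ n * (((1 + Λ) * T) * (C0 * rho γ p * T)) := by
          apply sum_bd
          intro i; rw [abs_mul]
          exact mul_le_mul (h2 i) (h1 i) (abs_nonneg _) (by positivity)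
      _ = n * (1 + Λ) * C0 * rho γ p * T ^ 2 := by ring
      _ ≤ n * (1 + Λ) * C0 * rho γ p * (n * S) := by gcongr
      _ = (n ^ 2 * (1 + Λ) * C0) * rho γ p * S := by ring
      _ ≤ _ := by gcongr

def vtot (γ α C lam M : ℝ) (A : E m k → Matrix (Fin (m + k)) (Fin (m + k)) ℝ) (u : E m k → ℝ)
    (χ η : ℝ → ℝ) (i : Fin (m + k)) (q : E m k) : ℝ :=
  vmain γ α A u χ i q + (-(6 * C ^ 3 / lam)) * ven γ α A u (3 - QQ m k γ) χ i q
    + (-(6 * C * M / lam)) * ven γ α A u (2 - QQ m k γ) η i q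

def DD (C lam M : ℝ) : ℝ := 6 * C + 2 * (6 * C ^ 3 / lam * (4 * C / lam)) + 6 * C * M / lam * (4 * C / lam + 10 * C)
        + 6 * C * M / lam * (4 * C / lam) * (2 + 2 * C ^ 2)

lemma pw {γ Λ lam α K M : ℝ} (hγ : 0 < γ) (hΛ : 0 < Λ) (hlam : 0 < lam)
    {A : E m k → Matrix (Fin (m + k)) (Fin (m + k)) ℝ} {p : E m k} (hp : p.1 ≠ 0)
    (hA : C1coeff A) (hsym : Symm A) (hE : Elliptic lam A) (hH : HypH γ Λ A) (hp1 : rho γ p < 1)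
    {u : E m k → ℝ} (hu : ContDiffAt ℝ 2 u p) {C : ℝ} (hC : C = CU m k γ Λ lam)
    (hα : 100 * C ^ 2 ≤ α) (he1 : 1000 * C ^ 2 * Real.exp (sl γ p / 2) ≤ 1)
    (he2 : 6 * C ^ 3 / lam * (4 * C / lam + 10 * C + 4 * C / lam * (2 * C ^ 2)) * Real.exp (sl γ p / 2) ≤ 1 / 64)
    {v : ℝ} (hL : Lop γ A u p = v * u p) (hv : |v| ≤ K * psi γ p) (hK0 : 0 ≤ K) (hK : K ^ 2 ≤ α ^ 3)
    {χ η χd ηd : ℝ → ℝ} (hχ : ∀ s, HasDerivAt χ (χd s) s) (hη : ∀ s, HasDerivAt η (ηd s) s)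
    (hM : 0 ≤ M) (hMη : ∀ s, 2 * |χ s * χd s| ≤ M * η s ^ 2) :
    ∑ i, Xd γ i (vtot γ α C lam M A u χ η i) p ≤
      -(1 / 64) * α ^ 2 * Real.exp (sl γ p / 2) * (χ (sl γ p) ^ 2 * Real.exp ((2 - QQ m k γ) * sl γ p)
        * (tau γ p * wf γ α u p ^ 2))
      + DD C lam M * α ^ 2
        * ((|χ (sl γ p) * χd (sl γ p)| + χd (sl γ p) ^ 2 + η (sl γ p) ^ 2 + ηd (sl γ p) ^ 2)
          * Real.exp ((2 - QQ m k γ) * sl γ p) * (tau γ p * wf γ α u p ^ 2)) := by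
  have hSB : SB C lam γ α A u p := hC ▸ SB_of hγ hΛ hlam hp hA hE hH hp1 u
  obtain ⟨hsg, hdiv, hft, hfs, hE0, hE1, hAA, hG, r, hRR, hr⟩ := hSB
  have hCG := CG_ge (m := m) (k := k) hγ hΛ
  have x : 0 ≤ ((m + k : ℕ) : ℝ) := Nat.cast_nonneg _
  have hC1 : 1 ≤ C ∧ |QQ m k γ - 2| ≤ C := by
    rw [hC]; unfold CU
    have x0 : 0 ≤ CG m k γ Λ := by linarith
    have x1 : 0 ≤ ((m + k : ℕ) : ℝ) ^ 2 * (1 + Λ) * CG m k γ Λ := by positivity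
    have x2 : 0 ≤ ((m + k : ℕ) : ℝ) * CG m k γ Λ := by positivity
    have x3 : 0 ≤ ((m + k : ℕ) : ℝ) * CG m k γ Λ ^ 2 := by positivity
    have x4 : 0 ≤ lam⁻¹ := by positivity
    have x5 : 0 ≤ |QQ m k γ - 2| := abs_nonneg _
    constructor <;> linarith
  obtain ⟨hC1, hQ⟩ := hC1
  set e := Real.exp (sl γ p / 2) with he
  have he0 : 0 < e := Real.exp_pos _
  have hee : rho γ p = e ^ 2 := by
    rw [he, ← Real.exp_nat_mul, ← exp_sl hγ hp]; congr 1; push_cast; ring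
  rw [hee] at hsg hdiv hft hfs hAA hRR
  have hτ := tau_pos hγ hp
  have hpsi : |v| ≤ K * e ^ 4 * tau γ p := by
    rw [psi_eq hγ hp, hee] at hv
    exact hv.trans (le_of_eq (by ring))
  obtain ⟨hα1, -, -, hee1, -⟩ := basics hC1 hα he0 he1
  have hα0 : 0 < α := by linarith
  have hg1 : α / 2 ≤ g1f α (sl γ p) := by
    unfold g1f
    rw [← he]
    have : α * (1 / 2) ≤ α * (1 - e / 2) := by gcongr; linarith
    linarith
  have hg1' : g1f α (sl γ p) ≤ α := by
    unfold g1f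
    rw [← he]
    have : α * (1 - e / 2) ≤ α * 1 := by gcongr; linarith
    linarith
  have hg2 : g2f α (sl γ p) = -(α * e / 4) := rfl
  have hS0 : 0 ≤ ∑ i, Wf γ α u i p ^ 2 := Finset.sum_nonneg fun i _ => sq_nonneg _
  have hEE0 : 0 ≤ EE A (Wf γ α u) p := le_trans (by positivity) hE0
  set Q := QQ m k γ with hQd
  set s := sl γ p with hs
  have hLW := LW_eq (α := α) hγ hp hu hA hsym hL
  obtain ⟨dκ, eκ⟩ := FF_kappa (α := α) hγ hp hA Q
  have hGp := Gf_eq (α := α) hγ hp u A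
  have hGev : Gf γ α A u =ᶠ[nhds p] fun q => ∑ j, ff γ A j q * Wf γ α u j q := by
    filter_upwards [isOpen_Om.mem_nhds hp] with q hq
    exact Gf_eq hγ hq u A
  have dW := fun j => da_Wf (α := α) hγ hp hu j
  have dw : DifferentiableAt ℝ (wf γ α u) p := (cd_wf hγ hp hu).differentiableAt (by norm_num)
  have hwX := fun i => Xd_wf (α := α) hγ hp (hu.differentiableAt (by norm_num)) i
  have main := div_main hγ hp hA hsym dW dw hwX (Wf_comm hγ hp hu) hGev dκ hr (hd_Th Q (hχ s))
  have en1 := div_energy hγ hp hA hsym dW dw hwX (hd_ze (3 - Q) (hχ s))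
  have en2 := div_energy hγ hp hA hsym dW dw hwX (hd_ze (2 - Q) (hη s))
  have dG : DifferentiableAt ℝ (Gf γ α A u) p :=
    (DifferentiableAt.fun_sum fun j _ => (da_ff hγ hp hA j).fun_mul (dW j)).congr_of_eventuallyEq hGev
  have dΘ := da_rad hγ hp (hd_Th Q (hχ s))
  have dP := da_PP hA dW
  have dE := da_EE hA dW
  have df := da_ff hγ hp hA
  have dt := da_tau hγ hp
  have dmain : ∀ i, DifferentiableAt ℝ (vmain γ α A u χ i) p := by
    intro i
    unfold vmain
    exact ((dΘ.fun_mul ((dP i).fun_mul dG)).fun_add (((df i).fun_mul (dΘ.fun_mul dE)).const_mul _)).fun_add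
      (((df i).fun_mul (dt.fun_mul (dΘ.fun_mul (DifferentiableAt.fun_mul dκ (dw.fun_mul dw))))).const_mul _)
  have d1 : ∀ i, DifferentiableAt ℝ (ven γ α A u (3 - Q) χ i) p := fun i =>
    (da_rad hγ hp (hd_ze (3 - Q) (hχ s))).fun_mul (dw.fun_mul (dP i))
  have d2 : ∀ i, DifferentiableAt ℝ (ven γ α A u (2 - Q) η i) p := fun i =>
    (da_rad hγ hp (hd_ze (2 - Q) (hη s))).fun_mul (dw.fun_mul (dP i))
  have etot : ∑ i, Xd γ i (vtot γ α C lam M A u χ η i) p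
      = ∑ i, Xd γ i (vmain γ α A u χ i) p - 6 * C ^ 3 / lam * ∑ i, Xd γ i (ven γ α A u (3 - Q) χ i) p
        - 6 * C * M / lam * ∑ i, Xd γ i (ven γ α A u (2 - Q) η i) p := by
    rw [Finset.mul_sum, Finset.mul_sum, ← Finset.sum_sub_distrib, ← Finset.sum_sub_distrib]
    refine Finset.sum_congr rfl fun i _ => ?_
    unfold vtot
    rw [Xd_add i ((dmain i).fun_add ((d1 i).const_mul _)) ((d2 i).const_mul _),
      Xd_add i (dmain i) ((d1 i).const_mul _), Xd_const_mul _ i (d1 i), Xd_const_mul _ i (d2 i)]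
    ring
  rw [etot]
  have X0 : 0 < Real.exp ((2 - Q) * s) := Real.exp_pos _
  have hX1 : Real.exp ((3 - Q) / 2 * s) ^ 2 = Real.exp ((2 - Q) * s) * e ^ 2 := by
    rw [he, ← Real.exp_nat_mul, ← Real.exp_nat_mul, ← Real.exp_add]; congr 1; push_cast; ring
  have hX2 : Real.exp ((2 - Q) / 2 * s) ^ 2 = Real.exp ((2 - Q) * s) := by
    rw [← Real.exp_nat_mul]; congr 1; push_cast; ring
  have y0 : 0 ≤ tau γ p * wf γ α u p ^ 2 := by positivity
  have L0 : 0 ≤ 4 * C / lam := by positivity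
  refine scalar_tot (L := 4 * C / lam) hlam hC1 hQ (by linarith) he0 (by linarith) hM X0.le hS0 y0
    L0 he2 (hMη s) ?_ ?_ ?_
  · have hsm := scalar_main (θ := Th Q χ s) (b := 2 * (χ s * χd s) * Real.exp ((2 - Q) * s)) (w := wf γ α u p)
      (G := Gf γ α A u p) hC1 hQ hα he0 he1 (by unfold Th; positivity) hτ hsg hdiv hft hfs hEE0 hE1 hRR hAA
      (hGp ▸ hG) rfl eκ (hGp ▸ hLW) hg1 hg1' hg2 hpsi hK0 hK
    refine le_trans (le_of_eq main) (le_trans hsm (le_of_eq ?_))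
    unfold Th
    ring
  · have hse := scalar_energy (ζ := χ s * Real.exp ((3 - Q) / 2 * s)) (w := wf γ α u p)
      (ζd := (χd s + (3 - Q) / 2 * χ s) * Real.exp ((3 - Q) / 2 * s)) hlam hC1 hQ hα he0 he1 hτ hsg hdiv hft
      hE0 hG hLW hg1 hg1' hg2 hpsi hK0 hK
    refine le_trans (le_of_eq ?_) (le_trans hse (le_of_eq en1.symm))
    rw [mul_pow, mul_pow, hX1]
    ring
  · have hse := scalar_energy (ζ := η s * Real.exp ((2 - Q) / 2 * s)) (w := wf γ α u p)
      (ζd := (ηd s + (2 - Q) / 2 * η s) * Real.exp ((2 - Q) / 2 * s)) hlam hC1 hQ hα he0 he1 hτ hsg hdiv hft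
      hE0 hG hLW hg1 hg1' hg2 hpsi hK0 hK
    refine le_trans (le_of_eq ?_) (le_trans hse (le_of_eq en2.symm))
    rw [mul_pow, mul_pow, hX2]
end BG

namespace BG
variable {m k : ℕ}

instance volHaar : (volume : Measure (E m k)).IsAddHaarMeasure := by
  rw [Measure.volume_eq_prod]; infer_instance

/-- cutoff away from z = 0 -/
def ph (ε : ℝ) (p : E m k) : ℝ := Real.smoothTransition (‖p.1‖ ^ 2 / ε ^ 2 - 1)

lemma ph_cd (ε : ℝ) : ContDiff ℝ 1 (ph ε : E m k → ℝ) := by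
  unfold ph
  refine Real.smoothTransition.contDiff.comp ?_
  exact ((contDiff_fst.norm_sq ℝ).div_const _).sub contDiff_const

lemma ph_ev {ε : ℝ} (hε : 0 < ε) {p : E m k} (hp : p.1 = 0) : ph ε =ᶠ[nhds p] fun _ => (0:ℝ) := by
  have h : IsOpen {q : E m k | ‖q.1‖ ^ 2 < ε ^ 2} := isOpen_lt (by fun_prop) continuous_const
  filter_upwards [h.mem_nhds (show ‖p.1‖ ^ 2 < ε ^ 2 by rw [hp]; simp; positivity)] with q hq
  apply Real.smoothTransition.zero_of_nonpos
  have : ‖q.1‖ ^ 2 / ε ^ 2 ≤ 1 := (div_le_one (by positivity)).2 (le_of_lt hq)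
  linarith

lemma T_deriv : ∃ M : ℝ, 0 ≤ M ∧ (∀ s, |deriv Real.smoothTransition s| ≤ M) := by
  have hc : Continuous (deriv Real.smoothTransition) :=
    (Real.smoothTransition.contDiff (n := 1)).continuous_deriv le_rfl
  obtain ⟨M, hM⟩ := (isCompact_Icc (a := (0:ℝ)) (b := 1)).exists_bound_of_continuousOn hc.continuousOn
  refine ⟨max M 0, le_max_right _ _, fun s => ?_⟩
  rcases lt_or_ge s 0 with h | h
  · have : Real.smoothTransition =ᶠ[nhds s] fun _ => (0:ℝ) := by
      filter_upwards [Iio_mem_nhds h] with q hq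
      exact Real.smoothTransition.zero_of_nonpos (le_of_lt hq)
    rw [this.deriv_eq]; simp
  rcases lt_or_ge 1 s with h' | h'
  · have : Real.smoothTransition =ᶠ[nhds s] fun _ => (1:ℝ) := by
      filter_upwards [Ioi_mem_nhds h'] with q hq
      exact Real.smoothTransition.one_of_one_le (le_of_lt hq)
    rw [this.deriv_eq]; simp
  · exact (hM s ⟨h, h'⟩).trans (le_max_left _ _)

lemma T_deriv_zero {s : ℝ} (h : 1 < s) : deriv Real.smoothTransition s = 0 := by
  have : Real.smoothTransition =ᶠ[nhds s] fun _ => (1:ℝ) := by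
    filter_upwards [Ioi_mem_nhds h] with q hq
    exact Real.smoothTransition.one_of_one_le (le_of_lt hq)
  rw [this.deriv_eq]; simp

lemma Xd_ph (γ ε : ℝ) (i : Fin (m + k)) (p : E m k) :
    Xd γ i (ph ε) p = if (i : ℕ) < m then deriv Real.smoothTransition (‖p.1‖ ^ 2 / ε ^ 2 - 1) * (2 * co i p / ε ^ 2)
      else 0 := by
  have h1 : HasFDerivAt (fun q : E m k => ‖q.1‖ ^ 2)
      (2 • (innerSL ℝ p.1).comp (ContinuousLinearMap.fst ℝ _ _)) p := by
    have := (hasFDerivAt_fst (𝕜 := ℝ) (p := p)).norm_sq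
    exact this
  have h2 : HasFDerivAt (ph ε : E m k → ℝ) _ p :=
    ((Real.smoothTransition.contDiff (n := 1)).differentiable (by norm_num)
      (‖p.1‖ ^ 2 / ε ^ 2 - 1)).hasDerivAt.comp_hasFDerivAt p ((h1.mul_const ((ε ^ 2)⁻¹)).sub_const 1)
  rw [Xd_eq, h2.fderiv]
  refine Fin.addCases (fun i => ?_) (fun i => ?_) i
  · simp [om, ev, co, EuclideanSpace.inner_single_right]
    left; ring
  · simp [om, ev, co]

lemma int_Xd_zero {γ : ℝ} (hγ : 0 < γ) (i : Fin (m + k)) {f : E m k → ℝ} (hf : ContDiff ℝ 1 f)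
    (hc : HasCompactSupport f) : Integrable (Xd γ i f) ∧ ∫ p, Xd γ i f p = 0 := by
  have hom : Continuous (om γ i : E m k → ℝ) := by
    unfold om; split_ifs
    · exact continuous_const
    · exact (continuous_fst.norm).rpow_const fun _ => Or.inr hγ.le
  have hXc : Continuous (Xd γ i f) := by
    have : Xd γ i f = fun p => om γ i p * fderiv ℝ f p (ev i) := funext fun p => Xd_eq γ i f p
    rw [this]
    exact hom.mul ((hf.continuous_fderiv (by norm_num)).clm_apply continuous_const)
  have hXs : HasCompactSupport (Xd γ i f) := by
    have h1 : HasCompactSupport (fderiv ℝ f) := hc.fderiv ℝ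
    refine h1.mono fun p hp hp' => hp ?_
    rw [Xd_eq, hp']; simp
  refine ⟨hXc.integrable_of_hasCompactSupport hXs, ?_⟩
  obtain ⟨M, hM⟩ := hXc.bounded_above_of_compact_support hXs
  have hfc : Continuous (fun p => om γ i p * f p) := hom.mul hf.continuous
  have homs : ∀ (x : E m k) (s : ℝ), om γ i (x + s • ev i) = om γ i x := by
    intro x s
    refine Fin.addCases (fun i => ?_) (fun i => ?_) i <;> simp [om, ev]
  refine ibp_line volume (fun p => om γ i p * f p) (Xd γ i f) (ev i) M
    (hfc.integrable_of_hasCompactSupport hc.mul_left) hXc.measurable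
    (hXc.integrable_of_hasCompactSupport hXs) hM (Eventually.of_forall fun x => ⟨?_, ∅, by simp, fun s _ => ?_⟩)
  · exact hfc.comp (by fun_prop)
  · simp only [homs, Xd_eq]
    apply HasDerivAt.const_mul
    have h1 : HasDerivAt (fun s : ℝ => x + s • (ev i : E m k)) (ev i) s := by
      simpa using ((hasDerivAt_id s).smul_const (ev i : E m k)).const_add x
    exact ((hf.differentiable (by norm_num) _).hasFDerivAt.comp_hasDerivAt s h1)

def refl (p : E m k) : E m k := (-p.1, p.2)

lemma int_refl (f : E m k → ℝ) : ∫ p, f (refl p) = ∫ p, f p := by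
  have h1 : MeasurePreserving (fun z : EuclideanSpace ℝ (Fin m) => -z) volume volume :=
    Measure.measurePreserving_neg _
  have h2 : MeasurePreserving (refl : E m k → E m k) volume volume := by
    rw [Measure.volume_eq_prod]
    exact h1.prod (MeasurePreserving.id _)
  have h3 : MeasurableEmbedding (refl : E m k → E m k) := by
    have : (refl : E m k → E m k) = ((Homeomorph.neg _).prodCongr (Homeomorph.refl _)) := by
      funext p; rfl
    rw [this]
    exact (Homeomorph.measurableEmbedding _)
  exact h2.integral_comp h3 f

lemma cut_small (hm : 1 ≤ m) {v : E m k → ℝ} (hv : Continuous v) (hvc : HasCompactSupport v) (γ : ℝ)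
    (i : Fin (m + k)) : ∀ κ > 0, ∃ δ > 0, ∀ ε, 0 < ε → ε < δ → |∫ p, v p * Xd γ i (ph ε) p| ≤ κ := by
  intro κ hκ
  by_cases him : (i : ℕ) < m
  swap
  · refine ⟨1, one_pos, fun ε _ _ => ?_⟩
    simp [Xd_ph, him, hκ.le]
  obtain ⟨M, hM0, hM⟩ := T_deriv
  obtain ⟨R, hR⟩ := hvc.isCompact.isBounded.subset_closedBall 0
  have hR0 : ∀ p : E m k, R < ‖p.2‖ → v p = 0 := by
    intro p hp
    by_contra h
    have h1 := hR (subset_closure h)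
    rw [mem_closedBall_zero_iff] at h1
    have := norm_snd_le p
    linarith
  set c : ℝ := (volume (Metric.ball (0 : EuclideanSpace ℝ (Fin m)) 1)).toReal
    * (volume (Metric.closedBall (0 : EuclideanSpace ℝ (Fin k)) R)).toReal with hc
  have hc0 : 0 ≤ c := by positivity
  set D : ℝ := 4 * M * 2 ^ m * c + 1 with hD
  have hD0 : 0 < D := by positivity
  have huc := hvc.uniformContinuous_of_continuous hv
  rw [Metric.uniformContinuous_iff] at huc
  obtain ⟨δ, hδ, hδ'⟩ := huc (κ / D) (by positivity)
  refine ⟨min (δ / 8) 1, by positivity, fun ε hε hεδ => ?_⟩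
  have hε1 : ε < 1 := hεδ.trans_le (min_le_right _ _)
  have hε2 : ε < δ / 8 := hεδ.trans_le (min_le_left _ _)
  set h : E m k → ℝ := Xd γ i (ph ε) with hh
  have hhe : ∀ p, h p = deriv Real.smoothTransition (‖p.1‖ ^ 2 / ε ^ 2 - 1) * (2 * co i p / ε ^ 2) := by
    intro p; rw [hh, Xd_ph, if_pos him]
  have hco : ∀ p : E m k, |co i p| ≤ ‖p.1‖ := by
    intro p
    unfold co
    rw [dif_pos him]
    exact PiLp.norm_apply_le p.1 _
  have hodd : ∀ p : E m k, h (refl p) = - h p := by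
    intro p
    rw [hhe, hhe]
    have : co i (refl p) = - co i p := by
      unfold co refl; rw [dif_pos him]; simp
    rw [this]; simp [refl]; ring
  have hsupp : ∀ p : E m k, 2 * ε < ‖p.1‖ → h p = 0 := by
    intro p hp
    rw [hhe, T_deriv_zero, zero_mul]
    have : 2 < ‖p.1‖ ^ 2 / ε ^ 2 := by
      rw [lt_div_iff₀ (by positivity)]
      nlinarith
    linarith
  have hhc : Continuous h := by
    have : h = fun p => fderiv ℝ (ph ε) p (ev i) := by
      funext p; rw [hh, Xd_eq]; simp [om, him]
    rw [this]
    exact ((ph_cd ε).continuous_fderiv (by norm_num)).clm_apply continuous_const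
  have hrc : Continuous (refl : E m k → E m k) := by unfold refl; fun_prop
  have i1 : Integrable fun p => v p * h p :=
    (hv.mul hhc).integrable_of_hasCompactSupport hvc.mul_right
  have hvr : HasCompactSupport fun p => v (refl p) := by
    refine hvc.comp_homeomorph ((Homeomorph.neg _).prodCongr (Homeomorph.refl _))
  have i2 : Integrable fun p => v (refl p) * h p :=
    ((hv.comp hrc).mul hhc).integrable_of_hasCompactSupport hvr.mul_right
  have e1 : ∫ p, v p * h p = - ∫ p, v (refl p) * h p := by
    rw [← int_refl, ← integral_neg]
    congr 1; funext p; rw [hodd]; ring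
  have e2 : ∫ p, v p * h p = (1 / 2) * ∫ p, (v p - v (refl p)) * h p := by
    have : ∫ p, (v p - v (refl p)) * h p = (∫ p, v p * h p) - ∫ p, v (refl p) * h p := by
      rw [← integral_sub i1 i2]; congr 1; funext p; ring
    rw [this]; linarith
  set S : Set (E m k) := Metric.closedBall 0 (2 * ε) ×ˢ Metric.closedBall 0 R with hS
  have hSv : volume S = ENNReal.ofReal ((2 * ε) ^ m) * volume (Metric.ball (0 : EuclideanSpace ℝ (Fin m)) 1)
      * volume (Metric.closedBall (0 : EuclideanSpace ℝ (Fin k)) R) := by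
    rw [hS, Measure.volume_eq_prod, Measure.prod_prod, Measure.addHaar_closedBall _ _ (by positivity)]
    simp
  have hSr : (volume S).toReal = (2 * ε) ^ m * c := by
    rw [hSv, ENNReal.toReal_mul, ENNReal.toReal_mul, ENNReal.toReal_ofReal (by positivity), hc]; ring
  have hSfin : volume S < ⊤ := by
    rw [hSv]
    exact ENNReal.mul_lt_top (ENNReal.mul_lt_top ENNReal.ofReal_lt_top measure_ball_lt_top) measure_closedBall_lt_top
  have hzero : ∀ p ∉ S, (v p - v (refl p)) * h p = 0 := by
    intro p hp
    by_cases h1 : 2 * ε < ‖p.1‖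
    · rw [hsupp p h1, mul_zero]
    · have h2 : R < ‖p.2‖ := by
        by_contra h2
        exact hp ⟨by simpa using not_lt.1 h1, by simpa using not_lt.1 h2⟩
      rw [hR0 p h2, hR0 (refl p) h2]; simp
  have hbd : ∀ p ∈ S, ‖(v p - v (refl p)) * h p‖ ≤ κ / D * (M * (4 / ε)) := by
    intro p hp
    have hp1 : ‖p.1‖ ≤ 2 * ε := by simpa using hp.1
    rw [norm_mul]
    have h1 : ‖v p - v (refl p)‖ ≤ κ / D := by
      rw [← dist_eq_norm]
      refine (hδ' ?_).le
      rw [dist_eq_norm]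
      have : p - refl p = ((2:ℝ) • p.1, 0) := by
        unfold refl; ext <;> simp; ring
      rw [this, Prod.norm_def]
      simp [norm_smul]
      linarith
    have h2 : ‖h p‖ ≤ M * (4 / ε) := by
      rw [hhe, norm_mul]
      refine mul_le_mul (hM _) ?_ (norm_nonneg _) hM0
      rw [norm_div, norm_mul, Real.norm_eq_abs, Real.norm_eq_abs, Real.norm_eq_abs]
      rw [abs_of_pos (by positivity : (0:ℝ) < ε ^ 2), abs_two]
      rw [div_le_div_iff₀ (by positivity) hε]
      have := (hco p).trans hp1
      nlinarith
    gcongr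
  have hfin : ‖∫ p, (v p - v (refl p)) * h p‖ ≤ κ / D * (M * (4 / ε)) * (volume S).toReal := by
    rw [← setIntegral_eq_integral_of_forall_compl_eq_zero hzero]
    exact norm_setIntegral_le_of_norm_le_const hSfin hbd
  rw [e2, abs_mul]
  rw [Real.norm_eq_abs, hSr] at hfin
  have hεm : ε ^ m ≤ ε := by
    calc ε ^ m ≤ ε ^ 1 := pow_le_pow_of_le_one hε.le hε1.le hm
      _ = ε := pow_one _
  have h4 : κ / D * (M * (4 / ε)) * ((2 * ε) ^ m * c) ≤ κ := by
    calc κ / D * (M * (4 / ε)) * ((2 * ε) ^ m * c) = κ / D * (4 * M * 2 ^ m * c) * (ε ^ m / ε) := by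
          rw [mul_pow]; ring
      _ ≤ κ / D * (4 * M * 2 ^ m * c) * 1 := by
          gcongr; exact (div_le_one hε).2 hεm
      _ ≤ κ / D * D := by rw [mul_one]; gcongr; linarith
      _ = κ := by field_simp
  have : |(1 / 2 : ℝ)| = 1 / 2 := by norm_num
  rw [this]
  have := abs_nonneg (∫ p, (v p - v (refl p)) * h p)
  linarith

lemma ae_z (hm : 1 ≤ m) : ∀ᵐ p : E m k, p.1 ≠ 0 := by
  have : volume {p : E m k | p.1 = 0} = 0 := by
    have e : {p : E m k | p.1 = 0} = {0} ×ˢ univ := by ext p; simp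
    have : Nonempty (Fin m) := ⟨⟨0, hm⟩⟩
    rw [e, Measure.volume_eq_prod, Measure.prod_prod]
    simp
  rw [ae_iff]; simpa using this

lemma div_ineq (hm : 1 ≤ m) {γ : ℝ} (hγ : 0 < γ) {v : Fin (m + k) → E m k → ℝ} {F : E m k → ℝ}
    (hv : ∀ i, ∀ p : E m k, p.1 ≠ 0 → ContDiffAt ℝ 1 (v i) p) (hvs : ∀ i, HasCompactSupport (v i))
    (hvc : ∀ i : Fin (m + k), (i : ℕ) < m → Continuous (v i)) (hF : Integrable F)
    (hle : ∀ p : E m k, p.1 ≠ 0 → ∑ i, Xd γ i (v i) p ≤ F p) : 0 ≤ ∫ p, F p := by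
  -- key inequality with cutoff
  have hpm : ∀ ε, AEStronglyMeasurable (fun p : E m k => ph ε p * F p) := fun ε =>
    (ph_cd ε).continuous.aestronglyMeasurable.mul hF.aestronglyMeasurable
  have hpb : ∀ ε, ∀ p : E m k, ‖ph ε p‖ ≤ 1 := by
    intro ε p
    unfold ph
    rw [Real.norm_eq_abs, abs_of_nonneg (Real.smoothTransition.nonneg _)]
    exact Real.smoothTransition.le_one _
  have key : ∀ ε > 0, 0 ≤ (∫ p, ph ε p * F p) + ∑ i, ∫ p, v i p * Xd γ i (ph ε) p := by
    intro ε hε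
    have hcd : ∀ i, ContDiff ℝ 1 (fun p => ph ε p * v i p) := by
      intro i
      rw [contDiff_iff_contDiffAt]
      intro p
      by_cases hp : p.1 = 0
      · refine (contDiffAt_const (c := (0:ℝ))).congr_of_eventuallyEq ?_
        filter_upwards [ph_ev hε hp] with q hq
        rw [hq, zero_mul]
      · exact (ph_cd ε).contDiffAt.mul (hv i p hp)
    have hcs : ∀ i, HasCompactSupport (fun p => ph ε p * v i p) := fun i => (hvs i).mul_left
    have h0 := fun i => int_Xd_zero hγ i (hcd i) (hcs i)
    have hiv : ∀ i, Integrable (fun p => v i p * Xd γ i (ph ε) p) := by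
      intro i
      by_cases him : (i : ℕ) < m
      · have : Continuous (Xd γ i (ph ε) : E m k → ℝ) := by
          have : (Xd γ i (ph ε) : E m k → ℝ) = fun p => fderiv ℝ (ph ε) p (ev i) := by
            funext p; rw [Xd_eq]; simp [om, him]
          rw [this]
          exact ((ph_cd ε).continuous_fderiv (by norm_num)).clm_apply continuous_const
        exact ((hvc i him).mul this).integrable_of_hasCompactSupport (hvs i).mul_right
      · simp [Xd_ph, him]
    have hiF : Integrable (fun p => ph ε p * F p) := by
      refine hF.bdd_mul (c := 1) (ph_cd ε).continuous.aestronglyMeasurable (Eventually.of_forall (hpb ε))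
    rw [← integral_finsetSum _ fun i _ => hiv i, ← integral_add hiF (integrable_finsetSum _ fun i _ => hiv i)]
    have e : (0:ℝ) = ∫ p, ∑ i, Xd γ i (fun p => ph ε p * v i p) p := by
      rw [integral_finsetSum _ fun i _ => (h0 i).1]
      simp [(h0 _).2]
    rw [e]
    refine integral_mono_ae (integrable_finsetSum _ fun i _ => (h0 i).1)
      (hiF.add (integrable_finsetSum _ fun i _ => hiv i)) ?_
    filter_upwards [ae_z hm] with p hp
    have : ∀ i, Xd γ i (fun p => ph ε p * v i p) p = ph ε p * Xd γ i (v i) p + v i p * Xd γ i (ph ε) p := fun i =>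
      Xd_mul i ((ph_cd ε).differentiable (by norm_num) p) ((hv i p hp).differentiableAt (by norm_num))
    simp only [this, Finset.sum_add_distrib, ← Finset.mul_sum]
    have h2 : 0 ≤ ph ε p := Real.smoothTransition.nonneg _
    have := hle p hp
    gcongr
  have hlim : Tendsto (fun n : ℕ => ∫ p, ph (1 / ((n:ℝ) + 1)) p * F p) atTop (nhds (∫ p, F p)) := by
    refine tendsto_integral_of_dominated_convergence (fun p => ‖F p‖) (fun n => hpm _) hF.norm
      (fun n => Eventually.of_forall fun p => ?_) ?_
    · rw [norm_mul]
      have := hpb (1 / ((n:ℝ) + 1)) p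
      have h2 := norm_nonneg (F p)
      nlinarith
    · filter_upwards [ae_z hm] with p hp
      have hpp := norm_pos_iff.2 hp
      refine tendsto_const_nhds.congr' ?_
      have ht := tendsto_one_div_add_atTop_nhds_zero_nat (𝕜 := ℝ)
      filter_upwards [ht.eventually (gt_mem_nhds (show 0 < ‖p.1‖ / 2 by positivity))] with n hn
      have hn0 : (0:ℝ) < 1 / ((n:ℝ) + 1) := by positivity
      unfold ph
      rw [Real.smoothTransition.one_of_one_le, one_mul]
      have : 2 ≤ ‖p.1‖ ^ 2 / (1 / ((n:ℝ) + 1)) ^ 2 := by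
        rw [le_div_iff₀ (by positivity)]
        nlinarith
      linarith
  refine le_of_forall_pos_le_add fun κ hκ => ?_
  have hN : (0:ℝ) < ((m + k : ℕ) : ℝ) := by
    have : 0 < m + k := by omega
    exact_mod_cast this
  have hsm : ∀ i, ∀ᶠ n : ℕ in atTop,
      |∫ p, v i p * Xd γ i (ph (1 / ((n:ℝ) + 1))) p| ≤ κ / 2 / ((m + k : ℕ) : ℝ) := by
    intro i
    by_cases him : (i : ℕ) < m
    · obtain ⟨δ, hδ, h⟩ := cut_small hm (hvc i him) (hvs i) γ i (κ / 2 / ((m + k : ℕ) : ℝ)) (by positivity)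
      have ht := tendsto_one_div_add_atTop_nhds_zero_nat (𝕜 := ℝ)
      filter_upwards [ht.eventually (gt_mem_nhds hδ)] with n hn
      exact h _ (by positivity) hn
    · refine Eventually.of_forall fun n => ?_
      simp [Xd_ph, him]; positivity
  have hcl : ∀ᶠ n : ℕ in atTop, ∫ p, ph (1 / ((n:ℝ) + 1)) p * F p ≤ (∫ p, F p) + κ / 2 :=
    hlim.eventually_le_const (by linarith)
  obtain ⟨n, h1, h2⟩ := ((eventually_all.2 hsm).and hcl).exists
  have h3 := key (1 / ((n:ℝ) + 1)) (by positivity)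
  have h4 := sum_bd _ _ h1
  have h5 : ((m + k : ℕ) : ℝ) * (κ / 2 / ((m + k : ℕ) : ℝ)) = κ / 2 := by field_simp
  have := le_abs_self (∑ i, ∫ p, v i p * Xd γ i (ph (1 / ((n:ℝ) + 1))) p)
  linarith
end BG

namespace BG
variable {m k : ℕ}

section
variable {γ : ℝ} (hγ : 0 < γ)
include hγ

lemma hh_nonneg (p : E m k) : 0 ≤ hh γ p := by unfold hh; positivity

lemma ct_hh : Continuous (hh γ : E m k → ℝ) := by
  unfold hh
  exact (continuous_fst.norm.rpow_const fun _ => Or.inr (by positivity)).add (by fun_prop)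

lemma ct_rho : Continuous (rho γ : E m k → ℝ) := by
  have h : (rho γ : E m k → ℝ) = fun p => hh γ p ^ (1 / (2 * (γ + 1))) := rfl
  rw [h]
  exact (ct_hh hγ).rpow_const fun _ => Or.inr (by positivity)

lemma isOpen_ball (r : ℝ) : IsOpen (ball (m := m) (k := k) γ r) := isOpen_lt (ct_rho hγ) continuous_const

lemma ca_sl {p : E m k} (hp : 0 < rho γ p) : ContinuousAt (sl γ) p :=
  (ct_rho hγ).continuousAt.log hp.ne'

lemma hh_pos' {p : E m k} (hp : 0 < rho γ p) : 0 < hh γ p := by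
  rw [← rho_pow hγ p]; positivity

lemma ca_tau {p : E m k} (hp : 0 < rho γ p) : ContinuousAt (tau γ) p := by
  unfold tau
  exact (continuous_fst.norm.rpow_const fun _ => Or.inr (by positivity)).continuousAt.div
    (ct_hh hγ).continuousAt (hh_pos' hγ hp).ne'

lemma ct_om (i : Fin (m + k)) : Continuous (om γ i : E m k → ℝ) := by
  unfold om; split_ifs
  · exact continuous_const
  · exact (continuous_fst.norm).rpow_const fun _ => Or.inr hγ.le

lemma ca_tauy {p : E m k} (hp : 0 < rho γ p) (j : Fin (m + k)) :
    ContinuousAt (fun q => tau γ q * yy γ j q) p := by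
  by_cases hj : (j : ℕ) < m
  · have : (yy γ j : E m k → ℝ) = fun q => (1 + gam γ j) * co j q := by
      funext q; simp [yy, om, hj]
    rw [this]
    exact (ca_tau hγ hp).mul (by fun_prop)
  · have : (fun q : E m k => tau γ q * yy γ j q) = fun q => om γ j q * ((1 + gam γ j) * co j q) / hh γ q := by
      funext q
      have e1 : om γ j q = ‖q.1‖ ^ γ := by simp [om, hj]
      have e2 : ‖q.1‖ ^ (2 * γ) = om γ j q * om γ j q := by
        rw [e1, two_mul, Real.rpow_add_of_nonneg (norm_nonneg _) hγ.le hγ.le]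
      unfold tau yy
      rw [e2]
      by_cases h0 : om γ j q = 0
      · rw [h0]; simp
      · field_simp
    rw [this]
    exact ((ct_om hγ j).continuousAt.mul (by fun_prop)).div (ct_hh hγ).continuousAt (hh_pos' hγ hp).ne'

lemma yy_zero {p : E m k} (hp : p.1 = 0) (j : Fin (m + k)) : yy γ j p = 0 := by
  refine Fin.addCases (fun i => ?_) (fun i => ?_) j
  · simp [yy, hp]
  · simp [yy, om, hp, Real.zero_rpow hγ.ne']

lemma bdd_rho (b : ℝ) : Bornology.IsBounded {q : E m k | rho γ q ≤ Real.exp b} := by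
  rw [isBounded_iff_forall_norm_le]
  refine ⟨max (Real.exp b) (1 + Real.exp b ^ (2 * (γ + 1))), fun q hq => ?_⟩
  have h1 := (N_le_rho hγ q).trans hq
  have h2 : hh γ q ≤ Real.exp b ^ (2 * (γ + 1)) := by
    rw [← rho_pow hγ q]
    exact Real.rpow_le_rpow (rho_nonneg hγ q) hq (by positivity)
  have h3 : ‖q.2‖ ^ 2 ≤ hh γ q := by
    unfold hh
    have : 0 ≤ ‖q.1‖ ^ (2 * (γ + 1)) := by positivity
    have h9 : 1 * ‖q.2‖ ^ 2 ≤ (γ + 1) ^ 2 * ‖q.2‖ ^ 2 := by gcongr; nlinarith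
    linarith
  have h4 : ‖q.2‖ ≤ 1 + ‖q.2‖ ^ 2 := by nlinarith [sq_nonneg (‖q.2‖ - 1)]
  rw [Prod.norm_def]
  exact max_le_max h1 (by linarith)

lemma cpt (a b : ℝ) : IsCompact {q : E m k | Real.exp a ≤ rho γ q ∧ rho γ q ≤ Real.exp b} := by
  refine Metric.isCompact_of_isClosed_isBounded ?_ ((bdd_rho hγ b).subset fun q hq => hq.2)
  exact (isClosed_le continuous_const (ct_rho hγ)).inter (isClosed_le (ct_rho hγ) continuous_const)

lemma vol_ball : volume (ball (m := m) (k := k) γ 1) < ⊤ := by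
  refine ((bdd_rho hγ 0).subset fun q hq => ?_).measure_lt_top
  simpa using le_of_lt hq

lemma rho_of_sl {a b : ℝ} (hb : b < 0) {q : E m k} (h : sl γ q ∈ Icc a b) :
    Real.exp a ≤ rho γ q ∧ rho γ q ≤ Real.exp b := by
  have h0 : rho γ q ≠ 0 := by
    intro h0
    have := h.2
    unfold sl at this
    rw [h0, Real.log_zero] at this
    linarith
  have h1 : 0 < rho γ q := lt_of_le_of_ne (rho_nonneg hγ q) (Ne.symm h0)
  rw [← Real.exp_log h1]
  exact ⟨Real.exp_le_exp.2 h.1, Real.exp_le_exp.2 h.2⟩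

lemma loc_zero {a b : ℝ} (hb : b < 0) {f : E m k → ℝ} (hf : ∀ q, sl γ q ∉ Icc a b → f q = 0) {p : E m k}
    (hp : ¬ (0 < rho γ p ∧ rho γ p < 1)) : f =ᶠ[nhds p] fun _ => 0 := by
  have hcl : IsOpen {q : E m k | Real.exp a ≤ rho γ q ∧ rho γ q ≤ Real.exp b}ᶜ :=
    (cpt hγ a b).isClosed.isOpen_compl
  refine Filter.eventually_of_mem (hcl.mem_nhds ?_) fun q hq => hf q fun h => hq (rho_of_sl hγ hb h)
  intro h
  exact hp ⟨(Real.exp_pos a).trans_le h.1, h.2.trans_lt (by simpa using hb)⟩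

lemma supp_cpt {a b : ℝ} (hb : b < 0) {f : E m k → ℝ} (hf : ∀ q, sl γ q ∉ Icc a b → f q = 0) :
    HasCompactSupport f :=
  HasCompactSupport.intro (cpt hγ a b) fun q hq => hf q fun h => hq (rho_of_sl hγ hb h)

lemma cont_of {a b : ℝ} (hb : b < 0) {f : E m k → ℝ} (hf : ∀ q, sl γ q ∉ Icc a b → f q = 0)
    (hc : ∀ p, 0 < rho γ p → rho γ p < 1 → ContinuousAt f p) : Continuous f := by
  rw [continuous_iff_continuousAt]
  intro p
  by_cases hp : 0 < rho γ p ∧ rho γ p < 1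
  · exact hc p hp.1 hp.2
  · exact continuousAt_const.congr (loc_zero hγ hb hf hp).symm

variable {Λ lam α : ℝ} (hΛ : 0 < Λ) {A : E m k → Matrix (Fin (m + k)) (Fin (m + k)) ℝ} (hA : C1coeff A)
  (hH : HypH γ Λ A) {u : E m k → ℝ} (hu : ContDiffOn ℝ 2 u (ball γ 1)) {p : E m k}

include hu in
lemma u_at (hp1 : rho γ p < 1) : ContDiffAt ℝ 2 u p := hu.contDiffAt ((isOpen_ball hγ 1).mem_nhds hp1)

include hΛ hA hH in
lemma ca_cc (hp1 : rho γ p < 1) (j : Fin (m + k)) : ContinuousAt (cc γ A j) p := by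
  by_cases hp : p.1 = 0
  · have h0 : ∀ q : E m k, q.1 = 0 → cc γ A j q = 0 := by
      intro q hq; unfold cc; simp [yy_zero hγ hq]
    have hb : ∀ᶠ q in nhds p, ‖cc γ A j q‖ ≤ CG m k γ Λ * rho γ q * ‖q.1‖ := by
      filter_upwards [(isOpen_ball hγ 1).mem_nhds hp1] with q hq
      by_cases hq0 : q.1 = 0
      · rw [h0 q hq0, hq0]; simp
      · exact (GB_of_PB hγ hΛ hq0 hA (PB_of_H hγ hΛ hH hq0 hq) hq).c j
    rw [ContinuousAt, h0 p hp]
    refine squeeze_zero_norm' hb ?_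
    have : Continuous (fun q : E m k => CG m k γ Λ * rho γ q * ‖q.1‖) := by
      have := ct_rho (m := m) (k := k) hγ
      fun_prop
    have := this.tendsto p
    simpa [hp] using this
  · exact (da_cc hγ hp hA j).continuousAt

include hu in
lemma ca_Xd (hp1 : rho γ p < 1) (j : Fin (m + k)) : ContinuousAt (Xd γ j u) p := by
  rw [Xd_fun_eq]
  refine (ct_om hγ j).continuousAt.mul ?_
  exact ((u_at hγ hu hp1).fderiv_right (m := 1) (by norm_num)).continuousAt.clm_apply continuousAt_const

include hu in
lemma ca_Zd (hp1 : rho γ p < 1) : ContinuousAt (Zd γ u) p := by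
  unfold Zd
  exact ((u_at hγ hu hp1).fderiv_right (m := 1) (by norm_num)).continuousAt.clm_apply
    (by fun_prop)

lemma ca_E (hp0 : 0 < rho γ p) : ContinuousAt (fun q => Real.exp (-gf α (sl γ q))) p :=
  (((cd_gf α (n := 1)).continuous.continuousAt.comp (ca_sl hγ hp0)).neg).rexp

lemma ca_g1 (hp0 : 0 < rho γ p) : ContinuousAt (fun q => g1f α (sl γ q)) p :=
  (cd_g1f α (n := 1)).continuous.continuousAt.comp (ca_sl hγ hp0)

include hu in
lemma ca_wf (hp0 : 0 < rho γ p) (hp1 : rho γ p < 1) : ContinuousAt (wf γ α u) p :=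
  (ca_E hγ hp0).mul (u_at hγ hu hp1).continuousAt

include hu in
lemma ca_Wf (hp0 : 0 < rho γ p) (hp1 : rho γ p < 1) (j : Fin (m + k)) : ContinuousAt (Wf γ α u j) p :=
  (ca_E hγ hp0).mul ((ca_Xd hγ hu hp1 j).sub
    (((ca_g1 hγ hp0).mul (ca_tauy hγ hp0 j)).mul (u_at hγ hu hp1).continuousAt))

include hΛ hA hH hu in
lemma ca_Gf (hp0 : 0 < rho γ p) (hp1 : rho γ p < 1) : ContinuousAt (Gf γ α A u) p :=
  ((ca_E hγ hp0).mul ((ca_Zd hγ hu hp1).sub ((ca_g1 hγ hp0).mul (u_at hγ hu hp1).continuousAt))).add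
    (tendsto_finsetSum _ fun j _ => (ca_cc hγ hΛ hA hH hp1 j).mul (ca_Wf hγ hu hp0 hp1 j))

include hΛ hA hH in
lemma ca_sg (hp0 : 0 < rho γ p) (hp1 : rho γ p < 1) : ContinuousAt (sg γ A) p := by
  have : sg γ A = fun q => 1 + ∑ j, cc γ A j q * (tau γ q * yy γ j q) := by
    funext q; unfold sg; rw [Finset.mul_sum]
    congr 1; refine Finset.sum_congr rfl fun j _ => ?_; ring
  rw [this]
  exact continuousAt_const.add
    (tendsto_finsetSum _ fun j _ => (ca_cc hγ hΛ hA hH hp1 j).mul (ca_tauy hγ hp0 j))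

include hΛ hA hH in
lemma ca_kap (hp0 : 0 < rho γ p) (hp1 : rho γ p < 1) : ContinuousAt (kap γ α A) p :=
  (((ca_g1 hγ hp0).pow 2).mul (ca_sg hγ hΛ hA hH hp0 hp1)).add (continuousAt_const.mul (ca_g1 hγ hp0))

include hA hu in
lemma ca_PP (hp0 : 0 < rho γ p) (hp1 : rho γ p < 1) (i : Fin (m + k)) : ContinuousAt (PP A (Wf γ α u) i) p :=
  tendsto_finsetSum _ fun j _ => (hA i j).continuous.continuousAt.mul (ca_Wf hγ hu hp0 hp1 j)

include hA hu in
lemma ca_EE (hp0 : 0 < rho γ p) (hp1 : rho γ p < 1) : ContinuousAt (EE A (Wf γ α u)) p :=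
  tendsto_finsetSum _ fun i _ => (ca_PP hγ hA hu hp0 hp1 i).mul (ca_Wf hγ hu hp0 hp1 i)

include hΛ hA hH in
lemma ca_ff (hp1 : rho γ p < 1) {i : Fin (m + k)} (hi : (i : ℕ) < m) : ContinuousAt (ff γ A i) p := by
  have : (yy γ i : E m k → ℝ) = fun q => (1 + gam γ i) * co i q := by
    funext q; simp [yy, om, hi]
  have h2 : ContinuousAt (yy γ i) p := by rw [this]; fun_prop
  exact h2.add (ca_cc hγ hΛ hA hH hp1 i)

lemma Th_cd {Q : ℝ} {χ : ℝ → ℝ} (hχ : ContDiff ℝ 1 χ) : ContDiff ℝ 1 (Th Q χ) := by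
  unfold Th; fun_prop
lemma ze_cd {Q : ℝ} {χ : ℝ → ℝ} (hχ : ContDiff ℝ 1 χ) : ContDiff ℝ 1 (ze Q χ) := by
  unfold ze; fun_prop

variable {C M : ℝ} {χ η : ℝ → ℝ} (hχ : ContDiff ℝ 1 χ) (hη : ContDiff ℝ 1 η)

include hΛ hA hH hu hχ hη in
lemma ca_vtot (hp0 : 0 < rho γ p) (hp1 : rho γ p < 1) {i : Fin (m + k)} (hi : (i : ℕ) < m) :
    ContinuousAt (vtot γ α C lam M A u χ η i) p := by
  have hs := ca_sl hγ hp0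
  have t1 := (Th_cd hγ (Q := QQ m k γ) hχ).continuous.continuousAt.comp hs
  have t2 := (ze_cd hγ (Q := 3 - QQ m k γ) hχ).continuous.continuousAt.comp hs
  have t3 := (ze_cd hγ (Q := 2 - QQ m k γ) hη).continuous.continuousAt.comp hs
  have p1 := ca_PP (α := α) hγ hA hu hp0 hp1 i
  have f1 := ca_ff hγ hΛ hA hH hp1 hi
  have w1 := ca_wf (α := α) hγ hu hp0 hp1
  have g1 := ca_Gf (α := α) hγ hΛ hA hH hu hp0 hp1
  have e1 := ca_EE (α := α) hγ hA hu hp0 hp1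
  have k1 := ca_kap (α := α) hγ hΛ hA hH hp0 hp1
  have ta := ca_tau hγ hp0
  unfold vtot vmain ven
  exact ((((t1.mul (p1.mul g1)).add (continuousAt_const.mul (f1.mul (t1.mul e1)))).add
    (continuousAt_const.mul (f1.mul (ta.mul (t1.mul (k1.mul (w1.mul w1))))))).add
    (continuousAt_const.mul (t2.mul (w1.mul p1)))).add (continuousAt_const.mul (t3.mul (w1.mul p1)))

include hA hu hχ hη in
lemma cd_vtot (hp : p.1 ≠ 0) (hp1 : rho γ p < 1) (i : Fin (m + k)) :
    ContDiffAt ℝ 1 (vtot γ α C lam M A u χ η i) p := by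
  have hu2 := u_at hγ hu hp1
  have hs : ContDiffAt ℝ 1 (sl γ) p := cd_sl hγ hp
  have t1 := (Th_cd hγ (Q := QQ m k γ) hχ).contDiffAt.comp p hs
  have t2 := (ze_cd hγ (Q := 3 - QQ m k γ) hχ).contDiffAt.comp p hs
  have t3 := (ze_cd hγ (Q := 2 - QQ m k γ) hη).contDiffAt.comp p hs
  have W1 := fun j => cd_Wf (α := α) hγ hp hu2 j
  have y1 : ∀ j, ContDiffAt ℝ 1 (yy γ j) p := fun j => cd_y hγ hp j
  have a1 : ∀ i j, ContDiffAt ℝ 1 (fun q => A q i j) p := fun i j => (hA i j).contDiffAt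
  have c1 : ∀ j, ContDiffAt ℝ 1 (cc γ A j) p := fun j =>
    ContDiffAt.sum fun i _ => ((a1 i j).sub contDiffAt_const).mul (y1 i)
  have f1 : ∀ j, ContDiffAt ℝ 1 (ff γ A j) p := fun j => (y1 j).add (c1 j)
  have ta : ContDiffAt ℝ 1 (tau γ) p := cd_tau hγ hp
  have s1 : ContDiffAt ℝ 1 (sg γ A) p :=
    contDiffAt_const.add (ta.mul (ContDiffAt.sum fun j _ => (c1 j).mul (y1 j)))
  have gg : ContDiffAt ℝ 1 (fun q => g1f α (sl γ q)) p := (cd_g1f α).contDiffAt.comp p hs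
  have k1 : ContDiffAt ℝ 1 (kap γ α A) p := ((gg.pow 2).mul s1).add (contDiffAt_const.mul gg)
  have p1 : ∀ i, ContDiffAt ℝ 1 (PP A (Wf γ α u) i) p := fun i => ContDiffAt.sum fun j _ => (a1 i j).mul (W1 j)
  have e1 : ContDiffAt ℝ 1 (EE A (Wf γ α u)) p := ContDiffAt.sum fun j _ => (p1 j).mul (W1 j)
  have w1 : ContDiffAt ℝ 1 (wf γ α u) p := (cd_wf hγ hp hu2).of_le (by norm_num)
  have g1 : ContDiffAt ℝ 1 (Gf γ α A u) p := by
    have : ContDiffAt ℝ 1 (fun q => ∑ j, ff γ A j q * Wf γ α u j q) p :=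
      ContDiffAt.sum fun j _ => (f1 j).mul (W1 j)
    refine this.congr_of_eventuallyEq ?_
    filter_upwards [isOpen_Om.mem_nhds hp] with q hq
    exact Gf_eq hγ hq u A
  unfold vtot vmain ven
  exact ((((t1.mul ((p1 i).mul g1)).add (contDiffAt_const.mul ((f1 i).mul (t1.mul e1)))).add
    (contDiffAt_const.mul ((f1 i).mul (ta.mul (t1.mul (k1.mul (w1.mul w1))))))).add
    (contDiffAt_const.mul (t2.mul (w1.mul (p1 i))))).add (contDiffAt_const.mul (t3.mul (w1.mul (p1 i))))

omit hγ in
lemma vtot_zero {a b : ℝ} (h1 : ∀ s ∉ Icc a b, χ s = 0) (h2 : ∀ s ∉ Icc a b, η s = 0) (i : Fin (m + k)) (q : E m k)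
    (hq : sl γ q ∉ Icc a b) : vtot γ α C lam M A u χ η i q = 0 := by
  simp [vtot, vmain, ven, Th, ze, h1 _ hq, h2 _ hq]

/-- radial weights -/
lemma rad_int {a b : ℝ} (hb : b < 0) {f : ℝ → ℝ} (hf : Continuous f) (hf0 : ∀ s ∉ Icc a b, f s = 0)
    {w : E m k → ℝ} (hw : ContinuousOn w (ball γ 1)) :
    Integrable (fun q => f (sl γ q) * (tau γ q * w q ^ 2)) := by
  have h0 : ∀ q : E m k, sl γ q ∉ Icc a b → f (sl γ q) * (tau γ q * w q ^ 2) = 0 := by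
    intro q hq; rw [hf0 _ hq, zero_mul]
  refine (cont_of hγ hb h0 fun p hp0 hp1 => ?_).integrable_of_hasCompactSupport (supp_cpt hγ hb h0)
  exact (hf.continuousAt.comp (ca_sl hγ hp0)).mul ((ca_tau hγ hp0).mul
    ((hw.continuousAt ((isOpen_ball hγ 1).mem_nhds hp1)).pow 2))
end
end BG

namespace BG
variable {m k : ℕ}

def f1 (α Q : ℝ) (χ : ℝ → ℝ) (s : ℝ) : ℝ :=
  Real.exp (s / 2) * (χ s ^ 2 * Real.exp ((2 - Q) * s)) * Real.exp (-gf α s) ^ 2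
def JJ (χ η : ℝ → ℝ) (s : ℝ) : ℝ := |χ s * deriv χ s| + deriv χ s ^ 2 + η s ^ 2 + deriv η s ^ 2
def f2 (α Q : ℝ) (χ η : ℝ → ℝ) (s : ℝ) : ℝ := JJ χ η s * Real.exp ((2 - Q) * s) * Real.exp (-gf α s) ^ 2

lemma deriv_zero {χ : ℝ → ℝ} {a b : ℝ} (h : ∀ s ∉ Icc a b, χ s = 0) : ∀ s ∉ Icc a b, deriv χ s = 0 := by
  intro s hs
  have : χ =ᶠ[nhds s] fun _ => (0:ℝ) :=
    Filter.eventually_of_mem (isClosed_Icc.isOpen_compl.mem_nhds hs) fun q hq => h q hq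
  rw [this.deriv_eq]; simp

lemma carleman (hm : 1 ≤ m) {γ Λ lam α K M : ℝ} (hγ : 0 < γ) (hΛ : 0 < Λ) (hlam : 0 < lam)
    {A : E m k → Matrix (Fin (m + k)) (Fin (m + k)) ℝ}
    (hA : C1coeff A) (hsym : Symm A) (hE : Elliptic lam A) (hH : HypH γ Λ A)
    {u : E m k → ℝ} (hu : ContDiffOn ℝ 2 u (ball γ 1)) {C : ℝ} (hC : C = CU m k γ Λ lam) (hC0 : 0 < C)
    (hα : 100 * C ^ 2 ≤ α) {a b : ℝ} (hb : b < 0) (he1 : 1000 * C ^ 2 * Real.exp (b / 2) ≤ 1)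
    (he2 : 6 * C ^ 3 / lam * (4 * C / lam + 10 * C + 4 * C / lam * (2 * C ^ 2)) * Real.exp (b / 2) ≤ 1 / 64)
    {v : E m k → ℝ} (hL : ∀ p ∈ ball γ 1, Lop γ A u p = v p * u p)
    (hv : ∀ p ∈ ball γ 1, |v p| ≤ K * psi γ p) (hK0 : 0 ≤ K) (hK : K ^ 2 ≤ α ^ 3)
    {χ η : ℝ → ℝ} (hχ : ContDiff ℝ 1 χ) (hη : ContDiff ℝ 1 η)
    (hχ0 : ∀ s ∉ Icc a b, χ s = 0) (hη0 : ∀ s ∉ Icc a b, η s = 0)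
    (hM : 0 ≤ M) (hMη : ∀ s, 2 * |χ s * deriv χ s| ≤ M * η s ^ 2) :
    Integrable (fun q => f1 α (QQ m k γ) χ (sl γ q) * (tau γ q * u q ^ 2)) ∧
    Integrable (fun q => f2 α (QQ m k γ) χ η (sl γ q) * (tau γ q * u q ^ 2)) ∧
    ∫ q, f1 α (QQ m k γ) χ (sl γ q) * (tau γ q * u q ^ 2)
      ≤ 64 * DD C lam M * ∫ q, f2 α (QQ m k γ) χ η (sl γ q) * (tau γ q * u q ^ 2) := by
  have hgc : Continuous (gf α) := (cd_gf α (n := 1)).continuous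
  have hχc := hχ.continuous
  have hηc := hη.continuous
  have hχd := hχ.continuous_deriv le_rfl
  have hηd := hη.continuous_deriv le_rfl
  have hχd0 := deriv_zero hχ0
  have hηd0 := deriv_zero hη0
  have f1c : Continuous (f1 α (QQ m k γ) χ) := by unfold f1; fun_prop
  have f2c : Continuous (f2 α (QQ m k γ) χ η) := by unfold f2 JJ; fun_prop
  have f10 : ∀ s ∉ Icc a b, f1 α (QQ m k γ) χ s = 0 := by
    intro s hs; simp [f1, hχ0 s hs]
  have f20 : ∀ s ∉ Icc a b, f2 α (QQ m k γ) χ η s = 0 := by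
    intro s hs; simp [f2, JJ, hχ0 s hs, hη0 s hs, hχd0 s hs, hηd0 s hs]
  have i1 := rad_int (m := m) (k := k) hγ hb f1c f10 hu.continuousOn
  have i2 := rad_int (m := m) (k := k) hγ hb f2c f20 hu.continuousOn
  refine ⟨i1, i2, ?_⟩
  have hα0 : 0 < α := lt_of_lt_of_le (by positivity) hα
  have hdχ : ∀ s, HasDerivAt χ (deriv χ s) s := fun s => (hχ.differentiable (by norm_num) s).hasDerivAt
  have hdη : ∀ s, HasDerivAt η (deriv η s) s := fun s => (hη.differentiable (by norm_num) s).hasDerivAt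
  have key := div_ineq (k := k) hm hγ (v := vtot γ α C lam M A u χ η)
    (F := fun q => (-(1 / 64) * α ^ 2) * (f1 α (QQ m k γ) χ (sl γ q) * (tau γ q * u q ^ 2))
      + (DD C lam M * α ^ 2) * (f2 α (QQ m k γ) χ η (sl γ q) * (tau γ q * u q ^ 2)))
    ?_ ?_ ?_ ((i1.const_mul _).add (i2.const_mul _)) ?_
  · rw [integral_add (i1.const_mul _) (i2.const_mul _), integral_const_mul, integral_const_mul] at key
    have h2 : 0 ≤ α ^ 2 * (DD C lam M * (∫ q, f2 α (QQ m k γ) χ η (sl γ q) * (tau γ q * u q ^ 2))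
       - 1 / 64 * ∫ q, f1 α (QQ m k γ) χ (sl γ q) * (tau γ q * u q ^ 2)) := by
      refine key.trans (le_of_eq ?_)
      ring
    have h3 := nonneg_of_mul_nonneg_right h2 (by positivity)
    linarith
  · intro i p hp
    by_cases hp1 : rho γ p < 1
    · exact cd_vtot hγ hA hu hχ hη hp hp1 i
    · exact contDiffAt_const.congr_of_eventuallyEq
        (loc_zero hγ hb (vtot_zero hχ0 hη0 i) (fun h => hp1 h.2))
  · intro i
    exact supp_cpt hγ hb (vtot_zero hχ0 hη0 i)
  · intro i hi
    exact cont_of hγ hb (vtot_zero hχ0 hη0 i) fun p hp0 hp1 => ca_vtot hγ hΛ hA hH hu hχ hη hp0 hp1 hi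
  · intro p hp
    by_cases hs : sl γ p ∈ Icc a b
    · have hp1 : rho γ p < 1 := (rho_of_sl hγ hb hs).2.trans_lt (by simpa using hb)
      have hle : Real.exp (sl γ p / 2) ≤ Real.exp (b / 2) := Real.exp_le_exp.2 (by linarith [hs.2])
      have h1 : 1000 * C ^ 2 * Real.exp (sl γ p / 2) ≤ 1 := le_trans (by gcongr) he1
      have h2 : 6 * C ^ 3 / lam * (4 * C / lam + 10 * C + 4 * C / lam * (2 * C ^ 2))
        * Real.exp (sl γ p / 2) ≤ 1 / 64 := le_trans (by gcongr) he2
      have := pw hγ hΛ hlam hp hA hsym hE hH hp1 (u_at hγ hu hp1) hC hα h1 h2 (hL p hp1) (hv p hp1) hK0 hK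
        hdχ hdη hM hMη
      refine this.trans (le_of_eq ?_)
      unfold f1 f2 JJ wf
      ring
    · have hz : ∀ i, vtot γ α C lam M A u χ η i =ᶠ[nhds p] fun _ => 0 := by
        intro i
        have := (ca_sl hγ (rho_pos hγ hp)).eventually (isClosed_Icc.isOpen_compl.mem_nhds hs)
        filter_upwards [this] with q hq
        exact vtot_zero hχ0 hη0 i q hq
      have : ∀ i, Xd γ i (vtot γ α C lam M A u χ η i) p = 0 := by
        intro i
        unfold Xd
        rw [(hz i).fderiv_eq]; simp
      simp [this, f10 _ hs, f20 _ hs]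

/-- bump -/
def bp (c d s : ℝ) : ℝ := Real.smoothTransition (s - c) * Real.smoothTransition (d - s)

lemma bp_cd (c d : ℝ) : ContDiff ℝ 1 (bp c d) := by
  unfold bp
  exact (Real.smoothTransition.contDiff.comp (contDiff_id.sub contDiff_const)).mul
    (Real.smoothTransition.contDiff.comp (contDiff_const.sub contDiff_id))

lemma bp_nonneg (c d s : ℝ) : 0 ≤ bp c d s :=
  mul_nonneg (Real.smoothTransition.nonneg _) (Real.smoothTransition.nonneg _)
lemma bp_le (c d s : ℝ) : bp c d s ≤ 1 :=
  mul_le_one₀ (Real.smoothTransition.le_one _) (Real.smoothTransition.nonneg _) (Real.smoothTransition.le_one _)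
lemma bp_zero {c d s : ℝ} (h : s ∉ Icc c d) : bp c d s = 0 := by
  unfold bp
  rw [mem_Icc, not_and_or] at h
  rcases h with h | h
  · rw [Real.smoothTransition.zero_of_nonpos (by linarith), zero_mul]
  · rw [Real.smoothTransition.zero_of_nonpos (x := d - s) (by linarith), mul_zero]
lemma bp_one {c d s : ℝ} (h1 : c + 1 ≤ s) (h2 : s ≤ d - 1) : bp c d s = 1 := by
  unfold bp
  rw [Real.smoothTransition.one_of_one_le (by linarith), Real.smoothTransition.one_of_one_le (by linarith), one_mul]

lemma T_deriv_zero' {s : ℝ} (h : s < 0) : deriv Real.smoothTransition s = 0 := by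
  have : Real.smoothTransition =ᶠ[nhds s] fun _ => (0:ℝ) := by
    filter_upwards [Iio_mem_nhds h] with q hq
    exact Real.smoothTransition.zero_of_nonpos (le_of_lt hq)
  rw [this.deriv_eq]; simp

lemma bp_deriv (c d s : ℝ) : deriv (bp c d) s = deriv Real.smoothTransition (s - c) * Real.smoothTransition (d - s)
    - Real.smoothTransition (s - c) * deriv Real.smoothTransition (d - s) := by
  have hd : ∀ x, HasDerivAt Real.smoothTransition (deriv Real.smoothTransition x) x := fun x =>
    ((Real.smoothTransition.contDiff (n := 1)).differentiable (by norm_num) x).hasDerivAt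
  have h1 : HasDerivAt (fun s : ℝ => s - c) 1 s := (hasDerivAt_id s).sub_const c
  have h2 : HasDerivAt (fun s : ℝ => d - s) (-1) s := by simpa using (hasDerivAt_id s).const_sub d
  have h3 : HasDerivAt (bp c d) _ s := ((hd _).comp s h1).mul ((hd _).comp s h2)
  rw [h3.deriv]; simp only [Function.comp]; ring

lemma bp_deriv_le {M : ℝ} (hM : ∀ s, |deriv Real.smoothTransition s| ≤ M) (c d s : ℝ) :
    |deriv (bp c d) s| ≤ 2 * M := by
  have hM0 : 0 ≤ M := (abs_nonneg _).trans (hM 0)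
  rw [bp_deriv]
  refine (abs_sub _ _).trans ?_
  rw [abs_mul, abs_mul, abs_of_nonneg (Real.smoothTransition.nonneg _), abs_of_nonneg (Real.smoothTransition.nonneg _)]
  have h1 := mul_le_mul (hM (s - c)) (Real.smoothTransition.le_one (d - s)) (Real.smoothTransition.nonneg _) hM0
  have h2 := mul_le_mul (Real.smoothTransition.le_one (s - c)) (hM (d - s)) (abs_nonneg _) zero_le_one
  linarith

lemma bp_deriv_supp {c d s : ℝ} (h : deriv (bp c d) s ≠ 0) : (c ≤ s ∧ s ≤ c + 1) ∨ (d - 1 ≤ s ∧ s ≤ d) := by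
  by_contra hn
  apply h
  rw [bp_deriv]
  have h1 : deriv Real.smoothTransition (s - c) = 0 ∨ (c ≤ s ∧ s ≤ c + 1) := by
    rcases lt_or_ge (s - c) 0 with h | h
    · exact Or.inl (T_deriv_zero' h)
    rcases lt_or_ge 1 (s - c) with h' | h'
    · exact Or.inl (T_deriv_zero h')
    · exact Or.inr ⟨by linarith, by linarith⟩
  have h2 : deriv Real.smoothTransition (d - s) = 0 ∨ (d - 1 ≤ s ∧ s ≤ d) := by
    rcases lt_or_ge (d - s) 0 with h | h
    · exact Or.inl (T_deriv_zero' h)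
    rcases lt_or_ge 1 (d - s) with h' | h'
    · exact Or.inl (T_deriv_zero h')
    · exact Or.inr ⟨by linarith, by linarith⟩
  rcases h1 with h1 | h1
  · rcases h2 with h2 | h2
    · rw [h1, h2]; ring
    · exact absurd (Or.inr h2) hn
  · exact absurd (Or.inl h1) hn

/-- the pair of cutoffs -/
lemma cutoffs : ∃ M D2 : ℝ, 0 ≤ M ∧ 0 ≤ D2 ∧ ∀ l s0 : ℝ, l ≤ s0 → ∃ χ η : ℝ → ℝ, ContDiff ℝ 1 χ ∧ ContDiff ℝ 1 η ∧
    (∀ s ∉ Icc (l - 3) (s0 + 4), χ s = 0) ∧ (∀ s ∉ Icc (l - 3) (s0 + 4), η s = 0) ∧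
    (∀ s, 2 * |χ s * deriv χ s| ≤ M * η s ^ 2) ∧ (∀ s, l ≤ s → s ≤ s0 → χ s = 1) ∧
    (∀ s, 0 ≤ JJ χ η s ∧ JJ χ η s ≤ D2) ∧ (∀ s, JJ χ η s ≠ 0 → (l - 3 ≤ s ∧ s ≤ l) ∨ (s0 + 1 ≤ s ∧ s ≤ s0 + 4)) := by
  obtain ⟨M, hM0, hM⟩ := T_deriv
  refine ⟨4 * M, 2 * M + (2 * M) ^ 2 + 2 ^ 2 + (4 * M) ^ 2, by positivity, by positivity, fun l s0 hl => ?_⟩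
  have hηc : ContDiff ℝ 1 (fun s => bp (l - 3) l s + bp (s0 + 1) (s0 + 4) s) := (bp_cd _ _).add (bp_cd _ _)
  have hηd : ∀ s, deriv (fun s => bp (l - 3) l s + bp (s0 + 1) (s0 + 4) s) s
      = deriv (bp (l - 3) l) s + deriv (bp (s0 + 1) (s0 + 4)) s := fun s =>
    deriv_fun_add ((bp_cd _ _).differentiable (by norm_num) s) ((bp_cd _ _).differentiable (by norm_num) s)
  have hch : ∀ s, |bp (l - 2) (s0 + 3) s| ≤ 1 := fun s => by
    rw [abs_of_nonneg (bp_nonneg _ _ _)]; exact bp_le _ _ _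
  have hcd := bp_deriv_le hM (l - 2) (s0 + 3)
  have hcc : ∀ s, |bp (l - 2) (s0 + 3) s * deriv (bp (l - 2) (s0 + 3)) s| ≤ 2 * M := by
    intro s
    rw [abs_mul]
    have := mul_le_mul (hch s) (hcd s) (abs_nonneg _) zero_le_one
    linarith
  have hE0 := fun s => bp_nonneg (l - 3) l s
  have hE1 := fun s => bp_nonneg (s0 + 1) (s0 + 4) s
  refine ⟨bp (l - 2) (s0 + 3), fun s => bp (l - 3) l s + bp (s0 + 1) (s0 + 4) s, bp_cd _ _, hηc,
    ?_, ?_, ?_, ?_, ?_, ?_⟩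
  · intro s hs
    exact bp_zero fun h => hs ⟨by linarith [h.1], by linarith [h.2]⟩
  · intro s hs
    simp only
    rw [bp_zero fun h => hs ⟨by linarith [h.1], by linarith [h.2]⟩,
      bp_zero fun h => hs ⟨by linarith [h.1], by linarith [h.2]⟩, add_zero]
  · intro s
    by_cases h : deriv (bp (l - 2) (s0 + 3)) s = 0
    · rw [h]; simp; positivity
    · have h1 : 1 ≤ bp (l - 3) l s + bp (s0 + 1) (s0 + 4) s := by
        rcases bp_deriv_supp h with h | h
        · rw [bp_one (c := l - 3) (d := l) (by linarith [h.1]) (by linarith [h.2])]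
          linarith [hE1 s]
        · rw [bp_one (c := s0 + 1) (d := s0 + 4) (by linarith [h.1]) (by linarith [h.2])]
          linarith [hE0 s]
      have h2 : 1 ≤ (bp (l - 3) l s + bp (s0 + 1) (s0 + 4) s) ^ 2 := one_le_pow₀ h1
      have := hcc s
      nlinarith
  · intro s h1 h2
    exact bp_one (by linarith) (by linarith)
  · intro s
    constructor
    · unfold JJ; positivity
    · unfold JJ
      rw [hηd]
      have a1 : deriv (bp (l - 2) (s0 + 3)) s ^ 2 ≤ (2 * M) ^ 2 := by
        rw [← sq_abs]; gcongr; exact hcd s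
      have a2 : (bp (l - 3) l s + bp (s0 + 1) (s0 + 4) s) ^ 2 ≤ 2 ^ 2 := by
        have := bp_le (l - 3) l s
        have := bp_le (s0 + 1) (s0 + 4) s
        have := hE0 s
        have := hE1 s
        gcongr; linarith
      have a3 : (deriv (bp (l - 3) l) s + deriv (bp (s0 + 1) (s0 + 4)) s) ^ 2 ≤ (4 * M) ^ 2 := by
        rw [← sq_abs]; gcongr
        refine (abs_add_le _ _).trans ?_
        have := bp_deriv_le hM (l - 3) l s
        have := bp_deriv_le hM (s0 + 1) (s0 + 4) s
        linarith
      have := hcc s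
      linarith
  · intro s hs
    by_contra hn
    rw [not_or] at hn
    apply hs
    have z1 : s ∉ Icc (l - 3) l := hn.1
    have z2 : s ∉ Icc (s0 + 1) (s0 + 4) := hn.2
    have e1 : deriv (bp (l - 3) l) s = 0 := deriv_zero (fun s h => bp_zero h) s z1
    have e2 : deriv (bp (s0 + 1) (s0 + 4)) s = 0 := deriv_zero (fun s h => bp_zero h) s z2
    have e3 : deriv (bp (l - 2) (s0 + 3)) s = 0 := by
      by_contra h
      rcases bp_deriv_supp h with h | h
      · exact z1 ⟨by linarith [h.1], by linarith [h.2]⟩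
      · exact z2 ⟨by linarith [h.1], by linarith [h.2]⟩
    unfold JJ
    rw [hηd, e1, e2, e3]; simp [bp_zero z1, bp_zero z2]
end BG

namespace BG
variable {m k : ℕ}

def WW (α Q s : ℝ) : ℝ := Real.exp (-(Q * s) - 2 * gf α s)

lemma WW_pos (α Q s : ℝ) : 0 < WW α Q s := Real.exp_pos _

lemma gf_low {α s t : ℝ} (hα : 0 ≤ α) (hst : s ≤ t) (ht : t ≤ 0) : α * (t - s) / 2 ≤ gf α t - gf α s := by
  have h1 : 1 - (t - s) / 2 ≤ Real.exp (-((t - s) / 2)) := by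
    have := Real.add_one_le_exp (-((t - s) / 2)); linarith
  have h2 : Real.exp (s / 2) = Real.exp (t / 2) * Real.exp (-((t - s) / 2)) := by
    rw [← Real.exp_add]; congr 1; ring
  have h3 : Real.exp (t / 2) ≤ 1 := Real.exp_le_one_iff.2 (by linarith)
  have h4 : Real.exp (t / 2) - Real.exp (s / 2) ≤ (t - s) / 2 := by
    rw [h2]
    have h5 : Real.exp (t / 2) * (1 - (t - s) / 2) ≤ Real.exp (t / 2) * Real.exp (-((t - s) / 2)) := by gcongr
    have h6 : Real.exp (t / 2) * ((t - s) / 2) ≤ 1 * ((t - s) / 2) := by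
      gcongr
    linarith
  unfold gf
  have h7 := mul_le_mul_of_nonneg_left h4 hα
  linarith

lemma gf_up {α s t : ℝ} (hα : 0 ≤ α) (hst : s ≤ t) : gf α t - gf α s ≤ α * (t - s) := by
  have h4 : Real.exp (s / 2) ≤ Real.exp (t / 2) := Real.exp_le_exp.2 (by linarith)
  unfold gf
  have h7 := mul_le_mul_of_nonneg_left h4 hα
  linarith

lemma WW_dec {α Q s t : ℝ} (hα : 0 ≤ α) (hQ : 0 ≤ Q) (hst : s ≤ t) (ht : t ≤ 0) :
    WW α Q t ≤ Real.exp (-(α * (t - s))) * WW α Q s := by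
  unfold WW
  rw [← Real.exp_add]
  apply Real.exp_le_exp.2
  have := gf_low hα hst ht
  have := mul_le_mul_of_nonneg_left hst hQ
  linarith

lemma WW_mono {α Q s t : ℝ} (hα : 0 ≤ α) (hQ : 0 ≤ Q) (hst : s ≤ t) (ht : t ≤ 0) :
    WW α Q t ≤ WW α Q s := by
  refine (WW_dec hα hQ hst ht).trans ?_
  have : Real.exp (-(α * (t - s))) ≤ 1 := Real.exp_le_one_iff.2 (by
    have := mul_nonneg hα (sub_nonneg.2 hst); linarith)
  exact mul_le_of_le_one_left (WW_pos _ _ _).le this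

lemma WW_up {α Q s t : ℝ} (hα : 0 ≤ α) (hst : s ≤ t) :
    WW α Q s ≤ Real.exp ((Q + 2 * α) * (t - s)) * WW α Q t := by
  unfold WW
  rw [← Real.exp_add]
  apply Real.exp_le_exp.2
  have := gf_up hα hst
  linarith

lemma WW_half {α Q s t : ℝ} (hα : 1 ≤ α) (hQ : 0 ≤ Q) (hst : s ≤ t) (ht : t ≤ 0) :
    Real.exp (t / 2) * WW α Q t ≤ Real.exp (s / 2) * WW α Q s := by
  unfold WW
  rw [← Real.exp_add, ← Real.exp_add]
  apply Real.exp_le_exp.2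
  have := gf_low (by linarith : 0 ≤ α) hst ht
  have := mul_le_mul_of_nonneg_left hst hQ
  have := mul_le_mul_of_nonneg_right hα (sub_nonneg.2 hst)
  linarith

lemma weight_eq {γ : ℝ} (hγ : 0 < γ) {q : E m k} (hq : q.1 ≠ 0) (α Q c : ℝ) :
    c * Real.exp ((2 - Q) * sl γ q) * Real.exp (-gf α (sl γ q)) ^ 2 * tau γ q
      = c * WW α Q (sl γ q) * psi γ q := by
  rw [psi_eq hγ hq, ← exp_sl hγ hq, WW, ← Real.exp_nat_mul, ← Real.exp_nat_mul]
  have : Real.exp ((2 - Q) * sl γ q) * Real.exp ((2 : ℕ) * -gf α (sl γ q))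
      = Real.exp (-(Q * sl γ q) - 2 * gf α (sl γ q)) * Real.exp ((2 : ℕ) * sl γ q) := by
    rw [← Real.exp_add, ← Real.exp_add]; congr 1; push_cast; ring
  calc _ = c * (Real.exp ((2 - Q) * sl γ q) * Real.exp ((2 : ℕ) * -gf α (sl γ q))) * tau γ q := by ring
    _ = _ := by rw [this]; ring

lemma core (hm : 1 ≤ m) {γ α Q D P : ℝ} (hγ : 0 < γ) (hα : 1 ≤ α) (hQ : 0 ≤ Q) {l s0 : ℝ}
    (hl : l ≤ s0) (hs0 : s0 + 4 < 0) (hD : 0 ≤ D) (hP : 0 ≤ P)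
    {u : E m k → ℝ} (hu1 : ∀ p ∈ ball γ 1, |u p| ≤ 1) {S : ℝ} (hS0 : 0 ≤ S)
    (hS : ∀ p : E m k, rho γ p ≤ Real.exp l → |u p| ≤ S)
    {χ η : ℝ → ℝ} (hχ1 : ∀ s, l ≤ s → s ≤ s0 → χ s = 1)
    (hJ : ∀ s, 0 ≤ JJ χ η s ∧ JJ χ η s ≤ D)
    (hJs : ∀ s, JJ χ η s ≠ 0 → (l - 3 ≤ s ∧ s ≤ l) ∨ (s0 + 1 ≤ s ∧ s ≤ s0 + 4))
    (i1 : Integrable (fun q : E m k => f1 α Q χ (sl γ q) * (tau γ q * u q ^ 2)))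
    (i2 : Integrable (fun q : E m k => f2 α Q χ η (sl γ q) * (tau γ q * u q ^ 2)))
    (h12 : ∫ q : E m k, f1 α Q χ (sl γ q) * (tau γ q * u q ^ 2)
      ≤ P * ∫ q : E m k, f2 α Q χ η (sl γ q) * (tau γ q * u q ^ 2)) :
    Real.exp (s0 / 2) * WW α Q s0 * (∫ p in ball γ (Real.exp s0), u p ^ 2 * psi γ p)
      ≤ P * (D * (WW α Q (l - 3) * S ^ 2 + WW α Q (s0 + 1)) * (volume (ball (m := m) (k := k) γ 1)).toReal)
        + Real.exp (s0 / 2) * WW α Q s0 * S ^ 2 * (volume (ball (m := m) (k := k) γ 1)).toReal := by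
  set B1 : Set (E m k) := ball γ 1 with hB1
  have hmB : MeasurableSet B1 := (isOpen_ball hγ 1).measurableSet
  have hmR : MeasurableSet (ball (m := m) (k := k) γ (Real.exp s0)) := (isOpen_ball hγ _).measurableSet
  have icst : ∀ c : ℝ, Integrable (B1.indicator fun _ : E m k => c) := fun c => by
    rw [integrable_indicator_iff hmB]
    exact integrableOn_const (vol_ball hγ).ne
  have vcst : ∀ c : ℝ, ∫ q : E m k, B1.indicator (fun _ : E m k => c) q = c * (volume B1).toReal := fun c => by
    rw [integral_indicator hmB, setIntegral_const, smul_eq_mul, mul_comm]; rfl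
  have hψ0 := fun q : E m k => psi_nonneg hγ q
  have hψ1 := fun q : E m k => psi_le_one hγ q
  have hrho : ∀ q : E m k, q.1 ≠ 0 → ∀ t, sl γ q ≤ t ↔ rho γ q ≤ Real.exp t := by
    intro q hq t
    rw [← exp_sl hγ hq, Real.exp_le_exp]
  -- bound of f2
  have hF2 : ∫ q : E m k, f2 α Q χ η (sl γ q) * (tau γ q * u q ^ 2)
      ≤ D * (WW α Q (l - 3) * S ^ 2 + WW α Q (s0 + 1)) * (volume B1).toReal := by
    rw [← vcst]
    refine integral_mono_ae i2 (icst _) ?_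
    filter_upwards [ae_z hm] with q hq
    have e : f2 α Q χ η (sl γ q) * (tau γ q * u q ^ 2) = JJ χ η (sl γ q) * WW α Q (sl γ q) * (psi γ q * u q ^ 2) := by
      have := weight_eq hγ hq α Q (JJ χ η (sl γ q))
      unfold f2
      calc _ = (JJ χ η (sl γ q) * Real.exp ((2 - Q) * sl γ q) * Real.exp (-gf α (sl γ q)) ^ 2 * tau γ q) * u q ^ 2 := by ring
        _ = _ := by rw [this]; ring
    show f2 α Q χ η (sl γ q) * (tau γ q * u q ^ 2) ≤ _
    rw [e]
    have w1 := WW_pos α Q (l - 3)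
    have w2 := WW_pos α Q (s0 + 1)
    have w3 := WW_pos α Q (sl γ q)
    have hR : 0 ≤ D * (WW α Q (l - 3) * S ^ 2 + WW α Q (s0 + 1)) := by positivity
    by_cases hz : JJ χ η (sl γ q) = 0
    · rw [hz, zero_mul, zero_mul]
      exact indicator_nonneg (fun _ _ => hR) q
    have hs := hJs _ hz
    have hslneg : sl γ q ≤ s0 + 4 := by rcases hs with h | h <;> linarith
    have hqB : q ∈ B1 := by
      show rho γ q < 1
      rw [← exp_sl hγ hq]; exact Real.exp_lt_one_iff.2 (by linarith)
    rw [indicator_of_mem hqB]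
    have hψ : psi γ q * u q ^ 2 ≤ u q ^ 2 := mul_le_of_le_one_left (sq_nonneg _) (hψ1 q)
    have hJq := hJ (sl γ q)
    have key : WW α Q (sl γ q) * (psi γ q * u q ^ 2) ≤ WW α Q (l - 3) * S ^ 2 + WW α Q (s0 + 1) := by
      rcases hs with h | h
      · have a1 : u q ^ 2 ≤ S ^ 2 := by
          rw [← sq_abs]; have := hS q ((hrho q hq l).1 h.2); gcongr
        have a2 : WW α Q (sl γ q) ≤ WW α Q (l - 3) := WW_mono (by linarith) hQ h.1 (by linarith)
        have : WW α Q (sl γ q) * (psi γ q * u q ^ 2) ≤ WW α Q (l - 3) * S ^ 2 :=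
          mul_le_mul a2 (hψ.trans a1) (mul_nonneg (hψ0 q) (sq_nonneg _)) w1.le
        linarith
      · have a1 : u q ^ 2 ≤ 1 := by
          rw [← sq_abs]; exact pow_le_one₀ (abs_nonneg _) (hu1 q hqB)
        have a2 : WW α Q (sl γ q) ≤ WW α Q (s0 + 1) := WW_mono (by linarith) hQ h.1 (by linarith)
        have : WW α Q (sl γ q) * (psi γ q * u q ^ 2) ≤ WW α Q (s0 + 1) * 1 :=
          mul_le_mul a2 (hψ.trans a1) (mul_nonneg (hψ0 q) (sq_nonneg _)) w2.le
        have : 0 ≤ WW α Q (l - 3) * S ^ 2 := by positivity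
        linarith
    rw [mul_assoc]
    exact mul_le_mul hJq.2 key (mul_nonneg w3.le (mul_nonneg (hψ0 q) (sq_nonneg _))) hD
  -- bound from below of f1
  have w0 := WW_pos α Q s0
  have hF1 : Real.exp (s0 / 2) * WW α Q s0 * (∫ p in ball γ (Real.exp s0), u p ^ 2 * psi γ p)
      ≤ (∫ q : E m k, f1 α Q χ (sl γ q) * (tau γ q * u q ^ 2))
        + Real.exp (s0 / 2) * WW α Q s0 * S ^ 2 * (volume B1).toReal := by
    rw [← vcst, ← integral_add i1 (icst _), ← integral_const_mul, ← integral_indicator hmR]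
    refine integral_mono_of_nonneg ?_ (i1.add (icst _)) ?_
    · refine Eventually.of_forall fun q => ?_
      refine indicator_nonneg (fun q _ => ?_) q
      have := hψ0 q
      positivity
    · filter_upwards [ae_z hm] with q hq
      have e : f1 α Q χ (sl γ q) * (tau γ q * u q ^ 2)
          = Real.exp (sl γ q / 2) * WW α Q (sl γ q) * χ (sl γ q) ^ 2 * (psi γ q * u q ^ 2) := by
        have := weight_eq hγ hq α Q (Real.exp (sl γ q / 2) * χ (sl γ q) ^ 2)
        unfold f1
        calc _ = (Real.exp (sl γ q / 2) * χ (sl γ q) ^ 2 * Real.exp ((2 - Q) * sl γ q) * Real.exp (-gf α (sl γ q)) ^ 2 * tau γ q) * u q ^ 2 := by ring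
          _ = _ := by rw [this]; ring
      have w3 := WW_pos α Q (sl γ q)
      have p0 := hψ0 q
      have hpos1 : 0 ≤ f1 α Q χ (sl γ q) * (tau γ q * u q ^ 2) := by rw [e]; positivity
      have hpos2 : 0 ≤ B1.indicator (fun _ : E m k => Real.exp (s0 / 2) * WW α Q s0 * S ^ 2) q :=
        indicator_nonneg (fun _ _ => by positivity) q
      show (ball γ (Real.exp s0)).indicator (fun q => Real.exp (s0 / 2) * WW α Q s0 * (u q ^ 2 * psi γ q)) q
        ≤ f1 α Q χ (sl γ q) * (tau γ q * u q ^ 2) + B1.indicator (fun _ : E m k => Real.exp (s0 / 2) * WW α Q s0 * S ^ 2) q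
      by_cases hqr : q ∈ ball (m := m) (k := k) γ (Real.exp s0)
      swap
      · rw [indicator_of_notMem hqr]; positivity
      rw [indicator_of_mem hqr]
      have hqr' : rho γ q < Real.exp s0 := hqr
      have hs1 : sl γ q ≤ s0 := (hrho q hq s0).2 hqr'.le
      have hqB : q ∈ B1 := by
        show rho γ q < 1
        exact hqr'.trans (Real.exp_lt_one_iff.2 (by linarith))
      rw [indicator_of_mem hqB] at hpos2 ⊢
      rcases le_total (sl γ q) l with h | h
      · have a1 : u q ^ 2 ≤ S ^ 2 := by
          rw [← sq_abs]; have := hS q ((hrho q hq l).1 h); gcongr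
        have a2 : u q ^ 2 * psi γ q ≤ S ^ 2 :=
          (mul_le_of_le_one_right (sq_nonneg _) (hψ1 q)).trans a1
        have := mul_le_mul_of_nonneg_left a2 (by positivity : 0 ≤ Real.exp (s0 / 2) * WW α Q s0)
        linarith
      · rw [e, hχ1 _ h hs1]
        have a1 := WW_half hα hQ hs1 (by linarith)
        have := mul_le_mul_of_nonneg_right a1 (by positivity : 0 ≤ psi γ q * u q ^ 2)
        linarith
  have := mul_le_mul_of_nonneg_left hF2 hP
  linarith
end BG

namespace BG
variable {m k : ℕ}

lemma CU_ge {γ Λ lam : ℝ} (hγ : 0 < γ) (hΛ : 0 < Λ) (hlam : 0 < lam) : 1 ≤ CU m k γ Λ lam := by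
  have hCG := CG_ge (m := m) (k := k) hγ hΛ
  have x : 0 ≤ ((m + k : ℕ) : ℝ) := Nat.cast_nonneg _
  unfold CU
  have x0 : 0 ≤ CG m k γ Λ := by linarith
  have x1 : 0 ≤ ((m + k : ℕ) : ℝ) ^ 2 * (1 + Λ) * CG m k γ Λ := by positivity
  have x2 : 0 ≤ ((m + k : ℕ) : ℝ) * CG m k γ Λ := by positivity
  have x3 : 0 ≤ ((m + k : ℕ) : ℝ) * CG m k γ Λ ^ 2 := by positivity
  have x4 : 0 ≤ lam⁻¹ := by positivity
  have x5 : 0 ≤ |QQ m k γ - 2| := abs_nonneg _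
  linarith

lemma final_scalar {P κ ω I S Q A0 T L d w0 wl w1 α : ℝ} (hP : 0 ≤ P) (hκ : 0 < κ) (hω : 0 ≤ ω)
    (hI : 0 < I) (hS : 0 ≤ S) (hQ : 0 ≤ Q) (hA0 : 0 ≤ A0) (hA1 : 2 * P / (κ * I) ≤ A0) (hT : 1 ≤ T)
    (hα : α = A0 * T) (hd0 : 0 ≤ d) (hd : d ≤ 5 * L)
    (hw0 : 0 < w0) (hwl : wl ≤ Real.exp ((Q + 2 * α) * d) * w0) (hw1 : w1 ≤ Real.exp (-α) * w0)
    (h : κ * w0 * I ≤ P * (wl * S ^ 2 + w1) + κ * w0 * S ^ 2 * ω) :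
    √(κ * I / (2 * (P + κ * ω + 1))) * Real.exp (-(5 * (Q / 2 + A0) * T * L)) ≤ S := by
  have hα0 : 0 ≤ α := by rw [hα]; positivity
  set Y := Real.exp ((Q + 2 * α) * d) with hY
  have hY1 : 1 ≤ Y := Real.one_le_exp (by positivity)
  have hPα : P ≤ α * (κ * I / 2) := by
    have h1 : A0 ≤ α := by rw [hα]; exact le_mul_of_one_le_right hA0 hT
    rw [div_le_iff₀ (by positivity)] at hA1
    have := mul_le_mul_of_nonneg_right h1 (by positivity : 0 ≤ κ * I)
    linarith
  have hPe : P * Real.exp (-α) ≤ κ * I / 2 := by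
    have h1 : α * Real.exp (-α) ≤ 1 := by
      rw [Real.exp_neg, ← div_eq_mul_inv, div_le_one (Real.exp_pos _)]
      have := Real.add_one_le_exp α; linarith
    have h2 := mul_le_mul_of_nonneg_right hPα (Real.exp_pos (-α)).le
    have h3 := mul_le_mul_of_nonneg_right h1 (by positivity : 0 ≤ κ * I / 2)
    linarith
  have h1 : κ * I * w0 ≤ (P * (Y * S ^ 2 + Real.exp (-α)) + κ * S ^ 2 * ω) * w0 := by
    have a1 := mul_le_mul_of_nonneg_left (mul_le_mul_of_nonneg_right hwl (sq_nonneg S)) hP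
    have a2 := mul_le_mul_of_nonneg_left hw1 hP
    linarith
  have h2 : κ * I ≤ P * (Y * S ^ 2 + Real.exp (-α)) + κ * S ^ 2 * ω := le_of_mul_le_mul_right h1 hw0
  have h3 : κ * I / 2 ≤ (P + κ * ω + 1) * (Y * S ^ 2) := by
    have a1 : κ * ω * S ^ 2 ≤ κ * ω * (Y * S ^ 2) := by
      gcongr; exact le_mul_of_one_le_left (sq_nonneg _) hY1
    have a2 : 0 ≤ Y * S ^ 2 := by positivity
    linarith
  have h4 : κ * I / (2 * (P + κ * ω + 1)) ≤ Y * S ^ 2 := by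
    rw [div_le_iff₀ (by positivity)]; linarith
  have h5 : Real.exp (-(5 * (Q / 2 + A0) * T * L)) ^ 2 * Y ≤ 1 := by
    rw [hY, ← Real.exp_nat_mul, ← Real.exp_add]
    apply Real.exp_le_one_iff.2
    have a1 : (Q + 2 * α) * d ≤ (Q + 2 * α) * (5 * L) := by gcongr
    have hL : 0 ≤ L := by linarith
    have a2 : Q * L * 1 ≤ Q * L * T := by gcongr
    rw [hα] at a1 ⊢
    push_cast
    linarith
  refine le_of_sq_le_sq ?_ hS
  rw [mul_pow, Real.sq_sqrt (by positivity)]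
  calc _ ≤ Y * S ^ 2 * Real.exp (-(5 * (Q / 2 + A0) * T * L)) ^ 2 := by gcongr
    _ = S ^ 2 * (Real.exp (-(5 * (Q / 2 + A0) * T * L)) ^ 2 * Y) := by ring
    _ ≤ S ^ 2 * 1 := by gcongr
    _ = S ^ 2 := mul_one _

end BG



open BG in
/-- Bourgain–Kenig type quantitative uniqueness
(Theorem `main` of the paper). -/
theorem bourgain_kenig_quantitative_uniqueness
    (m k : ℕ) (hm : 1 ≤ m) (hk : 1 ≤ k) (γ : ℝ) (hγ : 0 < γ)
    (lam Λ : ℝ) (hlam : 0 < lam) (hΛ : 0 < Λ) :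
    ∃ R₀ : ℝ, 0 < R₀ ∧ R₀ ≤ 1 / 2 ∧
      ∃ C₁ C₂ : ℝ → ℝ, (∀ s : ℝ, 0 < s → 0 < C₁ s ∧ 0 < C₂ s) ∧
        ∀ A : E m k → Matrix (Fin (m + k)) (Fin (m + k)) ℝ,
          C1coeff A → Symm A → Elliptic lam A → A 0 = 1 → HypH γ Λ A →
          ∀ K : ℝ, 0 ≤ K → ∀ V u : E m k → ℝ,
            ContDiffOn ℝ 2 u (ball γ 1) →
            (∀ p ∈ ball γ 1, |u p| ≤ 1) →
            (∀ p ∈ ball γ 1, Lop γ A u p = V p * u p) →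
            (∀ p ∈ ball γ 1, |V p| ≤ K * psi γ p) →
            0 < (∫ p in ball γ (R₀ / 4), u p ^ 2 * psi γ p) →
            ∀ r : ℝ, 0 < r → r < R₀ / 9 →
              C₁ (∫ p in ball γ (R₀ / 4), u p ^ 2 * psi γ p) *
                  (r / R₀) ^ (C₂ (∫ p in ball γ (R₀ / 4), u p ^ 2 * psi γ p)
                    * (K ^ ((2 : ℝ) / 3) + 1))
                ≤ ⨆ p ∈ ball γ r, |u p| := by
  obtain ⟨M, D2, hM, hD2, hcut⟩ := cutoffs
  obtain ⟨C, hC⟩ : ∃ C, C = CU m k γ Λ lam := ⟨_, rfl⟩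
  have hC1 : 1 ≤ C := hC ▸ CU_ge hγ hΛ hlam
  have hC0 : 0 < C := by linarith
  obtain ⟨G, hG⟩ : ∃ G, G = 6 * C ^ 3 / lam * (4 * C / lam + 10 * C + 4 * C / lam * (2 * C ^ 2)) := ⟨_, rfl⟩
  have hG0 : 0 ≤ G := by rw [hG]; positivity
  obtain ⟨e, he⟩ : ∃ e, e = 1 / (1000 * C ^ 2 + 64 * G + 1) := ⟨_, rfl⟩
  have hden : 0 < 1000 * C ^ 2 + 64 * G + 1 := by positivity
  have he0 : 0 < e := by rw [he]; positivity
  have hem : 1000 * C ^ 2 * e + 64 * G * e + e = 1 := by rw [he]; field_simp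
  have hx1 : 0 ≤ 1000 * C ^ 2 * e := by positivity
  have hx2 : 0 ≤ 64 * G * e := by positivity
  have he1 : e < 1 / 4 := by
    have : 1000 * 1 ^ 2 * e ≤ 1000 * C ^ 2 * e := by gcongr
    linarith
  have hDD : 0 ≤ 64 * DD C lam M := by unfold DD; positivity
  set s0 : ℝ := 2 * Real.log e - 4 with hs0
  have hlog : Real.log e < 0 := Real.log_neg he0 (by linarith)
  have heb : Real.exp ((s0 + 4) / 2) = e := by
    rw [hs0, show (2 * Real.log e - 4 + 4) / 2 = Real.log e by ring, Real.exp_log he0]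
  have hR4 : Real.exp s0 = 4 * Real.exp s0 / 4 := by ring
  set Q := QQ m k γ with hQ
  have hQ0 : 0 ≤ Q := by rw [hQ]; unfold QQ; positivity
  set ω := (volume (ball (m := m) (k := k) γ 1)).toReal with hω
  have hω0 : 0 ≤ ω := ENNReal.toReal_nonneg
  set P : ℝ := 64 * DD C lam M * D2 * ω with hP
  have hP0 : 0 ≤ P := by positivity
  set κ := Real.exp (s0 / 2) with hκ
  have hκ0 : 0 < κ := Real.exp_pos _
  refine ⟨4 * Real.exp s0, by positivity, ?_, fun I => √(κ * I / (2 * (P + κ * ω + 1))),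
    fun I => 5 * (Q / 2 + (100 * C ^ 2 + 1 + 2 * P / (κ * I))), ?_, ?_⟩
  · have h1 : Real.exp s0 ≤ Real.exp (Real.log e) := Real.exp_le_exp.2 (by linarith)
    have h2 : Real.exp s0 = e ^ 2 * Real.exp (-4) := by
      rw [← Real.exp_log he0, ← Real.exp_nat_mul, ← Real.exp_add, hs0]; congr 1
    have h3 : Real.exp (-4) ≤ 1 := Real.exp_le_one_iff.2 (by norm_num)
    have h4 : e ^ 2 * Real.exp (-4) ≤ (1 / 4) ^ 2 * 1 := by gcongr
    rw [h2]; linarith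
  · intro I hI
    constructor <;> positivity
  intro A hA hsym hE _ hH K hK0 V u hu hu1 hL hV hI r hr hr9
  rw [← hR4] at hI ⊢
  set I := ∫ p in ball γ (Real.exp s0), u p ^ 2 * psi γ p with hIdef
  set R := 4 * Real.exp s0 with hR
  have hR0 : 0 < R := by positivity
  obtain ⟨A0, hA0⟩ : ∃ A0, A0 = 100 * C ^ 2 + 1 + 2 * P / (κ * I) := ⟨_, rfl⟩
  have hA0f : 0 ≤ 2 * P / (κ * I) := by positivity
  have hA01 : 100 * C ^ 2 + 1 ≤ A0 := by linarith
  have hA00 : 1 ≤ A0 := by have : 0 ≤ 100 * C ^ 2 := by positivity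
                           linarith
  show √(κ * I / (2 * (P + κ * ω + 1))) * (r / R) ^ (5 * (Q / 2 + (100 * C ^ 2 + 1 + 2 * P / (κ * I)))
    * (K ^ ((2 : ℝ) / 3) + 1)) ≤ _
  rw [← hA0]
  set T := K ^ ((2 : ℝ) / 3) + 1 with hT
  have hk0 : 0 ≤ K ^ ((2 : ℝ) / 3) := Real.rpow_nonneg hK0 _
  have hT1 : 1 ≤ T := by linarith
  obtain ⟨α, hα⟩ : ∃ α, α = A0 * T := ⟨_, rfl⟩
  have hαA : A0 ≤ α := by rw [hα]; exact le_mul_of_one_le_right (by linarith) hT1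
  have hαT : K ^ ((2 : ℝ) / 3) ≤ α := by
    have : T ≤ α := by rw [hα]; exact le_mul_of_one_le_left (by linarith) hA00
    linarith
  have hK2 : K ^ 2 ≤ α ^ 3 := by
    have : K ^ 2 = (K ^ ((2 : ℝ) / 3)) ^ 3 := by
      rw [← Real.rpow_natCast, ← Real.rpow_natCast, ← Real.rpow_mul hK0]; norm_num
    rw [this]; gcongr
  set l := Real.log r - 1 with hl
  have hL1 : 1 ≤ Real.log (R / r) := by
    rw [Real.le_log_iff_exp_le (by positivity)]
    have h1 := Real.exp_one_lt_d9
    rw [le_div_iff₀ hr]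
    have : Real.exp 1 * r ≤ 9 * r := by gcongr; linarith
    linarith
  have hLe : Real.log (R / r) = Real.log 4 + s0 - Real.log r := by
    rw [Real.log_div hR0.ne' hr.ne', hR, Real.log_mul (by norm_num) (Real.exp_pos _).ne', Real.log_exp]
  have hlog4 : 0 ≤ Real.log 4 := Real.log_nonneg (by norm_num)
  have hls : l ≤ s0 := by
    have h1 : Real.log r ≤ s0 := by
      rw [Real.log_le_iff_le_exp hr]; linarith
    linarith
  have hs1 : s0 + 4 < 0 := by linarith
  have hrR : r ≤ 1 := by
    have : Real.exp s0 ≤ 1 := Real.exp_le_one_iff.2 (by linarith)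
    linarith
  -- the supremum
  have hinner : ∀ p : E m k, (⨆ _ : p ∈ ball γ r, |u p|) ≤ 1 := by
    intro p
    refine Real.iSup_le (fun hp => hu1 p ?_) (by norm_num)
    exact lt_of_lt_of_le hp hrR
  have hbdd : BddAbove (range fun p : E m k => ⨆ _ : p ∈ ball γ r, |u p|) :=
    ⟨1, by rintro _ ⟨p, rfl⟩; exact hinner p⟩
  have hSge : ∀ p ∈ ball (m := m) (k := k) γ r, |u p| ≤ ⨆ p ∈ ball γ r, |u p| := by
    intro p hp
    refine le_trans ?_ (le_ciSup hbdd p)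
    show |u p| ≤ ⨆ _ : p ∈ ball γ r, |u p|
    rw [ciSup_pos hp]
  set S := ⨆ p ∈ ball (m := m) (k := k) γ r, |u p| with hSdef
  have hS0 : 0 ≤ S := Real.iSup_nonneg fun p => Real.iSup_nonneg fun _ => abs_nonneg _
  have hS : ∀ p : E m k, rho γ p ≤ Real.exp l → |u p| ≤ S := by
    intro p hp
    refine hSge p (lt_of_le_of_lt hp ?_)
    rw [← Real.lt_log_iff_exp_lt hr]; linarith
  obtain ⟨χ, η, hχ, hη, hχ0, hη0, hMη, hχ1, hJ, hJs⟩ := hcut l s0 hls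
  obtain ⟨i1, i2, h12⟩ := carleman (α := α) (K := K) (M := M) hm hγ hΛ hlam hA hsym hE hH hu hC hC0 (by linarith) hs1
    (by rw [heb]; linarith) (by rw [heb, ← hG]; linarith) hL hV hK0 hK2 hχ hη hχ0 hη0 hM hMη
  have hc := core hm hγ (by linarith : 1 ≤ α) hQ0 hls hs1 hD2 hDD hu1 hS0 hS hχ1 hJ hJs i1 i2 h12
  have hrw : (r / R) ^ (5 * (Q / 2 + A0) * T) = Real.exp (-(5 * (Q / 2 + A0) * T * Real.log (R / r))) := by
    rw [Real.rpow_def_of_pos (by positivity), ← inv_div, Real.log_inv]; congr 1; ring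
  rw [hrw]
  refine final_scalar (d := s0 - (l - 3)) (w0 := WW α Q s0) (wl := WW α Q (l - 3)) (w1 := WW α Q (s0 + 1)) (α := α)
    hP0 hκ0 hω0 hI hS0 hQ0 (by linarith) ?_ hT1 hα (by linarith) (by linarith) (WW_pos _ _ _)
    (WW_up (by linarith) (by linarith)) ?_ ?_
  · rw [hA0]; have : 0 ≤ 100 * C ^ 2 := by positivity
    linarith
  · refine (WW_dec (by linarith) hQ0 (by linarith : s0 ≤ s0 + 1) (by linarith)).trans (le_of_eq ?_)
    congr 2; ring
  · refine hc.trans (le_of_eq ?_)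
    rw [hP]; ring
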